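/- Let f = x³y + y³ + z² ∈ ℂ(x,y,z) and let ℂ(f) be the subfield of ℂ(x,y,z) generated by f over ℂ. Let K be a field that is a finite field extension of ℂ(f), and assume that L := K ⊗_{ℂ(f)} ℂ(x,y,z) is a field. Then there exist elements g, h ∈ L such that L is generated as a field over (the image of) K by g and h if and only if there exists ρ ∈ K with ρ¹⁸ = f. -/

import Mathlib

section

open MvPolynomial TensorProduct

set_option synthInstance.maxHeartbeats 1000000
set_option maxHeartbeats 2000000

noncomputable section

/-- The field ℂ(x,y,z): fraction field of the polynomial ring in 3 variables. -/
abbrev Fxyz : Type := FractionRing (MvPolynomial (Fin 3) ℂ)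

/-- The images of the variables x, y, z in ℂ(x,y,z). -/
def Vx : Fxyz := algebraMap (MvPolynomial (Fin 3) ℂ) Fxyz (X 0)
def Vy : Fxyz := algebraMap (MvPolynomial (Fin 3) ℂ) Fxyz (X 1)
def Vz : Fxyz := algebraMap (MvPolynomial (Fin 3) ℂ) Fxyz (X 2)

/-- The element f of ℂ(x,y,z). -/
def fE7 : Fxyz := Vx ^ 3 * Vy + Vy ^ 3 + Vz ^ 2

/-- The subfield ℂ(f) of ℂ(x,y,z) generated by f over ℂ. -/
def Cf : IntermediateField ℂ Fxyz := IntermediateField.adjoin ℂ {fE7}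

end

end

section CyclicNorm
variable {A : Type*} [CommRing A]

/-- The product of the first `p` conjugates of `a` under the automorphism `σ`. -/
def cyclicNorm (σ : RingAut A) (p : ℕ) (a : A) : A := ∏ i ∈ Finset.range p, (σ ^ i) a

theorem cyclicNorm_mul (σ : RingAut A) (p : ℕ) (a b : A) :
    cyclicNorm σ p (a * b) = cyclicNorm σ p a * cyclicNorm σ p b := by
  simp [cyclicNorm, Finset.prod_mul_distrib]

theorem cyclicNorm_pow (σ : RingAut A) (p : ℕ) (a : A) (n : ℕ) :
    cyclicNorm σ p (a ^ n) = cyclicNorm σ p a ^ n := by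
  simp [cyclicNorm, Finset.prod_pow]

theorem map_cyclicNorm {σ : RingAut A} {p : ℕ} (hσ : σ ^ p = 1) (a : A) :
    σ (cyclicNorm σ p a) = cyclicNorm σ p a := by
  rcases p with _ | p
  · simp [cyclicNorm]
  · have h : ∀ i, σ ((σ ^ i) a) = (σ ^ (i + 1)) a := fun i => by rw [pow_succ']; rfl
    rw [cyclicNorm, map_prod, Finset.prod_congr rfl (fun i _ => h i), Finset.prod_range_succ, hσ,
      Finset.prod_range_succ']
    simp

variable [IsDomain A]

theorem cyclicNorm_ne_zero (σ : RingAut A) (p : ℕ) {a : A} (ha : a ≠ 0) :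
    cyclicNorm σ p a ≠ 0 :=
  Finset.prod_ne_zero_iff.2 fun i _ => (map_ne_zero_iff _ (σ ^ i : RingAut A).injective).2 ha

omit [IsDomain A] in
theorem associated_pow_apply {σ : RingAut A} {a : A} (h : Associated (σ a) a) (i : ℕ) :
    Associated ((σ ^ i) a) a := by
  induction i with
  | zero => simp
  | succ i ih =>
    rw [pow_succ]
    exact (h.map (σ ^ i : RingAut A)).trans ih

omit [IsDomain A] in
theorem associated_apply_of_pow {σ : RingAut A} {p : ℕ} (hp : p.Prime) (hσ : σ ^ p = 1) {a : A}
    {n : ℕ} (hn : ¬ p ∣ n) (h : Associated ((σ ^ n) a) a) : Associated (σ a) a := by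
  obtain ⟨r, -, hr⟩ := Nat.exists_mul_mod_eq_one_of_coprime
    ((Nat.Prime.coprime_iff_not_dvd hp).2 hn).symm hp.one_lt
  have h1 := associated_pow_apply h r
  rwa [← pow_mul, pow_eq_pow_mod _ hσ, hr, pow_one] at h1

theorem isRelPrime_conj {σ : RingAut A} {p : ℕ} (hp : p.Prime) (hσ : σ ^ p = 1) {q : A}
    (hq : Prime q) (h : ¬ Associated (σ q) q) {i j : ℕ} (hij : i < j) (hj : j < p) :
    IsRelPrime ((σ ^ i) q) ((σ ^ j) q) := by
  have hpr : ∀ n : ℕ, Prime ((σ ^ n : RingAut A) q) := fun n =>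
    (MulEquiv.prime_iff (σ ^ n : RingAut A)).2 hq
  rw [(hpr i).irreducible.isRelPrime_iff_not_dvd]
  intro hd
  have ha := (hpr i).irreducible.associated_of_dvd (hpr j).irreducible hd
  obtain ⟨n, rfl⟩ := Nat.exists_eq_add_of_lt hij
  have ha2 := ha.map ((σ ^ i : RingAut A)⁻¹ : RingAut A)
  rw [add_assoc, pow_add] at ha2
  have e1 : ((σ ^ i : RingAut A)⁻¹) ((σ ^ i) q) = q := RingEquiv.symm_apply_apply _ _
  have e2 : ((σ ^ i : RingAut A)⁻¹) ((σ ^ i * σ ^ (n + 1)) q) = (σ ^ (n + 1)) q :=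
    RingEquiv.symm_apply_apply _ _
  rw [e1, e2] at ha2
  exact h (associated_apply_of_pow hp hσ (Nat.not_dvd_of_pos_of_lt (by omega) (by omega)) ha2.symm)

theorem exists_pow_decomp_of_mul {q t b : A} {p : ℕ} (hq : Prime q) (ht : ¬ q ∣ t)
    (h : ∃ j c, t * b = q ^ (p * j) * c ∧ ¬ q ∣ c) : ∃ j c, b = q ^ (p * j) * c ∧ ¬ q ∣ c := by
  obtain ⟨j, c, h1, hc⟩ := h
  obtain ⟨c', rfl⟩ := hq.pow_dvd_of_dvd_mul_left _ ht ⟨c, h1⟩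
  refine ⟨j, c', rfl, fun hd => hc ?_⟩
  have : c = t * c' := mul_left_cancel₀ (pow_ne_zero (p * j) hq.ne_zero) (by rw [← h1]; ring)
  rw [this]; exact hd.mul_left t

theorem associated_of_mul_left_fixed {σ : RingAut A} {t b : A} (ht0 : t ≠ 0)
    (ht : Associated (σ t) t) (h : Associated (σ (t * b)) (t * b)) : Associated (σ b) b := by
  rw [map_mul] at h
  exact h.of_mul_left ht (by simpa using ht0)

theorem exists_cyclicNorm_associated [UniqueFactorizationMonoid A] {σ : RingAut A} {p : ℕ}
    (hp : p.Prime) (hσ : σ ^ p = 1) (a : A) (ha : a ≠ 0) (haσ : Associated (σ a) a)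
    (hval : ∀ q, Prime q → Associated (σ q) q → ∃ j c, a = q ^ (p * j) * c ∧ ¬ q ∣ c) :
    ∃ h, h ≠ 0 ∧ Associated a (cyclicNorm σ p h) := by
  induction a using (wellFounded_dvdNotUnit (α := A)).induction with
  | _ a ih =>
  by_cases hu : IsUnit a
  · exact ⟨1, one_ne_zero, by simpa [cyclicNorm] using associated_one_iff_isUnit.2 hu⟩
  obtain ⟨q, hqi, hqa⟩ := WfDvdMonoid.exists_irreducible_factor hu ha
  have hq := hqi.prime
  by_cases hqs : Associated (σ q) q
  · obtain ⟨j, c, rfl, hc⟩ := hval q hq hqs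
    have hc0 : c ≠ 0 := right_ne_zero_of_mul ha
    have hj : j ≠ 0 := by
      rintro rfl
      simp only [mul_zero, pow_zero, one_mul] at hqa
      exact hc hqa
    have hqs' : Associated (σ (q ^ (p * j))) (q ^ (p * j)) := by
      rw [map_pow]; exact hqs.pow_pow
    have hnu : ¬ IsUnit (q ^ (p * j)) := fun h =>
      hq.not_isUnit ((isUnit_pow_iff (mul_ne_zero hp.ne_zero hj)).1 h)
    obtain ⟨h, h0, hh⟩ := ih c ⟨hc0, _, hnu, mul_comm _ _⟩ hc0
      (associated_of_mul_left_fixed (pow_ne_zero _ hq.ne_zero) hqs' haσ) (by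
        intro r hr hrs
        by_cases hrq : r ∣ q
        · refine ⟨0, c, by simp, fun hrc => hc ?_⟩
          exact (hr.irreducible.associated_of_dvd hqi hrq).symm.dvd.trans hrc
        · exact exists_pow_decomp_of_mul hr (fun h => hrq (hr.dvd_of_dvd_pow h)) (hval r hr hrs))
    refine ⟨q ^ j * h, mul_ne_zero (pow_ne_zero _ hq.ne_zero) h0, ?_⟩
    rw [cyclicNorm_mul, cyclicNorm_pow, pow_mul]
    refine Associated.mul_mul (Associated.pow_pow ?_) hh
    have := Associated.prod (Finset.range p) (fun i => (σ ^ i) q) (fun _ => q)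
      (fun i _ => associated_pow_apply hqs i)
    rw [Finset.prod_const, Finset.card_range] at this
    exact this.symm
  · have hN : cyclicNorm σ p q ∣ a := by
      apply Finset.prod_dvd_of_isRelPrime
      · intro i hi j hj hij
        simp only [Finset.coe_range, Set.mem_Iio] at hi hj
        rcases lt_or_gt_of_ne hij with h | h
        · exact isRelPrime_conj hp hσ hq hqs h hj
        · exact (isRelPrime_conj hp hσ hq hqs h hi).symm
      · intro i _
        exact (map_dvd (σ ^ i : RingAut A) hqa).trans (associated_pow_apply haσ i).dvd
    obtain ⟨c, rfl⟩ := hN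
    have hN0 := left_ne_zero_of_mul ha
    have hc0 := right_ne_zero_of_mul ha
    have hqN : q ∣ cyclicNorm σ p q := by
      have := Finset.dvd_prod_of_mem (fun i => (σ ^ i) q) (Finset.mem_range.2 hp.pos)
      exact this
    obtain ⟨h, h0, hh⟩ := ih c ⟨hc0, _, fun h => hq.not_isUnit (isUnit_of_dvd_unit hqN h),
        mul_comm _ _⟩ hc0
      (associated_of_mul_left_fixed hN0 (by rw [map_cyclicNorm hσ]) haσ) (by
        intro r hr hrs
        refine exists_pow_decomp_of_mul hr (fun hrN => hqs ?_) (hval r hr hrs)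
        obtain ⟨i, -, hi⟩ := (hr.dvd_finsetProd_iff _).1 hrN
        have hpi := (MulEquiv.prime_iff (σ ^ i : RingAut A)).2 hq
        have hri := hr.irreducible.associated_of_dvd hpi.irreducible hi
        have h1 : Associated (σ ((σ ^ i) q)) ((σ ^ i) q) :=
          ((hri.map σ).symm.trans hrs).trans hri
        have h2 := h1.map ((σ ^ i : RingAut A)⁻¹ : RingAut A)
        have e1 : ((σ ^ i : RingAut A)⁻¹) ((σ ^ i) q) = q := RingEquiv.symm_apply_apply _ _
        have e2 : ((σ ^ i : RingAut A)⁻¹) (σ ((σ ^ i) q)) = σ q := by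
          have : σ ((σ ^ i) q) = (σ ^ i) (σ q) := by
            change (σ * σ ^ i) q = (σ ^ i * σ) q
            rw [← pow_succ, ← pow_succ']
          rw [this]; exact RingEquiv.symm_apply_apply _ _
        rwa [e1, e2] at h2)
    exact ⟨q * h, mul_ne_zero hq.ne_zero h0, by rw [cyclicNorm_mul]; exact hh.mul_left _⟩

end CyclicNorm

section PrimeValuation

open WithZero
variable {A : Type*} [CommRing A] [IsDomain A] [UniqueFactorizationMonoid A]

theorem finiteMultiplicity_of_prime {q a : A} (hq : Prime q) (ha : a ≠ 0) :
    FiniteMultiplicity q a := FiniteMultiplicity.of_not_isUnit hq.not_isUnit ha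

open Classical in
/-- The valuation of a factorial domain attached to a prime element. -/
noncomputable def primeValuation {q : A} (hq : Prime q) : Valuation A (WithZero (Multiplicative ℤ)) where
  toFun a := if a = 0 then 0 else exp (-(multiplicity q a : ℤ))
  map_zero' := by simp
  map_one' := by simp [multiplicity_eq_zero.2 (fun h => hq.not_isUnit (isUnit_of_dvd_one h))]
  map_mul' a b := by
    by_cases ha : a = 0
    · simp [ha]
    by_cases hb : b = 0
    · simp [hb]
    have hab := mul_ne_zero ha hb
    simp only [ha, hb, hab, if_false]
    rw [multiplicity_mul hq (finiteMultiplicity_of_prime hq hab), ← exp_add]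
    congr 1; push_cast; ring
  map_add_le_max' a b := by
    by_cases hab : a + b = 0
    · simp [hab]
    by_cases ha : a = 0
    · simp [ha]
    by_cases hb : b = 0
    · simp [hb]
    simp only [ha, hb, hab, if_false]
    rw [le_max_iff, exp_le_exp, exp_le_exp]
    have := (finiteMultiplicity_of_prime hq hab).pow_dvd_iff_le_multiplicity
      (k := min (multiplicity q a) (multiplicity q b))
    have h2 := this.1 (dvd_add ((pow_dvd_pow q (min_le_left _ _)).trans (pow_multiplicity_dvd q a))
      ((pow_dvd_pow q (min_le_right _ _)).trans (pow_multiplicity_dvd q b)))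
    omega

theorem primeValuation_apply {q a : A} (hq : Prime q) (ha : a ≠ 0) :
    primeValuation hq a = exp (-(multiplicity q a : ℤ)) := by
  simp [primeValuation, ha]

theorem primeValuation_le_one {q : A} (hq : Prime q) (a : A) : primeValuation hq a ≤ 1 := by
  by_cases ha : a = 0
  · simp [ha]
  · rw [primeValuation_apply hq ha, ← exp_zero, exp_le_exp]; omega

theorem primeValuation_map {q : A} (hq : Prime q) {σ : RingAut A} (hs : Associated (σ q) q) (a : A) :
    primeValuation hq (σ a) = primeValuation hq a := by
  by_cases ha : a = 0
  · simp [ha]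
  have ha' : σ a ≠ 0 := by simpa using ha
  rw [primeValuation_apply hq ha, primeValuation_apply hq ha']
  congr 3
  have h1 : multiplicity q (σ a) = multiplicity (σ q) (σ a) := multiplicity_eq_of_associated_left hs
  rw [h1]
  exact multiplicity_map_eq σ

variable {Ω : Type*} [Field Ω] [Algebra A Ω] [IsFractionRing A Ω]

/-- The extension of `primeValuation` to the fraction field. -/
noncomputable def primeValuationFrac (Ω : Type*) [Field Ω] [Algebra A Ω] [IsFractionRing A Ω]
    {q : A} (hq : Prime q) : Valuation Ω (WithZero (Multiplicative ℤ)) :=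
  (primeValuation hq).extendToLocalization (S := nonZeroDivisors A) (by
    intro a ha h
    have ha0 := nonZeroDivisors.ne_zero ha
    have : primeValuation hq a = 0 := h
    rw [primeValuation_apply hq ha0] at this
    exact exp_ne_zero this) Ω

theorem primeValuationFrac_algebraMap {q : A} (hq : Prime q) (a : A) :
    primeValuationFrac Ω hq (algebraMap A Ω a) = primeValuation hq a :=
  Valuation.extendToLocalization_apply_map_apply _ _ _ _

theorem exists_norm_of_valuations {σ : RingAut A} {p : ℕ} (hp : p.Prime) (hσ : σ ^ p = 1)
    {s : RingAut Ω} (hs : ∀ a : A, s (algebraMap A Ω a) = algebraMap A Ω (σ a))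
    {g : Ω} (hg0 : g ≠ 0) (hgs : s g = g)
    (hval : ∀ w : Valuation Ω (WithZero (Multiplicative ℤ)), (∀ a : A, w (algebraMap A Ω a) ≤ 1) →
      (∀ x, w (s x) = w x) → ∃ t, w g = w t ^ p) :
    ∃ (u : Aˣ) (h : Ω), h ≠ 0 ∧ g = algebraMap A Ω u * cyclicNorm s p h := by
  have inj := IsFractionRing.injective A Ω
  have hsi : ∀ (i : ℕ) (a : A), (s ^ i) (algebraMap A Ω a) = algebraMap A Ω ((σ ^ i) a) := by
    intro i
    induction i with
    | zero => intro a; simp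
    | succ i ih => intro a; rw [pow_succ, pow_succ]; change (s ^ i) (s _) = _; rw [hs, ih]; rfl
  have hnorm : ∀ a : A, cyclicNorm s p (algebraMap A Ω a) = algebraMap A Ω (cyclicNorm σ p a) := by
    intro a; simp only [cyclicNorm, map_prod, hsi]
  obtain ⟨n, d, hd, rfl⟩ := IsFractionRing.div_surjective (A := A) g
  have hd0 := nonZeroDivisors.ne_zero hd
  have hdΩ : algebraMap A Ω d ≠ 0 := by simpa using hd0
  set D := ∏ i ∈ Finset.range (p - 1), (σ ^ (i + 1)) d with hD
  have hDd : cyclicNorm σ p d = d * D := by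
    rw [cyclicNorm, ← Nat.sub_add_cancel hp.pos, Finset.prod_range_succ', hD]; simp [mul_comm]
  have hNd0 := cyclicNorm_ne_zero σ p hd0
  have hD0 : D ≠ 0 := fun h => hNd0 (by rw [hDd, h, mul_zero])
  have hn0 : n ≠ 0 := by rintro rfl; simp at hg0
  have ha : algebraMap A Ω (n * D) = algebraMap A Ω n / algebraMap A Ω d * algebraMap A Ω (cyclicNorm σ p d) := by
    rw [hDd, map_mul, map_mul]; field_simp
  have haσ : σ (n * D) = n * D := by
    apply inj
    rw [← hs, ha, map_mul, hgs, hs, map_cyclicNorm hσ]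
  obtain ⟨h, h0, v, hv⟩ := exists_cyclicNorm_associated hp hσ (n * D) (mul_ne_zero hn0 hD0)
    (by rw [haσ]) (by
      intro q hq hqs
      set w := primeValuationFrac Ω hq with hw
      have hwA : ∀ a, w (algebraMap A Ω a) = primeValuation hq a := primeValuationFrac_algebraMap hq
      have hws : ∀ x, w (s x) = w x := by
        intro x
        obtain ⟨b, c, hc, rfl⟩ := IsFractionRing.div_surjective (A := A) x
        rw [map_div₀ s, map_div₀, map_div₀, hs, hs, hwA, hwA, hwA, hwA, primeValuation_map hq hqs,
          primeValuation_map hq hqs]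
      obtain ⟨t, ht⟩ := hval w (fun a => by rw [hwA]; exact primeValuation_le_one hq a) hws
      have hNd : primeValuation hq (cyclicNorm σ p d) = primeValuation hq d ^ p := by
        rw [cyclicNorm, map_prod]
        have : ∀ i, primeValuation hq ((σ ^ i) d) = primeValuation hq d := fun i =>
          primeValuation_map hq (associated_pow_apply hqs i) d
        simp only [this, Finset.prod_const, Finset.card_range]
      have h1 : primeValuation hq (n * D) = w (t * algebraMap A Ω d) ^ p := by
        rw [← hwA, ha, map_mul, ht, hwA, hNd, map_mul, hwA, mul_pow]
      obtain ⟨b, c, hc, hbc⟩ := IsFractionRing.div_surjective (A := A) (t * algebraMap A Ω d)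
      have hc0 := nonZeroDivisors.ne_zero hc
      rw [← hbc, map_div₀, hwA, hwA] at h1
      have hnD0 := mul_ne_zero hn0 hD0
      have hb0 : b ≠ 0 := by
        rintro rfl
        rw [map_zero, zero_div, zero_pow hp.ne_zero, primeValuation_apply hq hnD0] at h1
        exact exp_ne_zero h1
      rw [primeValuation_apply hq hnD0, primeValuation_apply hq hb0, primeValuation_apply hq hc0,
        ← exp_sub, ← exp_nsmul, exp_inj] at h1
      have hfin := finiteMultiplicity_of_prime hq hnD0
      obtain ⟨e, he, hqe⟩ := hfin.exists_eq_pow_mul_and_not_dvd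
      have hdvd : p ∣ multiplicity q (n * D) := by
        rw [← Int.natCast_dvd_natCast]
        exact ⟨-(-(multiplicity q b : ℤ) - -(multiplicity q c : ℤ)), by
          rw [nsmul_eq_mul] at h1; linear_combination -h1⟩
      obtain ⟨j, hj⟩ := hdvd
      exact ⟨j, e, by rw [← hj]; exact he, hqe⟩)
  refine ⟨v⁻¹, algebraMap A Ω h / algebraMap A Ω d, by simp [h0, hd0], ?_⟩
  have hNdΩ : cyclicNorm s p (algebraMap A Ω d) ≠ 0 := cyclicNorm_ne_zero s p hdΩ
  have e1 : cyclicNorm s p (algebraMap A Ω h / algebraMap A Ω d) * cyclicNorm s p (algebraMap A Ω d) =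
      cyclicNorm s p (algebraMap A Ω h) := by
    rw [← cyclicNorm_mul, div_mul_cancel₀ _ hdΩ]
  apply mul_right_cancel₀ hNdΩ
  rw [mul_assoc, e1, hnorm, hnorm, ← ha, ← hv, ← map_mul]
  congr 1
  rw [mul_comm (v⁻¹ : Aˣ).val, mul_assoc, Units.mul_inv, mul_one]

end PrimeValuation

section Parity
variable {Ω : Type*} [Field Ω] {Γ : Type*} [LinearOrderedCommGroupWithZero Γ] (w : Valuation Ω Γ)

theorem one_le_of_one_le_mul {a b : Γ} (h : 1 ≤ a * b) (hb : b ≤ 1) : 1 ≤ a := by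
  by_contra! ha
  exact absurd h (not_le.2 ((mul_le_of_le_one_right zero_le hb).trans_lt ha))

theorem valuation_sq_eq_cube_left {x z d : Ω} (h : z ^ 2 = x ^ 3 + d) (hd : w d ≤ 1)
    (hx : 1 < w x) : w z ^ 2 = w x ^ 3 := by
  have h3 : 1 < w x ^ 3 := one_lt_pow₀ hx (by norm_num)
  rw [← map_pow, h, ← map_pow]
  apply Valuation.map_add_eq_of_lt_left
  rw [map_pow]; exact hd.trans_lt h3

theorem valuation_sq_eq_cube_right {x z d : Ω} (h : z ^ 2 = x ^ 3 + d) (hd : w d ≤ 1)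
    (hz : 1 < w z) : w z ^ 2 = w x ^ 3 := by
  have h3 : 1 < w z ^ 2 := one_lt_pow₀ hz (by norm_num)
  have : x ^ 3 = z ^ 2 - d := by rw [h]; ring
  rw [← map_pow, ← map_pow, this, Valuation.map_sub_eq_of_lt_left]
  rw [map_pow]; exact hd.trans_lt h3

theorem valuation_sub_le_one {a b : Ω} (ha : w a ≤ 1) (hb : w b ≤ 1) : w (a - b) ≤ 1 :=
  (w.map_sub a b).trans (max_le ha hb)

theorem valuation_add_le_one {a b : Ω} (ha : w a ≤ 1) (hb : w b ≤ 1) : w (a + b) ≤ 1 :=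
  (w.map_add a b).trans (max_le ha hb)

theorem valuation_mul_le_one {a b : Ω} (ha : w a ≤ 1) (hb : w b ≤ 1) : w (a * b) ≤ 1 := by
  rw [map_mul]; exact mul_le_one' ha hb

theorem exists_sq_of_conj {x z x0 z0 d : Ω} (h2 : w 2 = 1) (h3 : w 3 = 1)
    (h : z ^ 2 = x ^ 3 + d) (h0 : z0 ^ 2 = x0 ^ 3 + d) (hd : w d ≤ 1) (hx0 : w x0 ≤ 1)
    (hunit : w x0 = 1 ∨ w z0 = 1) (hconj : w (z + z0) = w (z - z0)) :
    ∃ t, w (x - x0) = w t ^ 2 := by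
  by_cases hx : 1 < w x
  · refine ⟨z / x, ?_⟩
    have hx' : w x ≠ 0 := (zero_lt_one.trans hx).ne'
    rw [Valuation.map_sub_eq_of_lt_left _ (hx0.trans_lt hx), map_div₀, div_pow,
      valuation_sq_eq_cube_left w h hd hx]
    field_simp
  push Not at hx
  have hz : w z ≤ 1 := by
    rw [← pow_le_one_iff (two_ne_zero), ← map_pow, h]
    exact valuation_add_le_one w (by rw [map_pow]; exact pow_le_one' hx 3) hd
  have hm : w z0 ≤ w (z - z0) := by
    have e : 2 * z0 = (z + z0) - (z - z0) := by ring
    calc w z0 = w (2 * z0) := by rw [map_mul, h2, one_mul]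
      _ ≤ max (w (z + z0)) (w (z - z0)) := by rw [e]; exact w.map_sub _ _
      _ = w (z - z0) := by rw [hconj, max_self]
  have hprod : w (z - z0) ^ 2 = w (x - x0) * w (x ^ 2 + x * x0 + x0 ^ 2) := by
    rw [← map_mul, pow_two]
    nth_rw 1 [← hconj]
    rw [← map_mul]; congr 1; linear_combination h - h0
  have hd1 := valuation_sub_le_one w hx hx0
  have hd2 : w (x ^ 2 + x * x0 + x0 ^ 2) ≤ 1 := by
    refine valuation_add_le_one w (valuation_add_le_one w ?_ (valuation_mul_le_one w hx hx0)) ?_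
    · rw [map_pow]; exact pow_le_one' hx 2
    · rw [map_pow]; exact pow_le_one' hx0 2
  by_cases h1 : w (x - x0) = 1
  · exact ⟨1, by simp [h1]⟩
  refine ⟨z - z0, ?_⟩
  have hlt := lt_of_le_of_ne hd1 h1
  rcases hunit with hu | hu
  · have : w (x ^ 2 + x * x0 + x0 ^ 2) = 1 := by
      have e : x ^ 2 + x * x0 + x0 ^ 2 = 3 * x0 ^ 2 + (x - x0) * (x + 2 * x0) := by ring
      have e1 : w (3 * x0 ^ 2) = 1 := by rw [map_mul, map_pow, h3, hu]; simp
      rw [e, Valuation.map_add_eq_of_lt_left, e1]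
      rw [e1, map_mul]
      refine (mul_le_of_le_one_right zero_le ?_).trans_lt hlt
      exact valuation_add_le_one w hx (valuation_mul_le_one w h2.le hx0)
    rw [hprod, this, mul_one]
  · exfalso
    rw [hu] at hm
    have := one_le_of_one_le_mul ((one_le_pow₀ hm (n := 2)).trans_eq hprod) hd2
    exact absurd this (not_le.2 hlt)

theorem exists_cube_of_conj {x z x0 z0 d ω : Ω} (h2 : w 2 = 1) (h3 : w 3 = 1)
    (hω : ω ^ 2 + ω + 1 = 0)
    (h : z ^ 2 = x ^ 3 + d) (h0 : z0 ^ 2 = x0 ^ 3 + d) (hd : w d ≤ 1)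
    (hz0 : w z0 ≤ 1) (hunit : w x0 = 1 ∨ w z0 = 1) (hconj : w (ω * x - x0) = w (x - x0))
    (hconj2 : w (ω ^ 2 * x - x0) = w (x - x0)) :
    ∃ t, w (z - z0) = w t ^ 3 := by
  have hω3 : ω ^ 3 = 1 := by linear_combination (ω - 1) * hω
  have hwω : w ω = 1 := by
    have : w ω ^ 3 = 1 := by rw [← map_pow, hω3, map_one]
    exact (pow_eq_one_iff.1 this).resolve_right (by norm_num)
  have hw1 : w (ω - 1) = 1 := by
    have : w (ω - 1) ^ 2 = 1 := by
      rw [← map_pow]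
      have : (ω - 1) ^ 2 = - (3 * ω) := by linear_combination hω
      rw [this, Valuation.map_neg, map_mul, h3, hwω, one_mul]
    exact (pow_eq_one_iff.1 this).resolve_right (by norm_num)
  by_cases hz : 1 < w z
  · have hzx := valuation_sq_eq_cube_right w h hd hz
    have hz' : w z ≠ 0 := (zero_lt_one.trans hz).ne'
    refine ⟨z / x, ?_⟩
    rw [Valuation.map_sub_eq_of_lt_left _ (hz0.trans_lt hz), map_div₀, div_pow, ← hzx]
    field_simp
  have hx : w x ≤ 1 := by
    by_contra! hx
    have hzx := valuation_sq_eq_cube_left w h hd hx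
    have : 1 < w z ^ 2 := hzx ▸ one_lt_pow₀ hx (by norm_num)
    exact hz (by
      by_contra! hz1
      exact absurd this (not_lt.2 (pow_le_one' hz1 2)))
  push Not at hz
  have hm : w x0 ≤ w (x - x0) := by
    have e : (ω - 1) * x0 = (ω * x - x0) - ω * (x - x0) := by ring
    calc w x0 = w ((ω - 1) * x0) := by rw [map_mul, hw1, one_mul]
      _ ≤ max (w (ω * x - x0)) (w (ω * (x - x0))) := by rw [e]; exact w.map_sub _ _
      _ = w (x - x0) := by rw [hconj, map_mul, hwω, one_mul, max_self]
  have hprod : w (x - x0) ^ 3 = w (z - z0) * w (z + z0) := by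
    have : w (x - x0) ^ 3 = w (x - x0) * w (ω * x - x0) * w (ω ^ 2 * x - x0) := by
      rw [hconj, hconj2, pow_succ, pow_two]
    rw [this, ← map_mul, ← map_mul, ← map_mul]; congr 1
    linear_combination h0 - h + (x ^ 3) * hω3 + (- x ^ 2 * x0 * ω + x * x0 ^ 2) * hω
  have hd1 := valuation_sub_le_one w hz hz0
  have hd2 := valuation_add_le_one w hz hz0
  by_cases h1 : w (z - z0) = 1
  · exact ⟨1, by simp [h1]⟩
  refine ⟨x - x0, ?_⟩
  have hlt := lt_of_le_of_ne hd1 h1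
  rcases hunit with hu | hu
  · exfalso
    rw [hu] at hm
    have := one_le_of_one_le_mul ((one_le_pow₀ hm (n := 3)).trans_eq hprod) hd2
    exact absurd this (not_le.2 hlt)
  · have : w (z + z0) = 1 := by
      have e : z + z0 = 2 * z0 + (z - z0) := by ring
      have e1 : w (2 * z0) = 1 := by rw [map_mul, h2, hu]; simp
      rw [e, Valuation.map_add_eq_of_lt_left, e1]
      rwa [e1]
    rw [hprod, this, mul_one]

/-- Numerical data of the section `(V² - 2V + 4, V³ + 6V² - 6V + 8)` at a place where `V` is
integral. -/
theorem section_integral {V : Ω} (hn : ∀ n : ℕ, n ≠ 0 → w n = 1) (hV : w V ≤ 1) :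
    w (18 * V ^ 2 * (V ^ 3 + 2)) ≤ 1 ∧ w (V ^ 2 - 2 * V + 4) ≤ 1 ∧
      w (V ^ 3 + 6 * V ^ 2 - 6 * V + 8) ≤ 1 ∧
      (w (V ^ 2 - 2 * V + 4) = 1 ∨ w (V ^ 3 + 6 * V ^ 2 - 6 * V + 8) = 1) := by
  have hnat : ∀ n : ℕ, (n : Ω) ∈ w.integer := fun n => natCast_mem _ n
  have hV' : V ∈ w.integer := hV
  have hZ : ∀ n : ℕ, ∀ [n.AtLeastTwo], (OfNat.ofNat n : Ω) ∈ w.integer := fun n _ => hnat n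
  have m1 : V ^ 2 - 2 * V + 4 ∈ w.integer :=
    add_mem (sub_mem (pow_mem hV' 2) (mul_mem (hZ 2) hV')) (hZ 4)
  have m2 : V ^ 3 + 6 * V ^ 2 - 6 * V + 8 ∈ w.integer :=
    add_mem (sub_mem (add_mem (pow_mem hV' 3) (mul_mem (hZ 6) (pow_mem hV' 2)))
      (mul_mem (hZ 6) hV')) (hZ 8)
  refine ⟨?_, m1, m2, ?_⟩
  · exact mul_mem (mul_mem (hZ 18) (pow_mem hV' 2)) (add_mem (pow_mem hV' 3) (hZ 2))
  · by_contra! hcon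
    have l1 := lt_of_le_of_ne m1 hcon.1
    have l2 := lt_of_le_of_ne m2 hcon.2
    have e : (72 : Ω) = (V ^ 2 - 2 * V + 4) * (6 + (V + 2) * (V + 8)) -
        (V ^ 3 + 6 * V ^ 2 - 6 * V + 8) * (V + 2) := by ring
    have h72 : w (72 : Ω) = 1 := by exact_mod_cast hn 72 (by norm_num)
    have : w (72 : Ω) < 1 := by
      rw [e]
      refine (w.map_sub _ _).trans_lt (max_lt ?_ ?_)
      · rw [map_mul]
        refine (mul_le_of_le_one_right zero_le ?_).trans_lt l1
        exact add_mem (hZ 6) (mul_mem (add_mem hV' (hZ 2)) (add_mem hV' (hZ 8)))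
      · rw [map_mul]
        refine (mul_le_of_le_one_right zero_le ?_).trans_lt l2
        exact add_mem hV' (hZ 2)
    exact absurd h72 this.ne

/-- Numerical data of the rescaled section at a place where `V` has a pole, with `U = V⁻¹`. -/
theorem section_at_pole {U : Ω} (hU : w U < 1) :
    w (18 * U * (1 + 2 * U ^ 3)) ≤ 1 ∧ w (1 - 2 * U + 4 * U ^ 2) ≤ 1 ∧
      w (1 + 6 * U - 6 * U ^ 2 + 8 * U ^ 3) = 1 := by
  have hnat : ∀ n : ℕ, (n : Ω) ∈ w.integer := fun n => natCast_mem _ n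
  have hU' : U ∈ w.integer := hU.le
  have hZ : ∀ n : ℕ, ∀ [n.AtLeastTwo], (OfNat.ofNat n : Ω) ∈ w.integer := fun n _ => hnat n
  refine ⟨?_, ?_, ?_⟩
  · exact mul_mem (mul_mem (hZ 18) hU') (add_mem (one_mem _) (mul_mem (hZ 2) (pow_mem hU' 3)))
  · exact add_mem (sub_mem (one_mem _) (mul_mem (hZ 2) hU')) (mul_mem (hZ 4) (pow_mem hU' 2))
  · have e : 1 + 6 * U - 6 * U ^ 2 + 8 * U ^ 3 = 1 + U * (6 - 6 * U + 8 * U ^ 2) := by ring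
    rw [e, Valuation.map_add_eq_of_lt_left, map_one]
    rw [map_one, map_mul]
    refine (mul_le_of_le_one_right zero_le ?_).trans_lt hU
    exact add_mem (sub_mem (hZ 6) (mul_mem (hZ 6) hU')) (mul_mem (hZ 8) (pow_mem hU' 2))

variable {V X Z : Ω} (hn : ∀ n : ℕ, n ≠ 0 → w n = 1)
  (hE : Z ^ 2 = X ^ 3 + 18 * V ^ 2 * (V ^ 3 + 2))
include hn hE

theorem section_sq_of_conj
    (hconj : w (Z + (V ^ 3 + 6 * V ^ 2 - 6 * V + 8)) = w (Z - (V ^ 3 + 6 * V ^ 2 - 6 * V + 8))) :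
    ∃ t, w (X - (V ^ 2 - 2 * V + 4)) = w t ^ 2 := by
  have h2 : w (2 : Ω) = 1 := by exact_mod_cast hn 2 (by norm_num)
  have h3 : w (3 : Ω) = 1 := by exact_mod_cast hn 3 (by norm_num)
  rcases le_or_gt (w V) 1 with hV | hV
  · obtain ⟨a, b, -, d⟩ := section_integral w hn hV
    exact exists_sq_of_conj w h2 h3 hE (by ring) a b d hconj
  · have hw0 : w V ≠ 0 := (zero_lt_one.trans hV).ne'
    have hV0 : V ≠ 0 := by simpa using hw0
    obtain ⟨a, b, c⟩ := section_at_pole w (U := V⁻¹) (by rw [map_inv₀]; exact inv_lt_one_of_one_lt₀ hV)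
    obtain ⟨t, ht⟩ := exists_sq_of_conj w (x := X / V ^ 2) (z := Z / V ^ 3) h2 h3
      (by field_simp; linear_combination hE) (by field_simp; ring) a b (.inr c) (by
        have e1 : Z / V ^ 3 + (1 + 6 * V⁻¹ - 6 * V⁻¹ ^ 2 + 8 * V⁻¹ ^ 3) =
          (Z + (V ^ 3 + 6 * V ^ 2 - 6 * V + 8)) / V ^ 3 := by field_simp
        have e2 : Z / V ^ 3 - (1 + 6 * V⁻¹ - 6 * V⁻¹ ^ 2 + 8 * V⁻¹ ^ 3) =
          (Z - (V ^ 3 + 6 * V ^ 2 - 6 * V + 8)) / V ^ 3 := by field_simp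
        rw [e1, e2, map_div₀, map_div₀, hconj])
    refine ⟨V * t, ?_⟩
    rw [map_mul, mul_pow, ← ht, ← map_pow, ← map_mul]
    congr 1; field_simp

theorem section_cube_of_conj {ω : Ω} (hω : ω ^ 2 + ω + 1 = 0)
    (hconj : w (ω * X - (V ^ 2 - 2 * V + 4)) = w (X - (V ^ 2 - 2 * V + 4)))
    (hconj2 : w (ω ^ 2 * X - (V ^ 2 - 2 * V + 4)) = w (X - (V ^ 2 - 2 * V + 4))) :
    ∃ t, w (Z - (V ^ 3 + 6 * V ^ 2 - 6 * V + 8)) = w t ^ 3 := by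
  have h2 : w (2 : Ω) = 1 := by exact_mod_cast hn 2 (by norm_num)
  have h3 : w (3 : Ω) = 1 := by exact_mod_cast hn 3 (by norm_num)
  rcases le_or_gt (w V) 1 with hV | hV
  · obtain ⟨a, -, c, d⟩ := section_integral w hn hV
    exact exists_cube_of_conj w h2 h3 hω hE (by ring) a c d hconj hconj2
  · have hw0 : w V ≠ 0 := (zero_lt_one.trans hV).ne'
    have hV0 : V ≠ 0 := by simpa using hw0
    obtain ⟨a, -, c⟩ := section_at_pole w (U := V⁻¹) (by rw [map_inv₀]; exact inv_lt_one_of_one_lt₀ hV)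
    have e : ∀ c : Ω, c * (X / V ^ 2) - (1 - 2 * V⁻¹ + 4 * V⁻¹ ^ 2) =
        (c * X - (V ^ 2 - 2 * V + 4)) / V ^ 2 := by intro c; field_simp
    have e1 : X / V ^ 2 - (1 - 2 * V⁻¹ + 4 * V⁻¹ ^ 2) = (X - (V ^ 2 - 2 * V + 4)) / V ^ 2 := by
      field_simp
    obtain ⟨t, ht⟩ := exists_cube_of_conj w (x := X / V ^ 2) (z := Z / V ^ 3)
      (x0 := 1 - 2 * V⁻¹ + 4 * V⁻¹ ^ 2) h2 h3 hω
      (by field_simp; linear_combination hE) (by field_simp; ring) a c.le (.inr c)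
      (by rw [e, e1, map_div₀, map_div₀, hconj]) (by rw [e, e1, map_div₀, map_div₀, hconj2])
    refine ⟨V * t, ?_⟩
    rw [map_mul, mul_pow, ← ht, ← map_pow, ← map_mul]
    congr 1; field_simp

end Parity

section

open Polynomial

/-- The discriminant-like constant term `18 V² (V³ + 2)`. -/
noncomputable def dPoly (k : Type*) [Field k] : k[X] := C 18 * X ^ 2 * (X ^ 3 + C 2)

section PolyDescent
variable {k : Type*} [Field k] [CharZero k]

theorem sPoly_natDegree : (X ^ 3 + C 2 : k[X]).natDegree = 3 := by compute_degree!

theorem dPoly_natDegree : (dPoly k).natDegree = 5 := by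
  unfold dPoly; rw [show (C 18 * X ^ 2 * (X ^ 3 + C 2) : k[X]) = C 18 * X ^ 5 + C 36 * X ^ 2 by
    rw [show (36:k) = 18 * 2 by norm_num, C_mul]; ring]
  compute_degree!

theorem sPoly_squarefree : Squarefree (X ^ 3 + C 2 : k[X]) := by
  apply Separable.squarefree
  rw [Polynomial.Separable]
  refine ⟨C (1/2), - C (1/6) * X, ?_⟩
  simp only [derivative_add, derivative_X_pow, derivative_C]
  have h1 : (C (1/2) * C 2 : k[X]) = 1 := by rw [← C_mul]; norm_num
  have h2 : (C (1/6) * C ((3:ℕ):k) : k[X]) = C (1/2) := by rw [← C_mul]; norm_num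
  linear_combination h1 - h2 * X^3

theorem sPoly_coprime_X : IsCoprime (X ^ 3 + C 2 : k[X]) X := by
  refine ⟨C (1/2), - C (1/2) * X^2, ?_⟩
  have h1 : (C (1/2) * C 2 : k[X]) = 1 := by rw [← C_mul]; norm_num
  linear_combination h1

theorem isUnit_C18 : IsUnit (C 18 : k[X]) := isUnit_C.2 (by norm_num)

theorem dPoly_ne_zero : dPoly k ≠ 0 := by
  intro h; have := dPoly_natDegree (k := k); rw [h] at this; simp at this

theorem dvd_X_of_sq_dvd_dPoly {q : k[X]} (hq : Prime q) (h : q ^ 2 ∣ dPoly k) : q ∣ X := by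
  by_contra hX
  unfold dPoly at h
  have h1 : IsCoprime (q ^ 2) (X ^ 2) :=
    ((Irreducible.coprime_iff_not_dvd hq.irreducible).2 hX).pow
  have h2 : q ^ 2 ∣ X ^ 3 + C 2 := by
    have : q ^ 2 ∣ X^2 * (X ^ 3 + C 2) := by
      rw [mul_assoc] at h
      exact (isUnit_C18.dvd_mul_left).1 h
    exact h1.dvd_of_dvd_mul_left this
  rw [pow_two] at h2
  exact hq.not_isUnit (sPoly_squarefree q h2)

theorem integral_degrees {m n e : k[X]} (he : e ≠ 0) (h : n ^ 2 = m ^ 3 + dPoly k * e ^ 6) :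
    ∃ M, m.natDegree = 2 * M ∧ n.natDegree = 3 * M ∧ e.natDegree + 1 ≤ M := by
  have hD := dPoly_ne_zero (k := k)
  have h1 : (dPoly k * e ^ 6).natDegree = 5 + 6 * e.natDegree := by
    rw [natDegree_mul hD (pow_ne_zero _ he), dPoly_natDegree, natDegree_pow]
  have h2 : (m ^ 3).natDegree = 3 * m.natDegree := natDegree_pow _ _
  have h3 : (n ^ 2).natDegree = 2 * n.natDegree := natDegree_pow _ _
  rcases lt_trichotomy (m ^ 3).natDegree (dPoly k * e ^ 6).natDegree with hlt | heq | hgt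
  · have := natDegree_add_eq_right_of_natDegree_lt hlt
    rw [← h] at this; omega
  · omega
  · have := natDegree_add_eq_left_of_natDegree_lt hgt
    rw [← h] at this
    exact ⟨m.natDegree / 2, by omega, by omega, by omega⟩

theorem prime_dvd_both {m n e q : k[X]} (hme : IsCoprime m e)
    (h : n ^ 2 = m ^ 3 + dPoly k * e ^ 6) (hq : Prime q) (hm : q ∣ m) (hn : q ∣ n) :
    q ∣ X := by
  apply dvd_X_of_sq_dvd_dPoly hq
  have hqe : IsCoprime (q ^ 2) (e ^ 6) := (hme.of_isCoprime_of_dvd_left hm).pow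
  apply hqe.dvd_of_dvd_mul_right
  have : dPoly k * e ^ 6 = n ^ 2 - m ^ 3 := by rw [h]; ring
  rw [this]
  exact dvd_sub (pow_dvd_pow_of_dvd hn 2) ((pow_dvd_pow q (by norm_num)).trans (pow_dvd_pow_of_dvd hm 3))

omit [CharZero k] in
theorem isCoprime_of_forall_prime {a b : k[X]} (ha : a ≠ 0)
    (h : ∀ q, Prime q → q ∣ a → q ∣ b → False) : IsCoprime a b := by
  apply isCoprime_of_prime_dvd (by tauto)
  intro q hq h1 h2; exact h q hq h1 h2

theorem dvd_of_dvd_three_mul {m n e u : k[X]} (he : e ≠ 0) (hme : IsCoprime m e)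
    (h : n ^ 2 = m ^ 3 + dPoly k * e ^ 6)
    (hu : X ∣ m → X ∣ u) (hn : n ∣ C 3 * m ^ 2 * u) : n ∣ u := by
  obtain ⟨M, hM, hN, hMe⟩ := integral_degrees he h
  have hn0 : n ≠ 0 := by rintro rfl; simp at hN; omega
  have hn : n ∣ m ^ 2 * u := by
    rw [mul_assoc] at hn
    exact ((isUnit_C.2 (by norm_num : IsUnit (3 : k))).dvd_mul_left).1 hn
  by_cases hX : X ∣ m ∧ X ∣ n
  · obtain ⟨⟨m1, hm1⟩, n1, hn1⟩ := hX
    have hXe : ¬ (X : k[X]) ∣ e := fun hXe =>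
      prime_X.not_isUnit (hme.isUnit_of_dvd' ⟨m1, hm1⟩ hXe)
    have e1 : n1 ^ 2 = X * m1 ^ 3 + C 18 * (X ^ 3 + C 2) * e ^ 6 := by
      apply mul_left_cancel₀ (pow_ne_zero 2 (X_ne_zero (R := k)))
      rw [hm1, hn1, dPoly] at h
      linear_combination h
    have hXn1 : ¬ (X : k[X]) ∣ n1 := by
      intro hd
      have : (X : k[X]) ∣ C 36 * e ^ 6 := by
        have h36 : (C 36 : k[X]) = C 18 * C 2 := by rw [← C_mul]; norm_num
        have : C 36 * e ^ 6 = n1 ^ 2 - X * (m1 ^ 3 + C 18 * X ^ 2 * e ^ 6) := by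
          rw [e1, h36]; ring
        rw [this]
        exact dvd_sub (dvd_pow hd two_ne_zero) (dvd_mul_right _ _)
      rw [IsUnit.dvd_mul_left (isUnit_C.2 (by norm_num))] at this
      exact hXe (prime_X.dvd_of_dvd_pow this)
    have hn10 : n1 ≠ 0 := by rintro rfl; simp at hXn1
    have hc : IsCoprime n1 m := by
      apply isCoprime_of_forall_prime hn10
      intro q hq h1 h2
      have := prime_dvd_both hme h hq h2 (hn1 ▸ h1.mul_left X)
      have hass := (hq.irreducible.associated_of_dvd prime_X.irreducible this)
      exact hXn1 (hass.symm.dvd.trans h1)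
    have hcX : IsCoprime X n1 := (Irreducible.coprime_iff_not_dvd prime_X.irreducible).2 hXn1
    rw [hn1]
    apply hcX.mul_dvd (hu ⟨m1, hm1⟩)
    exact (hc.pow_right (n := 2)).dvd_of_dvd_mul_left ((hn1 ▸ dvd_mul_left n1 X).trans hn)
  · have hc : IsCoprime n m := by
      apply isCoprime_of_forall_prime hn0
      intro q hq h1 h2
      have := prime_dvd_both hme h hq h2 h1
      have hass := (hq.irreducible.associated_of_dvd prime_X.irreducible this)
      exact hX ⟨hass.symm.dvd.trans h2, hass.symm.dvd.trans h1⟩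
    exact (hc.pow_right (n := 2)).dvd_of_dvd_mul_left hn

end PolyDescent

section Rigidity
variable {k : Type*} [Field k] [CharZero k]

omit [CharZero k] in
theorem natDegree_mapCoeffs_le [Differential k] (p : k[X]) :
    (Differential.mapCoeffs p).natDegree ≤ p.natDegree := by
  rw [natDegree_le_iff_coeff_eq_zero]
  intro i hi
  rw [Differential.coeff_mapCoeffs, coeff_eq_zero_of_natDegree_lt hi, map_zero]

omit [CharZero k] in
theorem mapCoeffs_eq_zero_of_monic_dvd [Differential k] {p : k[X]} (hp : p.Monic)
    (h : p ∣ Differential.mapCoeffs p) : Differential.mapCoeffs p = 0 := by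
  refine eq_zero_of_dvd_of_degree_lt h ?_
  rw [degree_eq_natDegree hp.ne_zero, degree_lt_iff_coeff_zero]
  intro i hi
  rw [Differential.coeff_mapCoeffs]
  rcases hi.lt_or_eq with hi | hi
  · rw [coeff_eq_zero_of_natDegree_lt hi, map_zero]
  · rw [← hi, hp.coeff_natDegree, Derivation.map_one_eq_zero]

omit [CharZero k] in
theorem mapCoeffs_C_natCast [Differential k] (n : ℕ) [n.AtLeastTwo] :
    Differential.mapCoeffs (C (OfNat.ofNat n : k)) = 0 := by
  rw [Differential.mapCoeffs_C, ← Nat.cast_ofNat, Derivation.map_natCast, C_0]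

theorem rigidity_integral [Differential k] {m n e : k[X]} (he : e.Monic) (hme : IsCoprime m e)
    (h : n ^ 2 = m ^ 3 + dPoly k * e ^ 6) :
    Differential.mapCoeffs m = 0 ∧ Differential.mapCoeffs n = 0 ∧
      Differential.mapCoeffs e = 0 := by
  set δ : Derivation ℤ k[X] k[X] := Differential.mapCoeffs with hδ
  obtain ⟨M, hM, hN, hMe⟩ := integral_degrees he.ne_zero h
  have hn0 : n ≠ 0 := by rintro rfl; simp at hN; omega
  have hXd : δ X = 0 := Differential.mapCoeffs_X
  have h18 : δ (C 18) = 0 := mapCoeffs_C_natCast 18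
  have h2 : δ (C 2) = 0 := mapCoeffs_C_natCast 2
  have hD : δ (dPoly k) = 0 := by
    simp [dPoly, Derivation.leibniz, Derivation.leibniz_pow, hXd, h18, h2]
  have key := congrArg δ h
  simp only [map_add, Derivation.leibniz, Derivation.leibniz_pow, hD, smul_eq_mul, nsmul_eq_mul] at key
  norm_num at key
  have c3 : (C 3 : k[X]) = 3 := rfl
  have key2 : C 3 * m ^ 2 * (e * δ m - 2 * m * δ e) = n * (2 * e * δ n - 6 * n * δ e) := by
    rw [c3]
    linear_combination (-e) * key + 6 * (δ e) * h
  have hu : e * δ m - 2 * m * δ e = 0 := by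
    have hd : n ∣ e * δ m - 2 * m * δ e := by
      apply dvd_of_dvd_three_mul he.ne_zero hme h _ ⟨_, key2⟩
      rintro ⟨m1, rfl⟩
      rw [Derivation.leibniz, hXd]
      exact ⟨e * δ m1 - 2 * m1 * δ e, by simp; ring⟩
    apply eq_zero_of_dvd_of_natDegree_lt hd
    rw [hN]
    have b1 : (e * δ m).natDegree ≤ e.natDegree + 2 * M :=
      natDegree_mul_le.trans (by have : (δ m).natDegree ≤ _ := natDegree_mapCoeffs_le m; omega)
    have b2 : (2 * m * δ e).natDegree ≤ e.natDegree + 2 * M := by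
      have c2 : (C 2 : k[X]) = 2 := rfl
      rw [← c2, mul_assoc]
      refine (natDegree_C_mul_le _ _).trans (natDegree_mul_le.trans ?_)
      have : (δ e).natDegree ≤ _ := natDegree_mapCoeffs_le e; omega
    have := natDegree_sub_le_of_le b1 b2
    rw [max_self] at this
    omega
  have hde : δ e = 0 := by
    apply mapCoeffs_eq_zero_of_monic_dvd he
    have : e ∣ C 2 * m * δ e := ⟨δ m, by
      have c2 : (C 2 : k[X]) = 2 := rfl
      rw [c2]; linear_combination -hu⟩
    rw [mul_assoc, IsUnit.dvd_mul_left (isUnit_C.2 (by norm_num))] at this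
    exact hme.symm.dvd_of_dvd_mul_left this
  have hdm : δ m = 0 := by
    rw [hde, mul_zero, sub_zero] at hu
    exact (mul_eq_zero.1 hu).resolve_left he.ne_zero
  refine ⟨hdm, ?_, hde⟩
  rw [hdm, hde] at key
  simpa [hn0] using key

omit [CharZero k] in
theorem monic_eq_one_of_dvd {m e : k[X]} (he : e.Monic) (hme : IsCoprime m e) {j : ℕ}
    (h : e ∣ m ^ j) : e = 1 :=
  he.eq_one_of_isUnit ((hme.pow_left (m := j)).isUnit_of_dvd' h dvd_rfl)

theorem no_double {m n e : k[X]} (he : e.Monic) (hme : IsCoprime m e)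
    (h : n ^ 2 = m ^ 3 + dPoly k * e ^ 6)
    (h2 : m * (m ^ 3 - 8 * dPoly k * e ^ 6) = 4 * (X ^ 2 - C 2 * X + C 4) * e ^ 2 * n ^ 2) :
    False := by
  obtain rfl : e = 1 := monic_eq_one_of_dvd (j := 4) he hme
    ⟨8 * m * dPoly k * e ^ 5 + 4 * (X ^ 2 - C 2 * X + C 4) * e * n ^ 2, by linear_combination h2⟩
  obtain ⟨M, hM, hN, hMe⟩ := integral_degrees he.ne_zero h
  simp only [one_pow, mul_one, natDegree_one] at h h2 hMe
  have hn0 : n ≠ 0 := by rintro rfl; simp at hN; omega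
  have hm0 : m ≠ 0 := by rintro rfl; simp at hM; omega
  have hd : n ^ 2 ∣ m * dPoly k := by
    have c9 : (C 9 : k[X]) = 9 := rfl
    have : n ^ 2 ∣ C 9 * (m * dPoly k) :=
      ⟨m - 4 * (X ^ 2 - C 2 * X + C 4), by rw [c9]; linear_combination -h2 - m * h⟩
    rwa [IsUnit.dvd_mul_left (isUnit_C.2 (by norm_num))] at this
  obtain ⟨l, hl⟩ := hd
  have hprod : m * dPoly k ≠ 0 := mul_ne_zero hm0 dPoly_ne_zero
  have hl0 : l ≠ 0 := by rintro rfl; simp [hm0, dPoly_ne_zero] at hl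
  have hdeg := congrArg natDegree hl
  rw [natDegree_mul hm0 dPoly_ne_zero, natDegree_mul (pow_ne_zero _ hn0) hl0, natDegree_pow,
    dPoly_natDegree, hM, hN] at hdeg
  have hc : IsCoprime (X ^ 3 + C 2 : k[X]) n := by
    apply isCoprime_of_forall_prime (by intro h0; simpa [h0] using sPoly_natDegree (k := k))
    intro q hq h1 h2
    have hqD : q ∣ dPoly k := h1.mul_left _
    have hqm : q ∣ m := by
      apply hq.dvd_of_dvd_pow (n := 3)
      have : m ^ 3 = n ^ 2 - dPoly k := by rw [h]; ring
      rw [this]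
      exact dvd_sub (dvd_pow h2 two_ne_zero) hqD
    have := prime_dvd_both (e := 1) isCoprime_one_right (by simpa using h) hq hqm h2
    exact hq.not_isUnit (sPoly_coprime_X.isUnit_of_dvd' h1 this)
  have : (X ^ 3 + C 2 : k[X]) ∣ l := by
    apply (hc.pow_right (n := 2)).dvd_of_dvd_mul_left
    rw [← hl, dPoly]
    exact (dvd_mul_left _ _).mul_left _
  have := natDegree_le_of_dvd this hl0
  rw [sPoly_natDegree] at this
  omega

theorem no_cm_image {m n e : k[X]} (he : e.Monic) (hme : IsCoprime m e)
    (h : n ^ 2 = m ^ 3 + dPoly k * e ^ 6) (c : k)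
    (h2 : m ^ 3 + 4 * dPoly k * e ^ 6 = C c * (X ^ 2 - C 2 * X + C 4) * m ^ 2 * e ^ 2) :
    False := by
  obtain rfl : e = 1 := monic_eq_one_of_dvd (j := 3) he hme
    ⟨C c * (X ^ 2 - C 2 * X + C 4) * m ^ 2 * e - 4 * dPoly k * e ^ 5, by linear_combination h2⟩
  obtain ⟨M, hM, hN, hMe⟩ := integral_degrees he.ne_zero h
  simp only [one_pow, mul_one, natDegree_one] at h h2 hMe
  have hm0 : m ≠ 0 := by rintro rfl; simp at hM; omega
  have hd : m ^ 2 ∣ dPoly k := by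
    have c4 : (C 4 : k[X]) = 4 := rfl
    have : m ^ 2 ∣ C 4 * dPoly k :=
      ⟨C c * (X ^ 2 - C 2 * X + C 4) - m, by rw [c4]; rw [c4] at h2; linear_combination h2⟩
    rwa [IsUnit.dvd_mul_left (isUnit_C.2 (by norm_num))] at this
  have hc : IsCoprime m (X ^ 3 + C 2 : k[X]) := by
    apply isCoprime_of_forall_prime hm0
    intro q hq h1 h2
    have := dvd_X_of_sq_dvd_dPoly hq ((pow_dvd_pow_of_dvd h1 2).trans hd)
    exact hq.not_isUnit (sPoly_coprime_X.isUnit_of_dvd' h2 this)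
  have : m ^ 2 ∣ X ^ 2 := by
    rw [dPoly] at hd
    have := (hc.pow_left (m := 2)).dvd_of_dvd_mul_right hd
    rwa [IsUnit.dvd_mul_left (isUnit_C.2 (by norm_num))] at this
  have := natDegree_le_of_dvd this (by simp)
  rw [natDegree_pow, hM] at this
  simp at this
  omega

end Rigidity

section RationalPoints
variable {k : Type*} [Field k] [CharZero k] {F : Type*} [Field F] [Algebra k[X] F]
  [IsFractionRing k[X] F]

omit [CharZero k] in
theorem exists_weighted_denominator {x y : F} {D : k[X]}
    (h : y ^ 2 = x ^ 3 + algebraMap k[X] F D) :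
    ∃ m n e : k[X], e.Monic ∧ IsCoprime m e ∧ x * algebraMap k[X] F e ^ 2 = algebraMap k[X] F m ∧
      y * algebraMap k[X] F e ^ 3 = algebraMap k[X] F n ∧ n ^ 2 = m ^ 3 + D * e ^ 6 := by
  classical
  have inj := IsFractionRing.injective k[X] F
  obtain ⟨a, ⟨b, hb⟩, hab, rfl⟩ := IsFractionRing.exists_reduced_fraction k[X] x
  obtain ⟨c, ⟨d, hd⟩, hcd, rfl⟩ := IsFractionRing.exists_reduced_fraction k[X] y
  replace hab := hab.isCoprime
  replace hcd := hcd.isCoprime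
  simp only at hab hcd
  have hb0 := nonZeroDivisors.ne_zero hb
  have hd0 := nonZeroDivisors.ne_zero hd
  have hbF : algebraMap k[X] F b ≠ 0 := by simpa using hb0
  have hdF : algebraMap k[X] F d ≠ 0 := by simpa using hd0
  rw [IsFractionRing.mk'_eq_div, IsFractionRing.mk'_eq_div] at h ⊢
  have h1 : c ^ 2 * b ^ 3 = d ^ 2 * (a ^ 3 + D * b ^ 3) := by
    apply inj
    simp only [map_mul, map_add, map_pow]
    field_simp at h
    linear_combination h
  have h2 : d ^ 2 ∣ b ^ 3 := (hcd.symm.pow (m := 2) (n := 2)).dvd_of_dvd_mul_left ⟨_, h1⟩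
  have h3 : b ^ 3 ∣ d ^ 2 := by
    apply (hab.symm.pow (m := 3) (n := 3)).dvd_of_dvd_mul_right
    exact ⟨c ^ 2 - d ^ 2 * D, by linear_combination -h1⟩
  have h4 : b ∣ d := (IsIntegrallyClosed.pow_dvd_pow_iff two_ne_zero).1 ((pow_dvd_pow b (by norm_num)).trans h3)
  obtain ⟨e0, rfl⟩ := h4
  have he0 : e0 ≠ 0 := right_ne_zero_of_mul hd0
  have h5 : Associated (e0 ^ 2) b := by
    have : Associated (b ^ 2 * e0 ^ 2) (b ^ 2 * b) := by
      rw [← mul_pow, ← pow_succ]; exact associated_of_dvd_dvd h2 h3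
    exact this.of_mul_left (Associated.refl _) (pow_ne_zero _ hb0)
  have hn : Associated (normalize e0) e0 := (associated_normalize e0).symm
  have h6 : Associated b (normalize e0 ^ 2) := h5.symm.trans (hn.pow_pow (n := 2)).symm
  have h7 : Associated (b * e0) (normalize e0 ^ 3) := by
    rw [pow_succ]; exact h6.mul_mul hn.symm
  obtain ⟨u, hu⟩ := h6
  obtain ⟨v, hv⟩ := h7
  refine ⟨a * u, c * v, normalize e0, monic_normalize he0, ?_, ?_, ?_, ?_⟩
  · refine (isCoprime_mul_unit_right_left u.isUnit a _).2 ?_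
    rw [← IsCoprime.pow_right_iff (m := 2) (by norm_num), ← hu]
    exact (isCoprime_mul_unit_right_right u.isUnit a b).2 hab
  · rw [← map_pow, ← hu, map_mul _ b, map_mul _ a, ← mul_assoc]
    exact congrArg (· * _) (div_mul_cancel₀ _ hbF)
  · rw [← map_pow, ← hv, map_mul _ (b * e0), map_mul _ c, ← mul_assoc]
    exact congrArg (· * _) (div_mul_cancel₀ _ hdF)
  · have hu3 : normalize e0 ^ 6 = (b * u) ^ 3 := by rw [hu]; ring
    have hv2 : normalize e0 ^ 6 = (b * e0 * v) ^ 2 := by rw [hv]; ring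
    have hbe : (b * e0) ^ 2 * b ^ 3 ≠ 0 :=
      mul_ne_zero (pow_ne_zero _ hd0) (pow_ne_zero _ hb0)
    apply mul_left_cancel₀ hbe
    have e1 : (b * u : k[X]) ^ 3 = (b * e0 * v) ^ 2 := by rw [← hu3, hv2]
    rw [hu3]
    linear_combination ((b * e0 * v)^2) * h1 - ((b * e0) ^ 2 * (a ^ 3 + D * b^3)) * e1

theorem point_fixed [Differential k] (σ : k →+* k) (hσ : ∀ a : k, Differential.deriv a = 0 → σ a = a)
    (φ : F →+* F) (hφ : ∀ p : k[X], φ (algebraMap k[X] F p) = algebraMap k[X] F (p.map σ))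
    {x y : F} (h : y ^ 2 = x ^ 3 + algebraMap k[X] F (dPoly k)) : φ x = x ∧ φ y = y := by
  obtain ⟨m, n, e, he, hme, hx, hy, hinteg⟩ := exists_weighted_denominator h
  obtain ⟨hm, hn, hee⟩ := rigidity_integral he hme hinteg
  have fixed : ∀ p : k[X], Differential.mapCoeffs p = 0 →
      φ (algebraMap k[X] F p) = algebraMap k[X] F p := by
    intro p hp
    rw [hφ]
    congr 1
    ext i
    rw [coeff_map]
    apply hσ
    rw [← Differential.coeff_mapCoeffs, hp, coeff_zero]
  have heF : algebraMap k[X] F e ≠ 0 := by simpa using he.ne_zero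
  have hx' := congrArg φ hx
  have hy' := congrArg φ hy
  rw [map_mul, map_pow, fixed e hee, fixed m hm, ← hx] at hx'
  rw [map_mul, map_pow, fixed e hee, fixed n hn, ← hy] at hy'
  exact ⟨mul_right_cancel₀ (pow_ne_zero _ heF) hx', mul_right_cancel₀ (pow_ne_zero _ heF) hy'⟩

theorem no_double_point {x y : F} (h : y ^ 2 = x ^ 3 + algebraMap k[X] F (dPoly k))
    (h2 : x * (x ^ 3 - 8 * algebraMap k[X] F (dPoly k)) =
      4 * algebraMap k[X] F (X ^ 2 - C 2 * X + C 4) * y ^ 2) : False := by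
  obtain ⟨m, n, e, he, hme, hx, hy, hinteg⟩ := exists_weighted_denominator h
  apply no_double he hme hinteg
  apply IsFractionRing.injective k[X] F
  simp only [map_mul, map_sub, map_pow] at h2 ⊢
  simp only [map_ofNat] at h2 ⊢
  rw [← hx, ← hy]
  linear_combination (algebraMap k[X] F e) ^ 8 * h2

theorem no_cm_point {x y : F} (h : y ^ 2 = x ^ 3 + algebraMap k[X] F (dPoly k)) (c : k)
    (h2 : x ^ 3 + 4 * algebraMap k[X] F (dPoly k) =
      algebraMap k[X] F (C c * (X ^ 2 - C 2 * X + C 4)) * x ^ 2) : False := by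
  obtain ⟨m, n, e, he, hme, hx, hy, hinteg⟩ := exists_weighted_denominator h
  apply no_cm_image he hme hinteg c
  apply IsFractionRing.injective k[X] F
  simp only [map_mul, map_sub, map_add, map_pow] at h2 ⊢
  simp only [map_ofNat] at h2 ⊢
  rw [← hx]
  linear_combination (algebraMap k[X] F e) ^ 6 * h2

end RationalPoints

/-- The Weierstrass curve `y² = x³ + D`. -/
def mordellCurve {F : Type*} [Zero F] (D : F) : WeierstrassCurve F := ⟨0, 0, 0, 0, D⟩

namespace Mordell

open WeierstrassCurve.Affine

variable {F : Type*} [Field F] (D : F)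

/-- The affine coordinate ring of `y² = x³ + D`. -/
abbrev Coord : Type _ := CoordinateRing (mordellCurve D)

lemma polynomial_eq : WeierstrassCurve.Affine.polynomial (mordellCurve D) = X ^ 2 - C (X ^ 3 + C D) := by
  simp [WeierstrassCurve.Affine.polynomial, mordellCurve]

/-- The coordinate function `x`. -/
noncomputable def coordX : Coord D := CoordinateRing.mk (mordellCurve D) (C X)

/-- The coordinate function `y`. -/
noncomputable def coordY : Coord D := CoordinateRing.mk (mordellCurve D) X

lemma algebraMap_X : algebraMap F[X] (Coord D) X = coordX D := rfl

lemma coordX_eq : coordX D = algebraMap F[X] (Coord D) X := rfl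

lemma algebraMap_C (a : F) : algebraMap F[X] (Coord D) (C a) = algebraMap F (Coord D) a := rfl

lemma coordY_sq_poly : coordY D ^ 2 = algebraMap F[X] (Coord D) (X ^ 3 + C D) := by
  have h : CoordinateRing.mk (mordellCurve D) (X ^ 2 - C (X ^ 3 + C D)) = 0 :=
    (congrArg _ (polynomial_eq D).symm).trans AdjoinRoot.mk_self
  rw [map_sub, map_pow, sub_eq_zero] at h
  exact h

lemma coordY_sq : coordY D ^ 2 = coordX D ^ 3 + algebraMap F (Coord D) D := by
  rw [coordY_sq_poly, map_add, map_pow, algebraMap_X, algebraMap_C]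

lemma exists_eq (r : Coord D) : ∃ p q : F[X],
    r = algebraMap _ _ p + algebraMap _ _ q * coordY D := by
  obtain ⟨p, q, h⟩ := CoordinateRing.exists_smul_basis_eq r
  refine ⟨p, q, ?_⟩
  rw [← h, Algebra.smul_def, Algebra.smul_def, mul_one]; rfl

lemma eq_zero_of {p q : F[X]}
    (h : algebraMap _ (Coord D) p + algebraMap _ _ q * coordY D = 0) : p = 0 ∧ q = 0 :=
  CoordinateRing.smul_basis_eq_zero (W' := mordellCurve D) (by
    rw [Algebra.smul_def, Algebra.smul_def, mul_one]; exact h)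

/-- A ring homomorphism out of the coordinate ring, given on scalars and coordinates. -/
noncomputable def lift {S : Type*} [CommRing S] (σ : F →+* S) (x y : S)
    (h : y ^ 2 = x ^ 3 + σ D) : Coord D →+* S :=
  AdjoinRoot.lift (eval₂RingHom σ x) y (by
    rw [polynomial_eq, eval₂_sub, eval₂_X_pow, eval₂_C]; simp [h])

section lift
variable {S : Type*} [CommRing S] (σ : F →+* S) (x y : S) (h : y ^ 2 = x ^ 3 + σ D)

@[simp] lemma lift_poly (p : F[X]) : lift D σ x y h (algebraMap F[X] (Coord D) p) = p.eval₂ σ x :=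
  AdjoinRoot.lift_of _

@[simp] lemma lift_scalar (a : F) : lift D σ x y h (algebraMap F (Coord D) a) = σ a := by
  rw [← algebraMap_C, lift_poly, eval₂_C]

@[simp] lemma lift_coordX : lift D σ x y h (coordX D) = x := by
  rw [← algebraMap_X, lift_poly, eval₂_X]

@[simp] lemma lift_coordY : lift D σ x y h (coordY D) = y := AdjoinRoot.lift_root _

end lift

lemma hom_ext {S : Type*} [CommRing S] {φ ψ : Coord D →+* S}
    (h : ∀ a, φ (algebraMap F _ a) = ψ (algebraMap F _ a)) (hx : φ (coordX D) = ψ (coordX D))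
    (hy : φ (coordY D) = ψ (coordY D)) : φ = ψ := by
  have hp : φ.comp (algebraMap F[X] (Coord D)) = ψ.comp (algebraMap F[X] (Coord D)) := by
    refine Polynomial.ringHom_ext (fun a => ?_) ?_
    · exact h a
    · exact hx
  refine RingHom.ext fun r => ?_
  obtain ⟨p, q, rfl⟩ := exists_eq D r
  have := fun p => RingHom.congr_fun hp p
  simp only [RingHom.comp_apply] at this
  rw [map_add, map_add, map_mul, map_mul, this, this, hy]

/-- The hyperelliptic involution `y ↦ -y`. -/
noncomputable def conj : Coord D →+* Coord D :=
  lift D (algebraMap F _) (coordX D) (-coordY D) (by rw [neg_sq, coordY_sq])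

lemma conj_poly (p : F[X]) : conj D (algebraMap F[X] (Coord D) p) = algebraMap _ _ p := by
  rw [conj, lift_poly, coordX_eq]
  exact (hom_eval₂ p C (algebraMap F[X] (Coord D)) X).symm.trans (by rw [eval₂_C_X])

lemma conj_coordY : conj D (coordY D) = -coordY D := lift_coordY ..

lemma conj_conj (r : Coord D) : conj D (conj D r) = r := by
  obtain ⟨p, q, rfl⟩ := exists_eq D r
  simp only [map_add, map_mul, conj_poly, conj_coordY, map_neg, neg_neg]

lemma mul_conj (p q : F[X]) : (algebraMap _ (Coord D) p + algebraMap _ _ q * coordY D) *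
    conj D (algebraMap _ (Coord D) p + algebraMap _ _ q * coordY D) =
      algebraMap _ _ (p ^ 2 - q ^ 2 * (X ^ 3 + C D)) := by
  simp only [map_add, map_mul, conj_poly, conj_coordY, map_sub, map_pow]
  have := coordY_sq_poly D
  rw [map_add, map_pow] at this
  linear_combination - algebraMap F[X] (Coord D) q ^ 2 * this

lemma squarefree_poly [CharZero F] (hD : D ≠ 0) : Squarefree (X ^ 3 + C D : F[X]) := by
  refine Separable.squarefree ⟨C (1 / D), C (-1 / (3 * D)) * X, ?_⟩
  simp only [derivative_add, derivative_X_pow, derivative_C, add_zero]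
  have h1 : C (1 / D) * C D = (1 : F[X]) := by
    rw [← C_mul, one_div_mul_cancel hD, C_1]
  have h2 : C (-1 / (3 * D)) * C 3 = -(C (1 / D) : F[X]) := by
    rw [← C_mul, ← C_neg]; congr 1; field_simp
  simp only [Nat.cast_ofNat, Nat.add_one_sub_one]
  linear_combination h1 + X ^ 3 * h2

instance : Module.Finite F[X] (Coord D) :=
  .of_basis (CoordinateRing.basis (mordellCurve D))

instance : IsNoetherianRing (Coord D) :=
  IsNoetherianRing.of_finite F[X] (Coord D)

instance : Algebra.IsIntegral F[X] (Coord D) := inferInstance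

lemma dvd_of_sq_dvd [CharZero F] (hD : D ≠ 0) {s b : F[X]} (hs : s ≠ 0)
    (h : s ^ 2 ∣ b ^ 2 * (X ^ 3 + C D)) : s ∣ b := by
  classical
  obtain ⟨g, s', b', hg, rfl, rfl⟩ : ∃ g s' b', IsCoprime s' b' ∧ s = g * s' ∧ b = g * b' := by
    obtain ⟨s', hs'⟩ := EuclideanDomain.gcd_dvd_left s b
    obtain ⟨b', hb'⟩ := EuclideanDomain.gcd_dvd_right s b
    refine ⟨EuclideanDomain.gcd s b, s', b', ?_, hs', hb'⟩
    obtain ⟨u, v, huv⟩ : ∃ u v, EuclideanDomain.gcd s b = s * u + b * v :=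
      ⟨_, _, EuclideanDomain.gcd_eq_gcd_ab s b⟩
    have h0 : EuclideanDomain.gcd s b ≠ 0 := fun h => hs (by rw [hs', h, zero_mul])
    refine ⟨u, v, mul_left_cancel₀ h0 ?_⟩
    linear_combination -huv - u * hs' - v * hb'
  have hg0 : g ^ 2 ≠ 0 := pow_ne_zero _ (left_ne_zero_of_mul hs)
  have h' : s' ^ 2 ∣ b' ^ 2 * (X ^ 3 + C D) := by
    rw [mul_pow, mul_pow, mul_assoc] at h
    exact (mul_dvd_mul_iff_left hg0).1 h
  have hu : IsUnit s' := squarefree_poly D hD s' (by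
    rw [← sq]; exact (hg.pow (m := 2) (n := 2)).dvd_of_dvd_mul_left h')
  exact mul_dvd_mul_left g (hu.dvd)

lemma dvd_of_isIntegral {L : Type*} [Field L] [Algebra F[X] L] [FaithfulSMul F[X] L] {a s : F[X]}
    (hs : s ≠ 0) (h : IsIntegral F[X] (algebraMap F[X] L a / algebraMap F[X] L s)) : s ∣ a := by
  let := FractionRing.liftAlgebra F[X] L
  have e : algebraMap F[X] L a / algebraMap F[X] L s = algebraMap (FractionRing F[X]) L
      (algebraMap _ _ a / algebraMap _ _ s) := by
    rw [map_div₀, ← IsScalarTower.algebraMap_apply, ← IsScalarTower.algebraMap_apply]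
  rw [e, isIntegral_algebraMap_iff (algebraMap (FractionRing F[X]) L).injective,
    IsIntegrallyClosed.isIntegral_iff] at h
  obtain ⟨c, hc⟩ := h
  refine ⟨c, ?_⟩
  have hs' : algebraMap F[X] (FractionRing F[X]) s ≠ 0 := by simpa using hs
  rw [eq_div_iff hs', ← map_mul] at hc
  rw [← IsFractionRing.injective F[X] (FractionRing F[X]) hc, mul_comm]

instance isIntegrallyClosed [CharZero F] [NeZero D] : IsIntegrallyClosed (Coord D) := by
  have hD : D ≠ 0 := NeZero.ne D
  let L := FractionRing (Coord D)
  have : FaithfulSMul F[X] L := FaithfulSMul.trans F[X] (Coord D) L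
  have inj : Function.Injective (algebraMap (Coord D) L) := IsFractionRing.injective _ _
  have hconj : Function.Injective (conj D) := fun a b h => by
    rw [← conj_conj D a, h, conj_conj]
  let τ : L →+* L := IsFractionRing.map hconj
  have hτ : ∀ r, τ (algebraMap _ L r) = algebraMap _ L (conj D r) := fun r =>
    IsLocalization.map_eq _ r
  have hτp : ∀ p : F[X], τ (algebraMap _ L p) = algebraMap _ L p := fun p => by
    rw [IsScalarTower.algebraMap_apply F[X] (Coord D) L, hτ, conj_poly]
  rw [isIntegrallyClosed_iff L]
  intro x hx
  replace hx : IsIntegral F[X] x := isIntegral_trans _ hx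
  obtain ⟨a, b, s, hs, rfl⟩ : ∃ a b s : F[X], s ≠ 0 ∧ x = (algebraMap _ L a +
      algebraMap _ L b * algebraMap _ L (coordY D)) / algebraMap _ L s := by
    obtain ⟨r, t, ht, rfl⟩ := IsFractionRing.div_surjective (A := Coord D) x
    have ht0 : t ≠ 0 := nonZeroDivisors.ne_zero ht
    obtain ⟨a, b, hab⟩ := exists_eq D (r * conj D t)
    obtain ⟨p, q, hpq⟩ := exists_eq D t
    have hn := mul_conj D p q
    rw [← hpq] at hn
    have htc : conj D t ≠ 0 := fun h => ht0 (hconj (by rw [h, map_zero]))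
    refine ⟨a, b, p ^ 2 - q ^ 2 * (X ^ 3 + C D), fun h => mul_ne_zero ht0 htc (by rw [hn, h, map_zero]), ?_⟩
    simp only [IsScalarTower.algebraMap_apply F[X] (Coord D) L]
    rw [← map_mul, ← map_add, ← hab, ← hn, map_mul, map_mul, mul_div_mul_right]
    rwa [Ne, map_eq_zero_iff _ inj]
  have hsL : algebraMap F[X] L s ≠ 0 := by
    rwa [Ne, map_eq_zero_iff _ (FaithfulSMul.algebraMap_injective F[X] L)]
  have hx' : IsIntegral F[X] (τ ((algebraMap _ L a +
      algebraMap _ L b * algebraMap _ L (coordY D)) / algebraMap _ L s)) :=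
    hx.map ({ τ with commutes' := hτp } : L →ₐ[F[X]] L)
  simp only [map_div₀, map_add, map_mul, hτp, hτ, conj_coordY, map_neg] at hx'
  have hY : algebraMap (Coord D) L (coordY D) ^ 2 = algebraMap F[X] L (X ^ 3 + C D) := by
    rw [← map_pow, coordY_sq_poly, ← IsScalarTower.algebraMap_apply]
  have h2a : s ∣ a := by
    have h2 : IsIntegral F[X] (algebraMap _ L (C 2 * a) / algebraMap _ L s) := by
      refine (congrArg (IsIntegral F[X]) ?_).mpr (hx.add hx')
      rw [map_mul (algebraMap F[X] L), show algebraMap F[X] L (C 2) = 2 from map_ofNat (algebraMap F[X] L) 2]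
      ring
    have := dvd_of_isIntegral hs h2
    rwa [IsUnit.dvd_mul_left] at this
    exact isUnit_C.2 (by simp)
  have hb : s ∣ b := by
    have h2 : IsIntegral F[X] (algebraMap _ L (a ^ 2 - b ^ 2 * (X ^ 3 + C D)) /
        algebraMap _ L (s ^ 2)) := by
      refine (congrArg (IsIntegral F[X]) ?_).mpr (hx.mul hx')
      rw [map_sub, map_mul, ← hY, map_pow, map_pow, map_pow]
      rw [div_mul_div_comm]
      congr 1 <;> ring
    have h3 := dvd_of_isIntegral (pow_ne_zero 2 hs) h2
    exact dvd_of_sq_dvd D hD hs ((dvd_sub_right (pow_dvd_pow_of_dvd h2a 2)).1 h3)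
  obtain ⟨a, rfl⟩ := h2a
  obtain ⟨b, rfl⟩ := hb
  refine ⟨algebraMap _ _ a + algebraMap _ _ b * coordY D, ?_⟩
  rw [eq_div_iff hsL]
  simp only [map_add, map_mul, ← IsScalarTower.algebraMap_apply F[X] (Coord D) L]
  ring

instance isDedekindDomain [CharZero F] [NeZero D] : IsDedekindDomain (Coord D) where
  toIsNoetherian := inferInstance
  toDimensionLEOne := Ring.DimensionLEOne.of_isIntegral F[X] (Coord D)
  toIsIntegralClosure := (isIntegrallyClosed D)

end Mordell

namespace Mordell

open WeierstrassCurve.Affine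

variable {F : Type*} [Field F] (D : F)

/-- The maximal ideal of the point `(x, y)`. -/
noncomputable def pointIdeal (x y : F) : Ideal (Coord D) :=
  Ideal.span {coordX D - algebraMap F _ x, coordY D - algebraMap F _ y}

lemma pointIdeal_eq (x y : F) :
    pointIdeal D x y = CoordinateRing.XYIdeal (mordellCurve D) x (C y) := by
  rw [pointIdeal, CoordinateRing.XYIdeal, CoordinateRing.XClass, CoordinateRing.YClass]
  simp only [map_sub]
  rfl

lemma polynomial_eval (x y : F) : ((WeierstrassCurve.Affine.polynomial
    (mordellCurve D)).eval (C y)).eval x = y ^ 2 - (x ^ 3 + D) := by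
  rw [polynomial_eq]; simp

lemma pointIdeal_isMaximal {x y : F} (h : y ^ 2 = x ^ 3 + D) : (pointIdeal D x y).IsMaximal := by
  rw [pointIdeal_eq]
  have e := CoordinateRing.quotientXYIdealEquiv (W' := mordellCurve D) (x := x) (y := C y)
    (by rw [polynomial_eval, h, sub_self])
  exact Ideal.Quotient.maximal_of_isField _ (e.toMulEquiv.isField (Field.toIsField F))

lemma finite_quotient {B : Ideal (Coord D)} (hB : B ≠ ⊥) : Module.Finite F (Coord D ⧸ B) :=
  Module.Finite.equiv
    (Ideal.quotientEquivDirectSum F (CoordinateRing.basis (mordellCurve D)) hB).symm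

lemma exists_mem_small {B : Ideal (Coord D)} (hB : B ≠ ⊥) : ∃ f ∈ B, f ≠ 0 ∧
    Module.finrank F (Coord D ⧸ Ideal.span {f}) ≤ Module.finrank F (Coord D ⧸ B) + 1 := by
  have := finite_quotient D hB
  set n := Module.finrank F (Coord D ⧸ B) with hn
  let U := degreeLT F ((n + 1) / 2 + 1)
  let V := degreeLT F (n / 2)
  have eU := degreeLTEquiv F ((n + 1) / 2 + 1)
  have eV := degreeLTEquiv F (n / 2)
  have : Module.Finite F U := Module.Finite.equiv eU.symm
  have : Module.Finite F V := Module.Finite.equiv eV.symm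
  let ι : F[X] →ₗ[F] Coord D := (IsScalarTower.toAlgHom F F[X] (Coord D)).toLinearMap
  let T₀ : U × V →ₗ[F] Coord D :=
    (ι ∘ₗ U.subtype).coprod (LinearMap.mulRight F (coordY D) ∘ₗ ι ∘ₗ V.subtype)
  have hT₀ : ∀ p, T₀ p = algebraMap F[X] (Coord D) p.1 + algebraMap F[X] _ p.2 * coordY D :=
    fun p => rfl
  let T : U × V →ₗ[F] Coord D ⧸ B := (Ideal.Quotient.mkₐ F B).toLinearMap ∘ₗ T₀
  have hlt : Module.finrank F (Coord D ⧸ B) < Module.finrank F (U × V) := by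
    rw [Module.finrank_prod, eU.finrank_eq, eV.finrank_eq, Module.finrank_fin_fun,
      Module.finrank_fin_fun]
    omega
  obtain ⟨⟨⟨p, hp⟩, ⟨q, hq⟩⟩, hpq, hpq0⟩ :=
    Submodule.exists_mem_ne_zero_of_ne_bot (LinearMap.ker_ne_bot_of_finrank_lt (f := T) hlt)
  have hf0 : algebraMap F[X] (Coord D) p + algebraMap F[X] _ q * coordY D ≠ 0 := by
    intro h
    obtain ⟨rfl, rfl⟩ := eq_zero_of D h
    exact hpq0 rfl
  refine ⟨algebraMap F[X] (Coord D) p + algebraMap F[X] _ q * coordY D, ?_, hf0, ?_⟩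
  · exact Ideal.Quotient.eq_zero_iff_mem.1 hpq
  · rw [finrank_quotient_span_eq_natDegree_norm
      (CoordinateRing.basis (mordellCurve D)) hf0]
    have e : algebraMap F[X] (Coord D) p + algebraMap F[X] _ q * coordY D =
        p • (1 : Coord D) + q • CoordinateRing.mk (mordellCurve D) X := by
      rw [Algebra.smul_def, Algebra.smul_def, mul_one]; rfl
    rw [e, natDegree_le_iff_degree_le, CoordinateRing.degree_norm_smul_basis]
    rw [mem_degreeLT] at hp hq
    refine max_le ?_ ?_
    · by_cases h : p = 0
      · simp [h]
      rw [degree_eq_natDegree h] at hp ⊢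
      have : p.natDegree < (n + 1) / 2 + 1 := by exact_mod_cast hp
      rw [nsmul_eq_mul]
      norm_cast
      omega
    · by_cases h : q = 0
      · simp [h]
      rw [degree_eq_natDegree h] at hq ⊢
      have : q.natDegree < n / 2 := by exact_mod_cast hq
      rw [nsmul_eq_mul]
      norm_cast
      omega

lemma finrank_quotient_le_one [IsDedekindDomain (Coord D)] {B J : Ideal (Coord D)} {f : Coord D}
    (hf : f ≠ 0) (hBJ : Ideal.span {f} = B * J)
    (h : Module.finrank F (Coord D ⧸ Ideal.span {f}) ≤ Module.finrank F (Coord D ⧸ B) + 1) :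
    Module.finrank F (Coord D ⧸ J) ≤ 1 := by
  have hf' : Ideal.span {f} ≠ ⊥ := by simpa using hf
  have hle : Ideal.span {f} ≤ B := hBJ ▸ Ideal.mul_le_left
  have hB : B ≠ ⊥ := fun h => hf' (by rw [hBJ, h, Ideal.bot_mul])
  obtain ⟨b, hb⟩ := IsDedekindDomain.exists_sup_span_eq hle hf'
  have hbB : b ∈ B := hb ▸ Ideal.mem_sup_right (Ideal.mem_span_singleton_self b)
  have := finite_quotient D hf'
  have := finite_quotient D hB
  let π : (Coord D ⧸ Ideal.span {f}) →ₗ[F] Coord D ⧸ B :=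
    (Ideal.Quotient.factorₐ F hle).toLinearMap
  have hπ : Function.Surjective π := Ideal.Quotient.factor_surjective hle
  let μ : Coord D →ₗ[F] Coord D ⧸ Ideal.span {f} :=
    (Ideal.Quotient.mkₐ F _).toLinearMap ∘ₗ LinearMap.mulRight F b
  have hμ : ∀ r, μ r = Ideal.Quotient.mk _ (r * b) := fun r => rfl
  have hker : LinearMap.ker μ = J.restrictScalars F := by
    ext r
    rw [LinearMap.mem_ker, hμ, Ideal.Quotient.eq_zero_iff_mem, Submodule.restrictScalars_mem]
    constructor
    · intro hr
      have : B * Ideal.span {r} ≤ B * J := by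
        rw [← hBJ, ← hb, Ideal.sup_mul, Ideal.span_singleton_mul_span_singleton,
          Ideal.span_singleton_mul_span_singleton]
        refine sup_le (Ideal.span_singleton_le_span_singleton.2 (dvd_mul_right f r)) ?_
        rwa [Ideal.span_singleton_le_iff_mem, mul_comm]
      rw [← Ideal.span_singleton_le_iff_mem]
      exact Ideal.dvd_iff_le.1 ((mul_dvd_mul_iff_left hB).1 (Ideal.dvd_iff_le.2 this))
    · intro hr
      rw [hBJ, mul_comm r]
      exact Ideal.mul_mem_mul hbB hr
  have hrange : LinearMap.range μ ≤ LinearMap.ker π := by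
    rintro _ ⟨r, rfl⟩
    rw [LinearMap.mem_ker, hμ]
    change Ideal.Quotient.mk B (r * b) = 0
    exact Ideal.Quotient.eq_zero_iff_mem.2 (B.mul_mem_left _ hbB)
  have e : (Coord D ⧸ J) ≃ₗ[F] LinearMap.range μ :=
    (Submodule.Quotient.restrictScalarsEquiv F J).symm.trans
      ((Submodule.quotEquivOfEq _ _ hker.symm).trans μ.quotKerEquivRange)
  rw [e.finrank_eq]
  have h1 := Submodule.finrank_mono hrange
  have h2 := LinearMap.finrank_range_add_finrank_ker π
  rw [LinearMap.range_eq_top.2 hπ, finrank_top] at h2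
  omega

lemma eq_pointIdeal {J : Ideal (Coord D)} (hJ0 : J ≠ ⊥) (hJ : J ≠ ⊤)
    (h : Module.finrank F (Coord D ⧸ J) ≤ 1) :
    ∃ x y : F, y ^ 2 = x ^ 3 + D ∧ J = pointIdeal D x y := by
  have := finite_quotient D hJ0
  have hnt : Nontrivial (Coord D ⧸ J) := Ideal.Quotient.nontrivial_iff.2 hJ
  have h1 : Module.finrank F (Coord D ⧸ J) = 1 :=
    le_antisymm h Module.finrank_pos
  have key : ∀ r : Coord D, ∃ c : F, r - algebraMap F _ c ∈ J := fun r => by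
    obtain ⟨c, hc⟩ := (finrank_eq_one_iff_of_nonzero' (1 : Coord D ⧸ J) one_ne_zero).1 h1
      (Ideal.Quotient.mk J r)
    refine ⟨c, Ideal.Quotient.eq.1 ?_⟩
    rw [← hc, Algebra.smul_def, mul_one]; rfl
  obtain ⟨x, hx⟩ := key (coordX D)
  obtain ⟨y, hy⟩ := key (coordY D)
  have hle : pointIdeal D x y ≤ J := by
    rw [pointIdeal, Ideal.span_le]
    rintro _ (rfl | rfl)
    exacts [hx, hy]
  have heq : y ^ 2 = x ^ 3 + D := by
    by_contra hne
    have hu : IsUnit (algebraMap F (Coord D) (y ^ 2 - (x ^ 3 + D))) :=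
      (IsUnit.mk0 _ (sub_ne_zero.2 hne)).map _
    refine hJ (J.eq_top_of_isUnit_mem ?_ hu)
    have : algebraMap F (Coord D) (y ^ 2 - (x ^ 3 + D)) =
        (coordX D - algebraMap F _ x) * (coordX D ^ 2 + coordX D * algebraMap F _ x +
          algebraMap F _ x ^ 2) -
        (coordY D - algebraMap F _ y) * (coordY D + algebraMap F _ y) := by
      simp only [map_sub, map_add, map_pow]
      linear_combination coordY_sq D
    rw [this]
    exact J.sub_mem (J.mul_mem_right _ hx) (J.mul_mem_right _ hy)
  exact ⟨x, y, heq, ((pointIdeal_isMaximal D heq).eq_of_le hJ hle).symm⟩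

/-- Every nonzero ideal is, up to a principal ideal, inverse to the ideal of a rational point. -/
theorem exists_mul_pointIdeal [IsDedekindDomain (Coord D)] {B : Ideal (Coord D)} (hB : B ≠ ⊥) :
    ∃ f ≠ 0, ∃ J, Ideal.span {f} = B * J ∧
      (J = ⊤ ∨ ∃ x y : F, y ^ 2 = x ^ 3 + D ∧ J = pointIdeal D x y) := by
  obtain ⟨f, hfB, hf, hle⟩ := exists_mem_small D hB
  obtain ⟨J, hJ⟩ := Ideal.dvd_iff_le.2 ((Ideal.span_singleton_le_iff_mem B).2 hfB)
  refine ⟨f, hf, J, hJ, or_iff_not_imp_left.2 fun hJt => eq_pointIdeal D ?_ hJt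
    (finrank_quotient_le_one D hf hJ hle)⟩
  rintro rfl
  rw [Ideal.mul_bot] at hJ
  exact hf (by simpa using hJ)

end Mordell

namespace Mordell

open WeierstrassCurve.Affine

variable {F : Type*} [Field F] (D : F)

lemma nonsingular [CharZero F] [NeZero D] {x y : F} (h : y ^ 2 = x ^ 3 + D) :
    WeierstrassCurve.Affine.Nonsingular (mordellCurve D) x y := by
  rw [WeierstrassCurve.Affine.nonsingular_iff, WeierstrassCurve.Affine.equation_iff]
  simp only [mordellCurve, zero_mul, add_zero, sub_zero]
  refine ⟨h, ?_⟩
  by_cases hy : y = 0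
  · left
    have hD := NeZero.ne D
    have hx : x ≠ 0 := by
      rintro rfl
      rw [hy] at h
      exact hD (by linear_combination -h)
    simpa using hx
  · right
    intro h'
    exact hy (self_eq_neg.1 h')

lemma pointIdeal_ne_bot {x y : F} : pointIdeal D x y ≠ ⊥ := by
  intro h
  have hm : coordX D - algebraMap F _ x ∈ pointIdeal D x y := Ideal.subset_span (by simp)
  rw [h, Ideal.mem_bot, ← algebraMap_C, ← algebraMap_X, ← map_sub] at hm
  have := (eq_zero_of D (p := X - C x) (q := 0) (by rw [hm, map_zero, zero_mul, add_zero])).1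
  exact X_sub_C_ne_zero x this

/-- The rational point `(x, y)`. -/
noncomputable def pt [CharZero F] [NeZero D] {x y : F} (h : y ^ 2 = x ^ 3 + D) :
    WeierstrassCurve.Affine.Point (mordellCurve D) :=
  .some x y (nonsingular D h)

section classes
open nonZeroDivisors
variable [CharZero F] [NeZero D]

lemma pt_ne_zero {x y : F} (h : y ^ 2 = x ^ 3 + D) : pt D h ≠ 0 := Point.some_ne_zero _

lemma neg_pt {x y : F} (h : y ^ 2 = x ^ 3 + D) :
    -pt D h = pt D (x := x) (y := -y) (by rw [neg_sq, h]) := by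
  simp only [pt, Point.neg_some]
  congr 1
  simp [WeierstrassCurve.Affine.negY, mordellCurve]

variable [DecidableEq F]

lemma toClass_pt {x y : F} (h : y ^ 2 = x ^ 3 + D) :
    (Point.toClass (pt D h)).toMul = ClassGroup.mk0 ⟨pointIdeal D x y,
      mem_nonZeroDivisors_of_ne_zero (pointIdeal_ne_bot D)⟩ := by
  rw [pt, Point.toClass_some,
    ← ClassGroup.mk_mk0 (R := Coord D) (FractionRing (Coord D))]
  refine congrArg (ClassGroup.mk _) (Units.ext ?_)
  rw [CoordinateRing.XYIdeal'_eq, FractionalIdeal.coe_mk0]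
  simp only [pointIdeal_eq]

lemma not_principal {x y : F} (h : y ^ 2 = x ^ 3 + D) {s t : Coord D} (hs : s ≠ 0) (ht : t ≠ 0)
    (he : Ideal.span {s} * pointIdeal D x y = Ideal.span {t}) : False := by
  refine pt_ne_zero D h ((Point.toClass_eq_zero _).1 ?_)
  have h1 : ClassGroup.mk0 ⟨pointIdeal D x y, mem_nonZeroDivisors_of_ne_zero
      (pointIdeal_ne_bot D)⟩ = ClassGroup.mk0 (1 : (Ideal (Coord D))⁰) :=
    (ClassGroup.mk0_eq_mk0_iff).2 ⟨s, t, hs, ht, by simpa using he⟩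
  rw [← toClass_pt D h, map_one] at h1
  exact h1

lemma add_pt {x₁ y₁ x₂ y₂ x₃ y₃ : F} (h₁ : y₁ ^ 2 = x₁ ^ 3 + D) (h₂ : y₂ ^ 2 = x₂ ^ 3 + D)
    (h₃ : y₃ ^ 2 = x₃ ^ 3 + D) {s t : Coord D} (hs : s ≠ 0) (ht : t ≠ 0)
    (he : Ideal.span {s} * (pointIdeal D x₁ y₁ * pointIdeal D x₂ y₂) =
      Ideal.span {t} * pointIdeal D x₃ y₃) : pt D h₁ + pt D h₂ = pt D h₃ := by
  refine Point.toClass_injective ?_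
  rw [map_add]
  apply Additive.toMul.injective
  rw [toMul_add, toClass_pt, toClass_pt, toClass_pt, ← map_mul]
  exact (ClassGroup.mk0_eq_mk0_iff).2 ⟨s, t, hs, ht, he⟩

lemma add_self_pt {x y x₃ y₃ : F} {h : y ^ 2 = x ^ 3 + D} {h₃ : y₃ ^ 2 = x₃ ^ 3 + D}
    (he : pt D h + pt D h = pt D h₃) : x * (x ^ 3 - 8 * D) = 4 * x₃ * y ^ 2 := by
  by_cases hy : y = 0
  · refine absurd he.symm ?_
    rw [pt, pt, Point.add_self_of_Y_eq]
    · exact Point.some_ne_zero _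
    · simp [hy, WeierstrassCurve.Affine.negY, mordellCurve]
  have hy' : y ≠ WeierstrassCurve.Affine.negY (mordellCurve D) x y := by
    simp only [WeierstrassCurve.Affine.negY, mordellCurve, zero_mul, sub_zero]
    exact fun h => hy (self_eq_neg.1 h)
  rw [pt, pt, Point.add_self_of_Y_ne hy', Point.some.injEq] at he
  have hx := he.1
  rw [WeierstrassCurve.Affine.slope_of_Y_ne rfl hy'] at hx
  simp only [WeierstrassCurve.Affine.addX, WeierstrassCurve.Affine.negY, mordellCurve, zero_mul,
    sub_zero, add_zero, mul_zero, sub_neg_eq_add] at hx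
  rw [← hx]
  field_simp
  linear_combination (32 * x) * h

lemma add_omega_pt {ω x y x₃ y₃ : F} (hω : ω ^ 2 + ω + 1 = 0) {h : y ^ 2 = x ^ 3 + D}
    {h' : (-y) ^ 2 = (ω ^ 2 * x) ^ 3 + D} {h₃ : y₃ ^ 2 = (ω * x₃) ^ 3 + D}
    (he : pt D h + pt D h' = pt D h₃) : x ^ 3 + 4 * D = -3 * x₃ * x ^ 2 := by
  have hω3 : ω ^ 3 = 1 := by linear_combination (ω - 1) * hω
  have hω0 : ω ≠ 0 := by rintro rfl; norm_num at hω
  by_cases hx0 : x = 0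
  · refine absurd he.symm ?_
    have : pt D h' = -pt D h := by
      rw [neg_pt]; simp [pt, hx0]
    rw [this, add_neg_cancel]
    exact Point.some_ne_zero _
  have hω1 : 1 - ω ^ 2 ≠ 0 := by
    intro h0
    have : (3 : F) = 0 := by linear_combination -h0 - (ω - 2) * (hω + h0)
    norm_num at this
  have hne : x ≠ ω ^ 2 * x := by
    intro h0
    exact mul_ne_zero hω1 hx0 (by linear_combination h0)
  simp only [pt, Point.add_of_X_ne hne, Point.some.injEq] at he
  have hx := he.1
  rw [WeierstrassCurve.Affine.slope_of_X_ne hne] at hx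
  simp only [WeierstrassCurve.Affine.addX, mordellCurve, zero_mul,
    sub_zero, add_zero, sub_neg_eq_add] at hx
  have hd : x - ω ^ 2 * x ≠ 0 := sub_ne_zero.2 hne
  rw [div_pow, sub_sub, sub_eq_iff_eq_add, div_eq_iff (pow_ne_zero 2 hd)] at hx
  have e1 : ω * x₃ + (x + ω ^ 2 * x) = ω * (x₃ - x) := by linear_combination x * hω
  have e2 : (x - ω ^ 2 * x) ^ 2 = -3 * ω ^ 2 * x ^ 2 := by
    linear_combination (x ^ 2 * (ω ^ 2 - ω + 1)) * hω
  rw [e1, e2] at hx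
  linear_combination hx - 4 * h - 3 * (x₃ - x) * x ^ 2 * hω3
end classes

lemma span_pair_mul_span_pair_le {R : Type*} [CommRing R] (s t v : R) :
    Ideal.span {s, v} * Ideal.span {t, v} ≤ Ideal.span {s * t, v} := by
  refine Ideal.mul_le.2 fun r hr r' hr' => ?_
  obtain ⟨a, b, rfl⟩ := Ideal.mem_span_pair.1 hr
  obtain ⟨a', b', rfl⟩ := Ideal.mem_span_pair.1 hr'
  exact Ideal.mem_span_pair.2 ⟨a * a', b * (a' * t + b' * v) + a * s * b', by ring⟩

lemma pointIdeal_prod_three [CharZero F] {ω x₀ y₀ : F} (hω : ω ^ 2 + ω + 1 = 0) (hy₀ : y₀ ≠ 0)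
    (h₀ : y₀ ^ 2 = x₀ ^ 3 + D) :
    pointIdeal D x₀ y₀ * pointIdeal D (ω ^ 2 * x₀) y₀ * pointIdeal D (ω * x₀) y₀ =
      Ideal.span {coordY D - algebraMap F _ y₀} := by
  have hω3 : ω ^ 3 = 1 := by linear_combination (ω - 1) * hω
  have ht : ∀ x, coordX D - algebraMap F _ x ∈ pointIdeal D x y₀ :=
    fun x => Ideal.subset_span (by simp)
  have hv : ∀ x, coordY D - algebraMap F _ y₀ ∈ pointIdeal D x y₀ :=
    fun x => Ideal.subset_span (by simp)
  have hprod : (coordX D - algebraMap F _ x₀) * (coordX D - algebraMap F _ (ω ^ 2 * x₀)) *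
      (coordX D - algebraMap F _ (ω * x₀)) =
      (coordY D - algebraMap F _ y₀) * (coordY D + algebraMap F _ y₀) := by
    have e1 := congrArg (algebraMap F (Coord D)) h₀
    have e2 := congrArg (algebraMap F (Coord D)) hω
    simp only [map_add, map_pow, map_mul, map_one, map_zero] at e1 e2 ⊢
    have e3 : algebraMap F (Coord D) ω ^ 3 = 1 := by rw [← map_pow, hω3, map_one]
    linear_combination e1 - coordY_sq D - algebraMap F _ x₀ ^ 3 * e3 +
      (-coordX D ^ 2 * algebraMap F _ x₀ + coordX D * algebraMap F _ x₀ ^ 2 *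
        algebraMap F _ ω) * e2
  refine le_antisymm ?_ ?_
  · refine (Ideal.mul_mono_left (span_pair_mul_span_pair_le _ _ _)).trans
      ((span_pair_mul_span_pair_le _ _ _).trans ?_)
    rw [hprod, Ideal.span_le]
    rintro _ (rfl | rfl)
    · exact Ideal.mul_mem_right _ _ (Ideal.mem_span_singleton_self _)
    · exact Ideal.mem_span_singleton_self _
  · rw [Ideal.span_singleton_le_iff_mem]
    have hu : IsUnit (algebraMap F (Coord D) (4 * y₀ ^ 2)) :=
      (IsUnit.mk0 _ (mul_ne_zero (by norm_num) (pow_ne_zero 2 hy₀))).map _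
    rw [← Ideal.mul_unit_mem_iff_mem _ hu]
    have m1 := Ideal.mul_mem_mul (Ideal.mul_mem_mul (ht x₀) (ht (ω ^ 2 * x₀))) (ht (ω * x₀))
    have m2 := Ideal.mul_mem_mul (Ideal.mul_mem_mul (hv x₀) (hv (ω ^ 2 * x₀))) (hv (ω * x₀))
    rw [hprod] at m1
    convert Ideal.add_mem _ (Ideal.mul_mem_right
      (3 * algebraMap F _ y₀ - coordY D) _ m1) m2 using 1
    simp only [map_mul, map_pow, map_ofNat]
    ring

section descent

variable [CharZero F] [NeZero D] {σ : F →+* F} {φ : Coord D →+* Coord D}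

/-- If `x - x₀` is a twisted norm for `(x, y) ↦ (x, -y)`, then `(x₀, y₀)` is, up to sign, twice
a rational point. -/
theorem exists_half_of_norm
    (hinj : Function.Injective φ) (hφ : ∀ a, φ (algebraMap F _ a) = algebraMap F _ (σ a))
    (hX : φ (coordX D) = coordX D) (hY : φ (coordY D) = -coordY D)
    (hrig : ∀ x y : F, y ^ 2 = x ^ 3 + D → σ x = x ∧ σ y = y) {x₀ y₀ : F}
    (h₀ : y₀ ^ 2 = x₀ ^ 3 + D) {a b u : Coord D} (ha : a ≠ 0) (hb : b ≠ 0) (hu : IsUnit u)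
    (hn : (coordX D - algebraMap F _ x₀) * (b * φ b) = u * (a * φ a)) :
    ∃ x y : F, y ^ 2 = x ^ 3 + D ∧ x * (x ^ 3 - 8 * D) = 4 * x₀ * y ^ 2 := by
  classical
  have hmap : ∀ {x y : F}, y ^ 2 = x ^ 3 + D →
      (pointIdeal D x y).map φ = pointIdeal D x (-y) := fun {x y} h => by
    obtain ⟨hx, hy⟩ := hrig x y h
    rw [pointIdeal, Ideal.map_span, Set.image_pair, map_sub, map_sub, hX, hY, hφ, hφ, hx, hy,
      pointIdeal, map_neg, Ideal.span_insert, Ideal.span_insert,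
      ← Ideal.span_singleton_neg (-coordY D - _)]
    congr 3
    ring
  have hneg : ∀ {x y : F}, y ^ 2 = x ^ 3 + D → (-y) ^ 2 = x ^ 3 + D := fun {x y} h => by
    rw [neg_sq, h]
  have hprod : pointIdeal D x₀ y₀ * pointIdeal D x₀ (-y₀) =
      Ideal.span {coordX D - algebraMap F _ x₀} := by
    have := CoordinateRing.XYIdeal_neg_mul (nonsingular D h₀)
    simp only [WeierstrassCurve.Affine.negY, mordellCurve, zero_mul, sub_zero] at this
    rw [mul_comm, pointIdeal_eq, pointIdeal_eq]
    refine Eq.trans this ?_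
    rw [CoordinateRing.XIdeal, CoordinateRing.XClass]
    simp only [map_sub]
    rfl
  set P := pointIdeal D x₀ y₀ with hP
  set P' := pointIdeal D x₀ (-y₀) with hP'
  have hPP' : P.map φ = P' := hmap h₀
  set A := Ideal.span {a} ⊔ P * Ideal.span {b} with hA
  have hA0 : A ≠ ⊥ := fun h => ha (by
    have : a ∈ A := Ideal.mem_sup_left (Ideal.mem_span_singleton_self a)
    rwa [h, Ideal.mem_bot] at this)
  have hAmap : A.map φ = Ideal.span {φ a} ⊔ P' * Ideal.span {φ b} := by
    rw [hA, Ideal.map_sup, Ideal.map_mul, hPP', Ideal.map_span, Ideal.map_span,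
      Set.image_singleton, Set.image_singleton]
  have hnorm : P * P' * (Ideal.span {b} * Ideal.span {φ b}) =
      Ideal.span {a} * Ideal.span {φ a} := by
    rw [hprod, Ideal.span_singleton_mul_span_singleton, Ideal.span_singleton_mul_span_singleton,
      Ideal.span_singleton_mul_span_singleton, hn, Ideal.span_singleton_mul_left_unit hu]
  have key : A * (P' * Ideal.span {φ b}) = Ideal.span {a} * A.map φ := by
    rw [hAmap, hA, Ideal.sup_mul, Ideal.mul_sup, ← hnorm, sup_comm]
    congr 1
    ring
  obtain ⟨f, hf, J, hJ, hJ'⟩ := exists_mul_pointIdeal D hA0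
  have hJmap : Ideal.span {φ f} = A.map φ * J.map φ := by
    rw [← Ideal.map_mul, ← hJ, Ideal.map_span, Set.image_singleton]
  have hφ0 : ∀ {r}, r ≠ 0 → φ r ≠ 0 := fun {r} hr h => hr (hinj (by rw [h, map_zero]))
  have hfin : Ideal.span {f * φ b} * (P' * J.map φ) = Ideal.span {a * φ f} * J := by
    rw [← Ideal.span_singleton_mul_span_singleton, ← Ideal.span_singleton_mul_span_singleton,
      hJ, hJmap]
    calc A * J * Ideal.span {φ b} * (P' * J.map φ)
        = A * (P' * Ideal.span {φ b}) * (J * J.map φ) := by ring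
      _ = _ := by rw [key]; ring
  have hs := mul_ne_zero hf (hφ0 hb)
  have ht := mul_ne_zero ha (hφ0 hf)
  rcases hJ' with rfl | ⟨x, y, h, rfl⟩
  · rw [Ideal.map_top, Ideal.mul_top, Ideal.mul_top] at hfin
    exact (not_principal D (hneg h₀) hs ht hfin).elim
  · rw [hmap h] at hfin
    have := add_pt D (hneg h₀) (hneg h) h hs ht hfin
    refine ⟨x, y, h, add_self_pt D (h := h) (h₃ := hneg h₀) ?_⟩
    rw [← neg_pt D h] at this
    exact (add_neg_eq_iff_eq_add.1 this).symm

/-- If `y - y₀` is a twisted norm for `(x, y) ↦ (ωx, y)`, then `(x₀, y₀)` is, up to automorphism,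
the image of a rational point under `1 - ω`. -/
theorem exists_preimage_of_norm
    (hinj : Function.Injective φ) (hφ : ∀ a, φ (algebraMap F _ a) = algebraMap F _ (σ a))
    {ω : F} (hω : ω ^ 2 + ω + 1 = 0)
    (hX : φ (coordX D) = algebraMap F _ ω * coordX D) (hY : φ (coordY D) = coordY D)
    (hrig : ∀ x y : F, y ^ 2 = x ^ 3 + D → σ x = x ∧ σ y = y) {x₀ y₀ : F} (hy₀ : y₀ ≠ 0)
    (h₀ : y₀ ^ 2 = x₀ ^ 3 + D) {a b u : Coord D} (ha : a ≠ 0) (hb : b ≠ 0) (hu : IsUnit u)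
    (hn : (coordY D - algebraMap F _ y₀) * (b * φ b * φ (φ b)) = u * (a * φ a * φ (φ a))) :
    ∃ x y : F, y ^ 2 = x ^ 3 + D ∧ x ^ 3 + 4 * D = -3 * x₀ * x ^ 2 := by
  classical
  have hω3 : ω ^ 3 = 1 := by linear_combination (ω - 1) * hω
  have hω0 : ω ≠ 0 := by rintro rfl; norm_num at hω
  have htw : ∀ {x y : F}, y ^ 2 = x ^ 3 + D → y ^ 2 = (ω ^ 2 * x) ^ 3 + D := fun {x y} h => by
    linear_combination h - x ^ 3 * (ω ^ 3 + 1) * hω3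
  have hmap : ∀ {x y : F}, y ^ 2 = x ^ 3 + D →
      (pointIdeal D x y).map φ = pointIdeal D (ω ^ 2 * x) y := fun {x y} h => by
    obtain ⟨hx, hy⟩ := hrig x y h
    have hu : IsUnit (algebraMap F (Coord D) ω) := (IsUnit.mk0 _ hω0).map _
    rw [pointIdeal, Ideal.map_span, Set.image_pair, map_sub, map_sub, hX, hY, hφ, hφ, hx, hy,
      pointIdeal, Ideal.span_insert, Ideal.span_insert,
      ← Ideal.span_singleton_mul_left_unit hu (coordX D - _)]
    congr 3
    rw [mul_sub, ← map_mul]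
    congr 2
    linear_combination -x * hω3
  have hprod := pointIdeal_prod_three D hω hy₀ h₀
  set P := pointIdeal D x₀ y₀ with hP
  set P' := pointIdeal D (ω ^ 2 * x₀) y₀ with hP'
  set P'' := pointIdeal D (ω * x₀) y₀ with hP''
  have hPP' : P.map φ = P' := hmap h₀
  have hPP'' : P'.map φ = P'' := by
    rw [hP', hmap (htw h₀), hP'']
    congr 1
    linear_combination ω * x₀ * hω3
  set A := P * P' * (Ideal.span {b} * Ideal.span {φ b}) ⊔
    (Ideal.span {a} * (P' * Ideal.span {φ b}) ⊔ Ideal.span {a} * Ideal.span {φ a}) with hA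
  have hφ0 : ∀ {r}, r ≠ 0 → φ r ≠ 0 := fun {r} hr h => hr (hinj (by rw [h, map_zero]))
  have hA0 : A ≠ ⊥ := fun h => mul_ne_zero ha (hφ0 ha) (by
    have : a * φ a ∈ A := Ideal.mem_sup_right (Ideal.mem_sup_right
      (by rw [Ideal.span_singleton_mul_span_singleton]; exact Ideal.mem_span_singleton_self _))
    rwa [h, Ideal.mem_bot] at this)
  have hAmap : A.map φ = P' * P'' * (Ideal.span {φ b} * Ideal.span {φ (φ b)}) ⊔
    (Ideal.span {φ a} * (P'' * Ideal.span {φ (φ b)}) ⊔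
      Ideal.span {φ a} * Ideal.span {φ (φ a)}) := by
    simp only [hA, Ideal.map_sup, Ideal.map_mul, hPP', hPP'', Ideal.map_span,
      Set.image_singleton]
  have hnorm : P * P' * P'' * (Ideal.span {b} * Ideal.span {φ b} * Ideal.span {φ (φ b)}) =
      Ideal.span {a} * Ideal.span {φ a} * Ideal.span {φ (φ a)} := by
    simp only [hprod, Ideal.span_singleton_mul_span_singleton]
    rw [hn, Ideal.span_singleton_mul_left_unit hu]
  have key : A * (P'' * Ideal.span {φ (φ b)}) = Ideal.span {a} * A.map φ := by
    rw [hAmap, hA, Ideal.sup_mul, Ideal.sup_mul, Ideal.mul_sup, Ideal.mul_sup]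
    simp only [← mul_assoc]
    rw [← hnorm, sup_comm, sup_assoc]
    congr 1
    · ring
    · congr 1; ring
  obtain ⟨f, hf, J, hJ, hJ'⟩ := exists_mul_pointIdeal D hA0
  have hJmap : Ideal.span {φ f} = A.map φ * J.map φ := by
    rw [← Ideal.map_mul, ← hJ, Ideal.map_span, Set.image_singleton]
  have hfin : Ideal.span {f * φ (φ b)} * (P'' * J.map φ) = Ideal.span {a * φ f} * J := by
    rw [← Ideal.span_singleton_mul_span_singleton, ← Ideal.span_singleton_mul_span_singleton,
      hJ, hJmap]
    calc A * J * Ideal.span {φ (φ b)} * (P'' * J.map φ)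
        = A * (P'' * Ideal.span {φ (φ b)}) * (J * J.map φ) := by ring
      _ = _ := by rw [key]; ring
  have hs := mul_ne_zero hf (hφ0 (hφ0 hb))
  have ht := mul_ne_zero ha (hφ0 hf)
  have h₀' : y₀ ^ 2 = (ω * x₀) ^ 3 + D := by linear_combination h₀ - x₀ ^ 3 * hω3
  rcases hJ' with rfl | ⟨x, y, h, rfl⟩
  · rw [Ideal.map_top, Ideal.mul_top, Ideal.mul_top] at hfin
    exact (not_principal D h₀' hs ht hfin).elim
  · rw [hmap h] at hfin
    have := add_pt D h₀' (htw h) h hs ht hfin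
    refine ⟨x, y, h, add_omega_pt D (h := h) (h₃ := h₀')
      (h' := by rw [neg_sq]; exact htw h) hω ?_⟩
    rw [← neg_pt D (htw h), ← this]
    exact add_neg_cancel_right _ _

end descent
end Mordell

namespace Mordell

variable {k F : Type*} [Field k] [CharZero k] [Field F] [CharZero F] [Algebra k[X] F]
  [IsFractionRing k[X] F]

/-- The first coordinate of the distinguished section. -/
noncomputable def secX (k : Type*) [Field k] : k[X] := X ^ 2 - C 2 * X + C 4

/-- The second coordinate of the distinguished section. -/
noncomputable def secZ (k : Type*) [Field k] : k[X] := X ^ 3 + C 6 * X ^ 2 - C 6 * X + C 8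

lemma secZ_sq (k : Type*) [Field k] : secZ k ^ 2 = secX k ^ 3 + dPoly k := by
  simp only [secZ, secX, dPoly]
  have h : ∀ n : ℕ, (C (n : k) : k[X]) = n := fun n => by simp
  have h2 := h 2
  have h4 := h 4
  have h6 := h 6
  have h8 := h 8
  have h18 := h 18
  push_cast at h2 h4 h6 h8 h18
  rw [h2, h4, h6, h8, h18]
  ring

lemma secZ_ne_zero (k : Type*) [Field k] [CharZero k] : secZ k ≠ 0 := fun h => by
  have := congrArg (eval 0) h
  simp [secZ] at this

instance : NeZero (algebraMap k[X] F (dPoly k)) :=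
  ⟨by simpa using dPoly_ne_zero (k := k)⟩

variable [Differential k] {σ : k →+* k} {σF : F →+* F}
  {φ : Coord (algebraMap k[X] F (dPoly k)) →+* Coord (algebraMap k[X] F (dPoly k))}
  {a b u : Coord (algebraMap k[X] F (dPoly k))}

theorem not_norm_two (hσ : ∀ a, Differential.deriv a = 0 → σ a = a)
    (hσF : ∀ p, σF (algebraMap k[X] F p) = algebraMap k[X] F (p.map σ))
    (hinj : Function.Injective φ) (hφ : ∀ a, φ (algebraMap F _ a) = algebraMap F _ (σF a))
    (hX : φ (coordX _) = coordX _) (hY : φ (coordY _) = -coordY _)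
    (ha : a ≠ 0) (hb : b ≠ 0) (hu : IsUnit u)
    (hn : (coordX _ - algebraMap F _ (algebraMap k[X] F (secX k))) * (b * φ b) =
      u * (a * φ a)) : False := by
  obtain ⟨x, y, h, h2⟩ := exists_half_of_norm _ hinj hφ hX hY
    (fun x y h => point_fixed σ hσ σF hσF h)
    (y₀ := algebraMap k[X] F (secZ k)) (by rw [← map_pow, secZ_sq, map_add, map_pow])
    ha hb hu hn
  exact no_double_point h h2

theorem not_norm_three (hσ : ∀ a, Differential.deriv a = 0 → σ a = a)
    (hσF : ∀ p, σF (algebraMap k[X] F p) = algebraMap k[X] F (p.map σ))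
    (hinj : Function.Injective φ) (hφ : ∀ a, φ (algebraMap F _ a) = algebraMap F _ (σF a))
    {ω : F} (hω : ω ^ 2 + ω + 1 = 0)
    (hX : φ (coordX _) = algebraMap F _ ω * coordX _) (hY : φ (coordY _) = coordY _)
    (ha : a ≠ 0) (hb : b ≠ 0) (hu : IsUnit u)
    (hn : (coordY _ - algebraMap F _ (algebraMap k[X] F (secZ k))) * (b * φ b * φ (φ b)) =
      u * (a * φ a * φ (φ a))) : False := by
  obtain ⟨x, y, h, h2⟩ := exists_preimage_of_norm _ hinj hφ hω hX hY
    (fun x y h => point_fixed σ hσ σF hσF h) (x₀ := algebraMap k[X] F (secX k))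
    (y₀ := algebraMap k[X] F (secZ k)) (by simpa using secZ_ne_zero k)
    (by rw [← map_pow, secZ_sq, map_add, map_pow]) ha hb hu hn
  refine no_cm_point h (-3) ?_
  have h3 : algebraMap k[X] F (C (-3)) = -3 := by
    rw [C_neg, map_neg, show (C 3 : k[X]) = 3 from map_ofNat C 3, map_ofNat]
  rw [h2, map_mul, h3, secX]

end Mordell

theorem exists_derivation_eq_one {k₀ k : Type*} [Field k₀] [CharZero k₀] [Field k] [Algebra k₀ k]
    (f : k) (hf : Transcendental k₀ f) [Algebra.IsAlgebraic (Algebra.adjoin k₀ {f}) k] :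
    ∃ d : Derivation k₀ k k, d f = 1 := by
  let _ : Algebra k₀[X] k := (aeval (R := k₀) f).toAlgebra
  have hmap : ∀ p : k₀[X], algebraMap k₀[X] k p = aeval f p := fun _ ↦ rfl
  have : IsScalarTower k₀ k₀[X] k := .of_algebraMap_eq fun a ↦ by
    rw [hmap, Polynomial.algebraMap_apply, Algebra.algebraMap_self_apply, aeval_C]
  have hinj : Function.Injective (algebraMap k₀[X] k) := transcendental_iff_injective.mp hf
  have : FaithfulSMul k₀[X] k := (faithfulSMul_iff_algebraMap_injective _ _).mpr hinj
  let _ : Algebra (FractionRing k₀[X]) k := FractionRing.liftAlgebra k₀[X] k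
  have : IsScalarTower k₀[X] (FractionRing k₀[X]) k := FractionRing.isScalarTower_liftAlgebra _ _
  have : Algebra.IsAlgebraic k₀[X] k := by
    refine ⟨fun a ↦ ?_⟩
    obtain ⟨p, hp0, hp⟩ := Algebra.IsAlgebraic.isAlgebraic (R := Algebra.adjoin k₀ {f}) a
    have hr : Algebra.adjoin k₀ {f} = (aeval (R := k₀) f).range :=
      Algebra.adjoin_singleton_eq_range_aeval k₀ f
    let e : k₀[X] ≃ₐ[k₀] Algebra.adjoin k₀ {f} :=
      (AlgEquiv.ofInjective (aeval f) hinj).trans (Subalgebra.equivOfEq _ _ hr.symm)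
    refine ⟨p.map (e.symm : Algebra.adjoin k₀ {f} →+* k₀[X]), ?_, ?_⟩
    · rwa [Ne, Polynomial.map_eq_zero_iff e.symm.injective]
    · rw [aeval_def, eval₂_map, ← hp, aeval_def]
      congr 1
      ext b
      obtain ⟨q, rfl⟩ := e.surjective b
      have : e.symm (e q) = q := e.symm_apply_apply q
      simp only [RingHom.coe_comp, Function.comp_apply, RingHom.coe_coe, this, hmap]
      rfl
  have : Algebra.IsAlgebraic (FractionRing k₀[X]) k :=
    (IsFractionRing.comap_isAlgebraic_iff (A := k₀[X])).mp inferInstance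
  have : Algebra.FormallyEtale k₀[X] (FractionRing k₀[X]) :=
    .of_isLocalization (nonZeroDivisors k₀[X])
  have : CharZero (FractionRing k₀[X]) := charZero_of_injective_algebraMap (R := k₀[X]) (IsFractionRing.injective _ _)
  have : Algebra.FormallyEtale (FractionRing k₀[X]) k := .of_isSeparable _ _
  have : Algebra.FormallyEtale k₀[X] k := .comp _ (FractionRing k₀[X]) _
  let l : Ω[k⁄k₀] →ₗ[k] k :=
    (TensorProduct.AlgebraTensorModule.rid k₀[X] k k).toLinearMap ∘ₗ
      (LinearMap.baseChange k (KaehlerDifferential.polynomialEquiv k₀).toLinearMap) ∘ₗ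
      (KaehlerDifferential.tensorKaehlerEquivOfFormallyEtale k₀ k₀[X] k).symm.toLinearMap
  refine ⟨l.compDer (KaehlerDifferential.D k₀ k), ?_⟩
  have hX : f = algebraMap k₀[X] k X := by rw [hmap, aeval_X]
  have := KaehlerDifferential.tensorKaehlerEquivOfFormallyEtale_symm_D_algebraMap k₀ k₀[X] k X
  rw [hX]
  simp [l, this]

theorem mem_range_algebraMap_of_isAlgebraic {k₀ k : Type*} [Field k₀] [IsAlgClosed k₀] [Field k]
    [Algebra k₀ k] {a : k} (h : IsAlgebraic k₀ a) : a ∈ Set.range (algebraMap k₀ k) := by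
  obtain ⟨p, hp0, hp⟩ := h
  have hs : (p.map (algebraMap k₀ k)).roots = p.roots.map (algebraMap k₀ k) :=
    ((IsAlgClosed.splits p).roots_map (algebraMap k₀ k))
  have : a ∈ (p.map (algebraMap k₀ k)).roots := by
    rw [mem_roots_map hp0, ← aeval_def, hp]
  rw [hs, Multiset.mem_map] at this
  obtain ⟨b, -, hb⟩ := this
  exact ⟨b, hb⟩

theorem exists_derivation_constants {k₀ k : Type*} [Field k₀] [CharZero k₀] [IsAlgClosed k₀]
    [Field k] [Algebra k₀ k]
    (f : k) (hf : Transcendental k₀ f) [Algebra.IsAlgebraic (Algebra.adjoin k₀ {f}) k] :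
    ∃ d : Derivation k₀ k k, ∀ a, d a = 0 → a ∈ Set.range (algebraMap k₀ k) := by
  obtain ⟨d, hd⟩ := exists_derivation_eq_one f hf
  refine ⟨d, fun a ha ↦ ?_⟩
  by_contra hna
  have hat : Transcendental k₀ a := fun h ↦ hna (mem_range_algebraMap_of_isAlgebraic h)
  have hai : AlgebraicIndependent k₀ (fun _ : Unit ↦ a) :=
    algebraicIndependent_unique_type_iff.mpr hat
  have htb : IsTranscendenceBasis k₀ (fun _ : Unit ↦ a) := by
    refine hai.isTranscendenceBasis_of_lift_trdeg_le_of_finite ?_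
    have := Algebra.IsAlgebraic.trdeg_le_cardinalMk k₀ ({f} : Set k)
    simpa using this
  let E := IntermediateField.adjoin k₀ (Set.range (fun _ : Unit ↦ a))
  have : Algebra.IsAlgebraic E k := htb.isAlgebraic_field
  have hE : ∀ e ∈ E, d e = 0 := by
    intro e he
    induction he using IntermediateField.adjoin_induction with
    | mem x hx => obtain ⟨_, rfl⟩ := hx; exact ha
    | algebraMap x => exact d.map_algebraMap x
    | add x y _ _ hx hy => rw [map_add, hx, hy, add_zero]
    | inv x _ hx => rw [Derivation.leibniz_inv, hx, smul_zero]
    | mul x y _ _ hx hy => rw [d.leibniz, hx, hy, smul_zero, smul_zero, add_zero]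
  let d' : Derivation E k k := Derivation.mk'
    { toFun := d
      map_add' := map_add d
      map_smul' := fun e x ↦ by
        rw [Algebra.smul_def, d.leibniz, show d (algebraMap E k e) = 0 from hE _ e.2,
          smul_zero, add_zero]; rfl }
    (fun x y ↦ d.leibniz x y)
  have h := d'.map_aeval (minpoly E f) f
  rw [minpoly.aeval, map_zero, eq_comm] at h
  have hne := (Algebra.IsSeparable.isSeparable E f).aeval_derivative_ne_zero (minpoly.aeval E f)
  have hf1 : d' f = 1 := hd
  rw [hf1, smul_eq_mul, mul_one] at h
  exact hne h

section Pair

open scoped IntermediateField.algebraAdjoinAdjoin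

variable {k Ω : Type*} [Field k] [Field Ω] [Algebra k Ω]

theorem algebraicIndependent_pair {a b : Ω} (htr : 2 ≤ Algebra.trdeg k Ω)
    (h : Algebra.IsAlgebraic (IntermediateField.adjoin k {a, b}) Ω) :
    AlgebraicIndependent k ![a, b] := by
  have hr : Set.range ![a, b] = {a, b} := by simp [Set.pair_comm]
  have : Algebra.IsAlgebraic (Algebra.adjoin k (Set.range ![a, b])) Ω := by
    rw [← hr] at h
    exact (IsFractionRing.comap_isAlgebraic_iff
      (K := IntermediateField.adjoin k (Set.range ![a, b]))).mpr h
  refine (Algebra.IsAlgebraic.isTranscendenceBasis_of_lift_le_trdeg_of_finite k ![a, b] ?_).1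
  simpa using htr

theorem isAlgebraic_adjoin_pair {a b c : Ω} (hgen : IntermediateField.adjoin k {a, b, c} = ⊤)
    (hc : IsAlgebraic (IntermediateField.adjoin k {a, b}) c) :
    Algebra.IsAlgebraic (IntermediateField.adjoin k {a, b}) Ω := by
  let E := IntermediateField.adjoin k {a, b}
  have htop : IntermediateField.adjoin E {c} = ⊤ := by
    rw [← IntermediateField.restrictScalars_eq_top_iff (K := k),
      IntermediateField.adjoin_adjoin_left, ← hgen]
    congr 1
    ext; simp; tauto
  have := IntermediateField.isAlgebraic_adjoin_simple (K := E) hc.isIntegral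
  rw [htop] at this
  exact (IntermediateField.topEquiv (F := E) (E := Ω)).isAlgebraic

theorem transcendental_of_pair {a b : Ω} (h : AlgebraicIndependent k ![a, b]) :
    Transcendental (Algebra.adjoin k {a}) b := by
  have h' : AlgebraicIndependent k (fun o : Option Unit ↦ o.elim b fun _ ↦ a) := by
    let g : Option Unit → Fin 2 := fun o ↦ o.elim 1 fun _ ↦ 0
    have hg : Function.Injective g := by
      rintro (_ | _) (_ | _) <;> simp [g]
    convert! h.comp g hg using 1
    funext o
    rcases o with _ | _ <;> rfl
  have := (AlgebraicIndependent.option_iff_transcendental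
    (h.comp (fun _ : Unit ↦ (0 : Fin 2)) fun _ _ _ ↦ rfl) b).mp h'
  have hr : Set.range (![a, b] ∘ fun _ : Unit ↦ 0) = {a} := by ext; simp [eq_comm]
  rwa [hr] at this

end Pair

namespace Mordell

section Embedding

variable {k Ω : Type*} [Field k] [Field Ω] [Algebra k Ω]

theorem exists_embedding (htr : 2 ≤ Algebra.trdeg k Ω) {v x z : Ω}
    (hE : z ^ 2 = x ^ 3 + 18 * v ^ 2 * (v ^ 3 + 2))
    (hgen : IntermediateField.adjoin k {v, x, z} = ⊤) :
    ∃ (ev : FractionRing k[X] →+* Ω)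
      (i : Coord (algebraMap k[X] (FractionRing k[X]) (dPoly k)) →+* Ω),
      (∀ p, ev (algebraMap k[X] _ p) = aeval v p) ∧ (∀ a, i (algebraMap _ _ a) = ev a) ∧
      i (coordX _) = x ∧ i (coordY _) = z ∧ Function.Injective i ∧
      ∀ w : Ω, ∃ a b, b ≠ 0 ∧ w = i a / i b := by
  have hz : IsAlgebraic (IntermediateField.adjoin k {v, x}) z := by
    have hv : v ∈ IntermediateField.adjoin k {v, x} :=
      IntermediateField.subset_adjoin k {v, x} (by simp)
    have hx : x ∈ IntermediateField.adjoin k {v, x} :=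
      IntermediateField.subset_adjoin k {v, x} (by simp)
    refine IsIntegral.isAlgebraic (IsIntegral.of_pow two_pos ?_)
    let e : IntermediateField.adjoin k {v, x} := ⟨x, hx⟩ ^ 3 + 18 * ⟨v, hv⟩ ^ 2 * (⟨v, hv⟩ ^ 3 + 2)
    have : z ^ 2 = algebraMap (IntermediateField.adjoin k {v, x}) Ω e := by
      rw [hE]; simp only [e, map_add, map_mul, map_pow]
      rw [map_ofNat, map_ofNat]; rfl
    rw [this]
    exact isIntegral_algebraMap
  have hind := algebraicIndependent_pair htr (isAlgebraic_adjoin_pair hgen hz)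
  have hvt : Transcendental k v := hind.transcendental 0
  have hxt := transcendental_of_pair hind
  have hvinj : Function.Injective (aeval (R := k) v) := transcendental_iff_injective.mp hvt
  let ev : FractionRing k[X] →+* Ω := IsFractionRing.lift (g := (aeval (R := k) v).toRingHom) hvinj
  have hev : ∀ p, ev (algebraMap k[X] _ p) = aeval v p := fun p ↦
    IsFractionRing.lift_algebraMap (g := (aeval (R := k) v).toRingHom) hvinj p
  have hxF : ∀ p : (FractionRing k[X])[X], p.eval₂ ev x = 0 → p = 0 := by
    let _ : Algebra (FractionRing k[X]) Ω := ev.toAlgebra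
    let _ : Algebra k[X] Ω := (aeval (R := k) v).toAlgebra
    have : IsScalarTower k[X] (FractionRing k[X]) Ω := .of_algebraMap_eq fun p ↦ (hev p).symm
    intro p hp
    by_contra hp0
    have h1 : IsAlgebraic (FractionRing k[X]) x := ⟨p, hp0, hp⟩
    rw [← IsFractionRing.isAlgebraic_iff k[X]] at h1
    obtain ⟨q, hq0, hq⟩ := h1
    have hmem : ∀ p : k[X], aeval v p ∈ Algebra.adjoin k {v} := fun p ↦ by
      rw [Algebra.adjoin_singleton_eq_range_aeval]; exact ⟨p, rfl⟩
    let e : k[X] →ₐ[k] Algebra.adjoin k {v} := (aeval (R := k) v).codRestrict _ hmem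
    have he : Function.Injective e := fun a b hab ↦ hvinj (congrArg Subtype.val hab)
    refine hxt ⟨q.map e.toRingHom, ?_, ?_⟩
    · rwa [Ne, Polynomial.map_eq_zero_iff he]
    · rw [aeval_def, eval₂_map]
      exact hq
  have h : z ^ 2 = x ^ 3 + ev (algebraMap k[X] (FractionRing k[X]) (dPoly k)) := by
    rw [hev, hE, dPoly]; simp [map_ofNat (algebraMap k Ω)]
  let i := lift _ ev x z h
  have hinj : Function.Injective i := by
    rw [injective_iff_map_eq_zero]
    intro r hr
    obtain ⟨p, q, rfl⟩ := exists_eq _ r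
    have h0 := congrArg i (mul_conj _ p q)
    rw [map_mul, hr, zero_mul, lift_poly, eq_comm] at h0
    have h1 := hxF _ h0
    have h2 := mul_conj (algebraMap k[X] (FractionRing k[X]) (dPoly k)) p q
    rw [h1, map_zero, mul_eq_zero] at h2
    rcases h2 with h2 | h2
    · exact h2
    · rw [← conj_conj _ (_ + _), h2, map_zero]
  refine ⟨ev, i, hev, fun a ↦ lift_scalar .., lift_coordX .., lift_coordY .., hinj, fun w ↦ ?_⟩
  let R := Coord (algebraMap k[X] (FractionRing k[X]) (dPoly k))
  let ι : FractionRing R →+* Ω := IsFractionRing.lift hinj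
  have hι : ∀ r : R, ι (algebraMap _ _ r) = i r := IsFractionRing.lift_algebraMap hinj
  have hk : ∀ a : k, i (algebraMap _ _ (algebraMap k[X] _ (C a))) = algebraMap k Ω a := fun a ↦ by
    rw [lift_scalar, hev, aeval_C]
  let E : IntermediateField k Ω := ι.fieldRange.toIntermediateField fun a ↦
    ⟨algebraMap R _ (algebraMap _ _ (algebraMap k[X] _ (C a))), by rw [hι, hk]⟩
  have hmemE : ∀ r : R, i r ∈ E := fun r ↦ ⟨algebraMap R _ r, hι r⟩
  have hEtop : E = ⊤ := by
    rw [← top_le_iff, ← hgen, IntermediateField.adjoin_le_iff]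
    rintro a (rfl | rfl | rfl)
    · have : i (algebraMap _ _ (algebraMap k[X] (FractionRing k[X]) X)) = a := by rw [lift_scalar, hev, aeval_X]
      exact this ▸ hmemE _
    · have : i (coordX _) = a := lift_coordX ..
      exact this ▸ hmemE _
    · have : i (coordY _) = a := lift_coordY ..
      exact this ▸ hmemE _
  have hw : w ∈ E := hEtop ▸ IntermediateField.mem_top
  obtain ⟨t, ht⟩ := hw
  obtain ⟨a, b, hb, rfl⟩ := IsFractionRing.div_surjective (A := R) t
  refine ⟨a, b, nonZeroDivisors.ne_zero hb, ?_⟩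
  rw [← ht]
  exact (map_div₀ ι _ _).trans (by rw [hι, hι])

theorem exists_equivariant {v x z : Ω} {ev : FractionRing k[X] →+* Ω}
    {i : Coord (algebraMap k[X] (FractionRing k[X]) (dPoly k)) →+* Ω}
    (hev : ∀ p, ev (algebraMap k[X] _ p) = aeval v p) (hi : ∀ a, i (algebraMap _ _ a) = ev a)
    (hx : i (coordX _) = x) (hz : i (coordY _) = z) (hinj : Function.Injective i)
    {σ : k →+* k} {s : Ω →+* Ω} (hs : ∀ a, s (algebraMap k Ω a) = algebraMap k Ω (σ a))
    (hsv : s v = v) {c e : k} (hc : c ^ 3 = 1) (he : e ^ 2 = 1)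
    (hsx : s x = algebraMap k Ω c * x) (hsz : s z = algebraMap k Ω e * z) :
    ∃ (σF : FractionRing k[X] →+* FractionRing k[X])
      (φ : Coord (algebraMap k[X] (FractionRing k[X]) (dPoly k)) →+*
        Coord (algebraMap k[X] (FractionRing k[X]) (dPoly k))),
      (∀ p, σF (algebraMap k[X] _ p) = algebraMap k[X] _ (p.map σ)) ∧
      Function.Injective φ ∧ (∀ a, φ (algebraMap _ _ a) = algebraMap _ _ (σF a)) ∧
      φ (coordX _) = algebraMap _ _ (algebraMap k[X] (FractionRing k[X]) (C c)) * coordX _ ∧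
      φ (coordY _) = algebraMap _ _ (algebraMap k[X] (FractionRing k[X]) (C e)) * coordY _ ∧
      ∀ r, s (i r) = i (φ r) := by
  have hσi : Function.Injective ((algebraMap k[X] (FractionRing k[X])).comp (mapRingHom σ)) :=
    (IsFractionRing.injective _ _).comp (map_injective σ σ.injective)
  let σF : FractionRing k[X] →+* FractionRing k[X] := IsFractionRing.lift hσi
  have hσF : ∀ p, σF (algebraMap k[X] _ p) = algebraMap k[X] _ (p.map σ) :=
    IsFractionRing.lift_algebraMap hσi
  have hsev : s.comp ev = ev.comp σF := by
    refine IsLocalization.ringHom_ext (nonZeroDivisors k[X]) ?_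
    refine Polynomial.ringHom_ext (fun a ↦ ?_) ?_
    · simp [hev, hσF, hs]
    · simp [hev, hσF, hsv]
  have hσD : σF (algebraMap k[X] _ (dPoly k)) = algebraMap k[X] _ (dPoly k) := by
    rw [hσF]; congr 1; simp [dPoly, map_ofNat σ]
  let a : FractionRing k[X] →+* Coord (algebraMap k[X] (FractionRing k[X]) (dPoly k)) :=
    algebraMap _ _
  let cF : k → Coord (algebraMap k[X] (FractionRing k[X]) (dPoly k)) := fun c ↦
    a (algebraMap k[X] (FractionRing k[X]) (C c))
  have hic : ∀ b, i (cF b) = algebraMap k Ω b := fun b ↦ by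
    rw [hi, hev, aeval_C]
  have hφ : (cF e * coordY _) ^ 2 = (cF c * coordX _) ^ 3 +
      (a.comp σF) (algebraMap k[X] (FractionRing k[X]) (dPoly k)) := by
    have h1 : cF e ^ 2 = 1 := by simp only [cF, ← map_pow, he, map_one]
    have h2 : cF c ^ 3 = 1 := by simp only [cF, ← map_pow, hc, map_one]
    rw [mul_pow, mul_pow, h1, h2, one_mul, one_mul, coordY_sq, RingHom.comp_apply, hσD]
  let φ := lift _ (a.comp σF) (cF c * coordX _) (cF e * coordY _) hφ
  have hφs : ∀ b, φ (algebraMap _ _ b) = algebraMap _ _ (σF b) := fun b ↦ lift_scalar ..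
  have hcomm : s.comp i = i.comp φ := by
    refine hom_ext _ (fun b ↦ ?_) ?_ ?_
    · rw [RingHom.comp_apply, RingHom.comp_apply, hφs, hi, hi]
      exact RingHom.congr_fun hsev b
    · rw [RingHom.comp_apply, RingHom.comp_apply, lift_coordX, map_mul, hic, hx, hsx]
    · rw [RingHom.comp_apply, RingHom.comp_apply, lift_coordY, map_mul, hic, hz, hsz]
  refine ⟨σF, φ, hσF, ?_, hφs, lift_coordX .., lift_coordY .., RingHom.congr_fun hcomm⟩
  have : Function.Injective (i.comp φ) := hcomm ▸ s.injective.comp hinj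
  exact .of_comp (f := i) this

end Embedding

end Mordell

namespace Mordell

section Automorphism

variable {k A Ω : Type*} [Field k] [CharZero k] [Differential k]
  [CommRing A] [IsDomain A] [UniqueFactorizationMonoid A] [Algebra k A]
  [Field Ω] [Algebra A Ω] [IsFractionRing A Ω] [Algebra k Ω] [IsScalarTower k A Ω]

omit [CharZero k] [Differential k] [IsDomain A] [UniqueFactorizationMonoid A]
  [IsFractionRing A Ω] in
theorem valuation_natCast_eq_one [CharZero k] {Γ : Type*} [LinearOrderedCommGroupWithZero Γ]
    {w : Valuation Ω Γ} (hw : ∀ a : A, w (algebraMap A Ω a) ≤ 1) {n : ℕ} (hn : n ≠ 0) :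
    w n = 1 := by
  have hk : ∀ c : k, w (algebraMap k Ω c) ≤ 1 := fun c ↦ by
    rw [IsScalarTower.algebraMap_apply k A Ω]; exact hw _
  have hn' : (n : k) ≠ 0 := Nat.cast_ne_zero.mpr hn
  refine le_antisymm (by simpa using hk n) ?_
  have h1 := hk (n : k)⁻¹
  have h2 : w (algebraMap k Ω n) * w (algebraMap k Ω (n : k)⁻¹) = 1 := by
    rw [← map_mul, ← map_mul, mul_inv_cancel₀ hn', map_one, map_one]
  rw [map_natCast] at h2
  calc 1 = w n * w (algebraMap k Ω (n : k)⁻¹) := h2.symm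
    _ ≤ w n * 1 := by gcongr
    _ = w n := mul_one _

variable (htr : 2 ≤ Algebra.trdeg k Ω) (hunit : ∀ u : Aˣ, ∃ c : k, algebraMap k A c = u)
  {σ : k →+* k} (hσ : ∀ a, Differential.deriv a = 0 → σ a = a)
  {σA : RingAut A} {s : RingAut Ω} (hs : ∀ a : A, s (algebraMap A Ω a) = algebraMap A Ω (σA a))
  (hsk : ∀ a, s (algebraMap k Ω a) = algebraMap k Ω (σ a))
  {v x z : Ω} (hE : z ^ 2 = x ^ 3 + 18 * v ^ 2 * (v ^ 3 + 2))
  (hgen : IntermediateField.adjoin k {v, x, z} = ⊤) (hsv : s v = v)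

include htr hunit hσ hs hsk hE hgen hsv

theorem not_involution (hσA : σA ^ 2 = 1) (hsx : s x = x) (hsz : s z = -z) : False := by
  have : CharZero Ω := charZero_of_injective_algebraMap (algebraMap k Ω).injective
  have : CharZero (FractionRing k[X]) :=
    charZero_of_injective_algebraMap (IsFractionRing.injective k[X] (FractionRing k[X]))
  obtain ⟨ev, i, hev, hi, hix, hiz, hinj, hsurj⟩ := exists_embedding htr hE hgen
  obtain ⟨σF, φ, hσF, hφinj, hφs, hφx, hφy, hφ⟩ := exists_equivariant (s := (s : Ω →+* Ω))
    hev hi hix hiz hinj hsk hsv (c := 1) (e := -1) (by norm_num) (by norm_num)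
    (by simpa using hsx) (by simpa using hsz)
  let g₀ : Coord (algebraMap k[X] (FractionRing k[X]) (dPoly k)) :=
    coordX _ - algebraMap _ _ (algebraMap k[X] (FractionRing k[X]) (secX k))
  have hg₀ : i g₀ = x - (v ^ 2 - 2 * v + 4) := by
    rw [map_sub, hix, hi, hev, secX]; simp [map_ofNat (algebraMap k Ω)]
  have hg0 : x - (v ^ 2 - 2 * v + 4) ≠ 0 := by
    rw [← hg₀, map_ne_zero_iff i hinj]
    intro h
    have h' : algebraMap _ (Coord (algebraMap k[X] (FractionRing k[X]) (dPoly k)))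
        (X - C (algebraMap k[X] (FractionRing k[X]) (secX k))) + algebraMap _ _ 0 * coordY _ = 0 := by
      rw [map_zero, zero_mul, add_zero, map_sub, algebraMap_X, algebraMap_C]; exact h
    exact X_sub_C_ne_zero _ (eq_zero_of _ h').1
  have hn2 : s 2 = 2 := map_ofNat s 2
  have hn4 : s 4 = 4 := map_ofNat s 4
  have hn6 : s 6 = 6 := map_ofNat s 6
  have hn8 : s 8 = 8 := map_ofNat s 8
  obtain ⟨u, h, hh, hgh⟩ := exists_norm_of_valuations Nat.prime_two hσA hs hg0
    (by simp [hsx, hsv, hn2, hn4]) (fun w hwA hws ↦ by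
      refine section_sq_of_conj w (fun n hn ↦ valuation_natCast_eq_one (k := k) hwA hn) hE ?_
      rw [← hws (z - _), ← w.map_neg]
      congr 1
      simp only [map_sub, map_add, map_mul, map_pow, hsz, hsv, hn6, hn8]
      ring)
  obtain ⟨c, hc⟩ := hunit u
  obtain ⟨a, b, hb, rfl⟩ := hsurj h
  have ha : a ≠ 0 := by rintro rfl; simp at hh
  have hc0 : c ≠ 0 := by
    rintro rfl
    exact u.ne_zero (by rw [← hc, map_zero])
  refine not_norm_two hσ hσF hφinj hφs (by simpa using hφx) (by simpa using hφy) ha hb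
    (u := algebraMap _ _ (algebraMap k[X] (FractionRing k[X]) (C c))) ?_ ?_
  · exact ((isUnit_C.mpr hc0.isUnit).map _).map _
  · apply hinj
    have hib : i b ≠ 0 := (map_ne_zero_iff i hinj).mpr hb
    have hib' : i (φ b) ≠ 0 := (map_ne_zero_iff i hinj).mpr ((map_ne_zero_iff φ hφinj).mpr hb)
    have hφ' : ∀ r, s (i r) = i (φ r) := hφ
    have huc : i (algebraMap _ _ (algebraMap k[X] (FractionRing k[X]) (C c))) =
        algebraMap A Ω u := by
      rw [hi, hev, aeval_C, ← hc, ← IsScalarTower.algebraMap_apply]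
    rw [map_mul, hg₀, hgh, map_mul i (algebraMap _ _ _), huc]
    simp only [cyclicNorm, Finset.prod_range_succ, Finset.prod_range_zero, pow_zero, pow_one,
      RingAut.one_apply, map_div₀, hφ', map_mul, one_mul]
    field_simp

theorem not_triality {ω : k} (hω : ω ^ 2 + ω + 1 = 0) (hσω : σ ω = ω) (hσA : σA ^ 3 = 1)
    (hsx : s x = algebraMap k Ω ω * x) (hsz : s z = z) : False := by
  have : CharZero Ω := charZero_of_injective_algebraMap (algebraMap k Ω).injective
  have : CharZero (FractionRing k[X]) :=
    charZero_of_injective_algebraMap (IsFractionRing.injective k[X] (FractionRing k[X]))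
  obtain ⟨ev, i, hev, hi, hix, hiz, hinj, hsurj⟩ := exists_embedding htr hE hgen
  obtain ⟨σF, φ, hσF, hφinj, hφs, hφx, hφy, hφ⟩ := exists_equivariant (s := (s : Ω →+* Ω))
    hev hi hix hiz hinj hsk hsv (c := ω) (e := 1) (by linear_combination (ω - 1) * hω) (by norm_num)
    hsx (by simpa using hsz)
  let g₀ : Coord (algebraMap k[X] (FractionRing k[X]) (dPoly k)) :=
    coordY _ - algebraMap _ _ (algebraMap k[X] (FractionRing k[X]) (secZ k))
  have hg₀ : i g₀ = z - (v ^ 3 + 6 * v ^ 2 - 6 * v + 8) := by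
    rw [map_sub, hiz, hi, hev, secZ]; simp [map_ofNat (algebraMap k Ω)]
  have hg0 : z - (v ^ 3 + 6 * v ^ 2 - 6 * v + 8) ≠ 0 := by
    rw [← hg₀, map_ne_zero_iff i hinj]
    intro h
    have h' : algebraMap _ (Coord (algebraMap k[X] (FractionRing k[X]) (dPoly k)))
        (-C (algebraMap k[X] (FractionRing k[X]) (secZ k))) +
          algebraMap (FractionRing k[X])[X] _ 1 * coordY _ = 0 := by
      rw [map_one, one_mul, map_neg, algebraMap_C, neg_add_eq_sub]; exact h
    exact one_ne_zero (eq_zero_of _ h').2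
  have hn2 : s 2 = 2 := map_ofNat s 2
  have hn4 : s 4 = 4 := map_ofNat s 4
  have hn6 : s 6 = 6 := map_ofNat s 6
  have hn8 : s 8 = 8 := map_ofNat s 8
  have hωΩ : algebraMap k Ω ω ^ 2 + algebraMap k Ω ω + 1 = 0 := by
    simpa using congrArg (algebraMap k Ω) hω
  obtain ⟨u, h, hh, hgh⟩ := exists_norm_of_valuations Nat.prime_three hσA hs hg0
    (by simp [hsz, hsv, hn6, hn8]) (fun w hwA hws ↦ by
      have h1 : w (algebraMap k Ω ω * x - (v ^ 2 - 2 * v + 4)) =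
          w (x - (v ^ 2 - 2 * v + 4)) := by
        rw [← hws (x - _)]
        simp only [map_sub, map_add, map_mul, map_pow, hsx, hsv, hn2, hn4]
      refine section_cube_of_conj w (fun n hn ↦ valuation_natCast_eq_one (k := k) hwA hn) hE
        hωΩ h1 ?_
      rw [← h1, ← hws (algebraMap k Ω ω * x - _)]
      simp only [map_sub, map_add, map_mul, hsx, hsv, hn2, hn4, hsk, hσω, pow_two,
        mul_assoc])
  obtain ⟨c, hc⟩ := hunit u
  obtain ⟨a, b, hb, rfl⟩ := hsurj h
  have ha : a ≠ 0 := by rintro rfl; simp at hh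
  have hc0 : c ≠ 0 := by
    rintro rfl
    exact u.ne_zero (by rw [← hc, map_zero])
  refine not_norm_three (ω := algebraMap k[X] (FractionRing k[X]) (C ω)) hσ hσF hφinj hφs
    ?_ hφx (by simpa using hφy) ha hb
    (u := algebraMap _ _ (algebraMap k[X] (FractionRing k[X]) (C c))) ?_ ?_
  · have : C ω ^ 2 + C ω + 1 = (0 : k[X]) := by simpa using congrArg C hω
    simpa using congrArg (algebraMap k[X] (FractionRing k[X])) this
  · exact ((isUnit_C.mpr hc0.isUnit).map _).map _
  · apply hinj
    have hφb : φ b ≠ 0 := (map_ne_zero_iff φ hφinj).mpr hb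
    have hib : i b ≠ 0 := (map_ne_zero_iff i hinj).mpr hb
    have hib' : i (φ b) ≠ 0 := (map_ne_zero_iff i hinj).mpr hφb
    have hib'' : i (φ (φ b)) ≠ 0 :=
      (map_ne_zero_iff i hinj).mpr ((map_ne_zero_iff φ hφinj).mpr hφb)
    have hφ' : ∀ r, s (i r) = i (φ r) := hφ
    have hφ'' : ∀ r, (s ^ 2) (i r) = i (φ (φ r)) := fun r ↦ by
      rw [← hφ', ← hφ', pow_two]; rfl
    have huc : i (algebraMap _ _ (algebraMap k[X] (FractionRing k[X]) (C c))) =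
        algebraMap A Ω u := by
      rw [hi, hev, aeval_C, ← hc, ← IsScalarTower.algebraMap_apply]
    rw [map_mul, hg₀, hgh, map_mul i (algebraMap _ _ _), huc]
    simp only [cyclicNorm, Finset.prod_range_succ, Finset.prod_range_zero, pow_zero, pow_one,
      RingAut.one_apply, map_div₀, hφ', hφ'', map_mul, one_mul]
    field_simp

end Automorphism

end Mordell

section Kummer

variable {k₀ K : Type*} [Field k₀] [CharZero k₀] [IsAlgClosed k₀] [Field K] [Algebra k₀ K]

omit [CharZero k₀] in
theorem exists_of_pow_eq_one {n : ℕ} (hn : n ≠ 0) {a : K} (ha : a ^ n = 1) :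
    ∃ c : k₀, algebraMap k₀ K c = a ∧ c ^ n = 1 := by
  have hs : (X ^ n - C 1 : k₀[X]).Splits := IsAlgClosed.splits _
  have hne : (X ^ n - C 1 : k₀[X]) ≠ 0 := X_pow_sub_C_ne_zero (Nat.pos_of_ne_zero hn) 1
  have hr := hs.roots_map (algebraMap k₀ K)
  have hmem : a ∈ ((X ^ n - C 1 : k₀[X]).map (algebraMap k₀ K)).roots := by
    rw [mem_roots_map hne]; simp [ha]
  rw [hr, Multiset.mem_map] at hmem
  obtain ⟨c, -, rfl⟩ := hmem
  exact ⟨c, rfl, (algebraMap k₀ K).injective (by rw [map_pow, ha, map_one])⟩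

theorem exists_kummer_automorphism {f : K} (hf : f ≠ 0) {n : ℕ} (hn : n ≠ 0)
    (hno : ¬ ∃ ρ : K, ρ ^ n = f) :
    ∃ (ρ : (X ^ n - C f).SplittingField) (p : ℕ) (η : k₀)
      (σ : (X ^ n - C f).SplittingField ≃ₐ[K] (X ^ n - C f).SplittingField),
      ρ ^ n = algebraMap K _ f ∧ p.Prime ∧ p ∣ n ∧ IsPrimitiveRoot η p ∧ σ ^ p = 1 ∧
        σ ρ = algebraMap k₀ _ η * ρ := by
  have : CharZero K := charZero_of_injective_algebraMap (algebraMap k₀ K).injective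
  let k := (X ^ n - C f).SplittingField
  have hdeg : (X ^ n - C f).degree ≠ 0 := by
    rw [degree_X_pow_sub_C (Nat.pos_of_ne_zero hn)]; exact_mod_cast hn
  obtain ⟨ρ, hρ⟩ := (SplittingField.splits (X ^ n - C f)).exists_eval_eq_zero
    (by rwa [degree_map])
  replace hρ : ρ ^ n = algebraMap K k f := by
    simpa [sub_eq_zero] using hρ
  have hρ0 : ρ ≠ 0 := by
    rintro rfl
    rw [zero_pow hn, eq_comm, map_eq_zero] at hρ
    exact hf hρ
  have : IsGalois K k := IsGalois.mk
  have hgal : ∃ τ : k ≃ₐ[K] k, τ ρ ≠ ρ := by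
    by_contra! h
    have : ρ ∈ (⊥ : IntermediateField K k) := (IsGalois.mem_bot_iff_fixed ρ).mpr h
    obtain ⟨r, hr⟩ := IntermediateField.mem_bot.mp this
    exact hno ⟨r, (algebraMap K k).injective (by rw [map_pow, hr, hρ])⟩
  obtain ⟨τ, hτ⟩ := hgal
  have hroot : ∀ r : k, r ^ n = algebraMap K k f → ∃ c : k₀, r = algebraMap k₀ k c * ρ ∧ c ^ n = 1 := by
    intro r hr
    obtain ⟨c, hc, hcn⟩ := exists_of_pow_eq_one (k₀ := k₀) hn (a := r / ρ) (by
      rw [div_pow, hr, hρ, div_self]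
      rwa [Ne, map_eq_zero])
    exact ⟨c, by rw [hc, div_mul_cancel₀ _ hρ0], hcn⟩
  have hfix : ∀ (σ : k ≃ₐ[K] k) (c : k₀), σ (algebraMap k₀ k c) = algebraMap k₀ k c := fun σ c ↦ by
    rw [IsScalarTower.algebraMap_apply k₀ K k, σ.commutes]
  obtain ⟨ε, hε, hεn⟩ := hroot (τ ρ) (by rw [← map_pow, hρ, τ.commutes])
  have hiter : ∀ j : ℕ, (τ ^ j) ρ = algebraMap k₀ k (ε ^ j) * ρ := by
    intro j
    induction j with
    | zero => simp
    | succ j ih =>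
      rw [pow_succ', AlgEquiv.mul_apply, ih, map_mul, hfix, hε, pow_succ, map_mul, mul_assoc]
  have hε1 : ε ≠ 1 := by
    rintro rfl
    exact hτ (by rw [hε, map_one, one_mul])
  have hdvd : orderOf ε ∣ n := orderOf_dvd_of_pow_eq_one hεn
  have hpos : 0 < orderOf ε := Nat.pos_of_dvd_of_pos hdvd (Nat.pos_of_ne_zero hn)
  obtain ⟨p, hp, m, hm⟩ := Nat.exists_prime_and_dvd (n := orderOf ε) (by rwa [Ne, orderOf_eq_one_iff])
  have hη : IsPrimitiveRoot (ε ^ m) p :=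
    (IsPrimitiveRoot.orderOf ε).pow hpos (by rw [hm, mul_comm])
  refine ⟨ρ, p, ε ^ m, τ ^ m, hρ, hp, (Dvd.intro _ hm.symm).trans hdvd, hη, ?_, hiter m⟩
  rw [← pow_mul, mul_comm, ← hm]
  have hgen := SplittingField.adjoin_rootSet (X ^ n - C f)
  have : ((τ ^ orderOf ε : k ≃ₐ[K] k) : k →ₐ[K] k) = AlgHom.id K k := by
    refine AlgHom.ext_of_adjoin_eq_top hgen fun r hr ↦ ?_
    obtain ⟨c, rfl, -⟩ := hroot r (by
      rw [mem_rootSet] at hr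
      simpa [sub_eq_zero] using hr.2)
    change (τ ^ orderOf ε) _ = _
    rw [map_mul, hfix, hiter, pow_orderOf_eq_one, map_one, one_mul]
    rfl
  ext r
  exact DFunLike.congr_fun this r

end Kummer

section BaseChange

theorem natCast_le_trdeg_fractionRing (k : Type*) [Field k] (n : ℕ) :
    n ≤ Algebra.trdeg k (FractionRing (MvPolynomial (Fin n) k)) := by
  have h : AlgebraicIndependent k
      (fun i ↦ algebraMap _ (FractionRing (MvPolynomial (Fin n) k)) (MvPolynomial.X (R := k) i)) :=
    (MvPolynomial.algebraicIndependent_X (Fin n) k).map'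
      (f := IsScalarTower.toAlgHom k (MvPolynomial (Fin n) k) (FractionRing (MvPolynomial (Fin n) k)))
      (IsFractionRing.injective _ _)
  simpa using h.lift_cardinalMk_le_trdeg

theorem two_le_trdeg_fractionRing (k : Type*) [Field k] :
    2 ≤ Algebra.trdeg k (FractionRing (MvPolynomial (Fin 2) k)) :=
  mod_cast natCast_le_trdeg_fractionRing k 2

variable (K k : Type*) [Field K] [Field k] [Algebra K k] (ι : Type*)

/-- The map of rational function fields induced by an extension of coefficient fields. -/
noncomputable def ratBaseChange :
    FractionRing (MvPolynomial ι K) →+* FractionRing (MvPolynomial ι k) :=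
  IsFractionRing.lift (A := MvPolynomial ι K)
    (g := (algebraMap (MvPolynomial ι k) (FractionRing (MvPolynomial ι k))).comp
      (MvPolynomial.map (algebraMap K k)))
    ((IsFractionRing.injective _ _).comp (MvPolynomial.map_injective _ (algebraMap K k).injective))

theorem ratBaseChange_algebraMap (p : MvPolynomial ι K) :
    ratBaseChange K k ι (algebraMap _ _ p) = algebraMap _ _ (MvPolynomial.map (algebraMap K k) p) :=
  IsFractionRing.lift_algebraMap (A := MvPolynomial ι K) (K := FractionRing (MvPolynomial ι K))
    (g := (algebraMap (MvPolynomial ι k) (FractionRing (MvPolynomial ι k))).comp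
      (MvPolynomial.map (algebraMap K k)))
    ((IsFractionRing.injective _ _).comp (MvPolynomial.map_injective _ (algebraMap K k).injective)) p

theorem ratBaseChange_scalar (a : K) :
    ratBaseChange K k ι (algebraMap K _ a) = algebraMap k _ (algebraMap K k a) := by
  rw [IsScalarTower.algebraMap_apply K (MvPolynomial ι K), ratBaseChange_algebraMap,
    MvPolynomial.algebraMap_eq, MvPolynomial.map_C,
    IsScalarTower.algebraMap_apply k (MvPolynomial ι k), MvPolynomial.algebraMap_eq]

variable {K k ι}

theorem eq_top_of_ratBaseChange_mem {S : Set (FractionRing (MvPolynomial ι K))}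
    (hS : IntermediateField.adjoin K S = ⊤)
    {E : IntermediateField k (FractionRing (MvPolynomial ι k))}
    (hE : ∀ a ∈ S, ratBaseChange K k ι a ∈ E) : E = ⊤ := by
  let E' : IntermediateField K (FractionRing (MvPolynomial ι K)) :=
    (E.toSubfield.comap (ratBaseChange K k ι)).toIntermediateField fun a ↦ by
      change ratBaseChange K k ι _ ∈ E
      rw [ratBaseChange_scalar]
      exact E.algebraMap_mem _
  have hE' : E' = ⊤ := by
    rw [← top_le_iff, ← hS, IntermediateField.adjoin_le_iff]
    exact hE
  have hX : ∀ i : ι, algebraMap _ _ (MvPolynomial.X (R := k) i) ∈ E := fun i ↦ by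
    have : algebraMap _ _ (MvPolynomial.X (R := K) i) ∈ E' := hE' ▸ IntermediateField.mem_top
    have h2 : ratBaseChange K k ι (algebraMap _ _ (MvPolynomial.X (R := K) i)) ∈ E := this
    rwa [ratBaseChange_algebraMap, MvPolynomial.map_X] at h2
  have hA : ∀ p : MvPolynomial ι k, algebraMap _ _ p ∈ E := fun p ↦ by
    induction p using MvPolynomial.induction_on with
    | C a =>
      rw [← MvPolynomial.algebraMap_eq, ← IsScalarTower.algebraMap_apply]
      exact E.algebraMap_mem _
    | add p q hp hq => rw [map_add]; exact add_mem hp hq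
    | mul_X p i hp => rw [map_mul]; exact mul_mem hp (hX i)
  rw [eq_top_iff]
  intro w _
  obtain ⟨a, b, -, rfl⟩ := IsFractionRing.div_surjective (A := MvPolynomial ι k) w
  exact div_mem (hA a) (hA b)

/-- Coefficientwise action on rational functions. -/
noncomputable def ratAut (ι : Type*) (σ : RingAut k) : RingAut (FractionRing (MvPolynomial ι k)) :=
  IsFractionRing.ringEquivOfRingEquiv (MvPolynomial.mapEquiv ι σ)

theorem ratAut_algebraMap (σ : RingAut k) (p : MvPolynomial ι k) :
    ratAut ι σ (algebraMap _ _ p) = algebraMap _ _ (MvPolynomial.mapEquiv ι σ p) :=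
  IsFractionRing.ringEquivOfRingEquiv_algebraMap _ _

theorem ratAut_scalar (σ : RingAut k) (a : k) :
    ratAut ι σ (algebraMap k _ a) = algebraMap k _ (σ a) := by
  rw [IsScalarTower.algebraMap_apply k (MvPolynomial ι k), ratAut_algebraMap,
    MvPolynomial.algebraMap_eq, MvPolynomial.mapEquiv_apply, MvPolynomial.map_C]
  rfl

theorem ratAut_ratBaseChange (σ : k ≃ₐ[K] k) (a : FractionRing (MvPolynomial ι K)) :
    ratAut ι (σ : RingAut k) (ratBaseChange K k ι a) = ratBaseChange K k ι a := by
  have : ((ratAut ι (σ : RingAut k) : _ →+* _)).comp (ratBaseChange K k ι) =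
      ratBaseChange K k ι := by
    refine IsLocalization.ringHom_ext (nonZeroDivisors (MvPolynomial ι K)) ?_
    ext p
    · simp [ratBaseChange_algebraMap, ratAut_algebraMap, MvPolynomial.mapEquiv_apply]
    · simp [ratBaseChange_algebraMap, ratAut_algebraMap, MvPolynomial.mapEquiv_apply]
  exact RingHom.congr_fun this a

theorem mapEquiv_pow_eq_one {σ : RingAut k} {n : ℕ} (h : σ ^ n = 1) :
    (MvPolynomial.mapEquiv ι σ : RingAut (MvPolynomial ι k)) ^ n = 1 := by
  have : ∀ j : ℕ, (MvPolynomial.mapEquiv ι σ : RingAut (MvPolynomial ι k)) ^ j =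
      MvPolynomial.mapEquiv ι (σ ^ j : RingAut k) := by
    intro j
    induction j with
    | zero => exact (MvPolynomial.mapEquiv_refl _).symm
    | succ j ih =>
      rw [pow_succ, ih, pow_succ]
      exact MvPolynomial.mapEquiv_trans _ σ (σ ^ j)
  rw [this, h]
  exact MvPolynomial.mapEquiv_refl _

end BaseChange

theorem algebraicIndependent_of_eq {K L : Type*} [Field K] [Field L] [Algebra K L]
    (htr : 2 ≤ Algebra.trdeg K L) {f : K} {x y z : L}
    (hgen : IntermediateField.adjoin K {x, y, z} = ⊤)
    (hf : x ^ 3 * y + y ^ 3 + z ^ 2 = algebraMap K L f) : AlgebraicIndependent K ![x, y] := by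
  refine algebraicIndependent_pair htr (isAlgebraic_adjoin_pair hgen ?_)
  have hx : x ∈ IntermediateField.adjoin K {x, y} :=
    IntermediateField.subset_adjoin K {x, y} (by simp)
  have hy : y ∈ IntermediateField.adjoin K {x, y} :=
    IntermediateField.subset_adjoin K {x, y} (by simp)
  refine IsIntegral.isAlgebraic (IsIntegral.of_pow two_pos ?_)
  let e : IntermediateField.adjoin K {x, y} :=
    algebraMap K _ f - ⟨x, hx⟩ ^ 3 * ⟨y, hy⟩ - ⟨y, hy⟩ ^ 3
  have : z ^ 2 = algebraMap (IntermediateField.adjoin K {x, y}) L e := by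
    simp only [e, map_sub, map_mul, map_pow, ← IsScalarTower.algebraMap_apply, ← hf]
    change _ = _ - x ^ 3 * y - y ^ 3
    ring
  rw [this]
  exact isIntegral_algebraMap

theorem false_of_kummer_automorphism {k₀ K k : Type*} [Field k₀] [CharZero k₀] [IsAlgClosed k₀]
    [Field K] [Field k] [Algebra K k] [Algebra k₀ k] {f : K} (hf0 : f ≠ 0)
    {d : Derivation k₀ k k} (hd : ∀ a, d a = 0 → a ∈ Set.range (algebraMap k₀ k))
    {x y z : FractionRing (MvPolynomial (Fin 2) K)}
    (hgen : IntermediateField.adjoin K {x, y, z} = ⊤)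
    (hf : x ^ 3 * y + y ^ 3 + z ^ 2 = algebraMap K _ f)
    {ρ : k} (hρ : ρ ^ 18 = algebraMap K k f) {p : ℕ} (hp : p = 2 ∨ p = 3) {η : k₀}
    (hη : IsPrimitiveRoot η p) {σ : k ≃ₐ[K] k} (hσ : σ ^ p = 1)
    (hσk₀ : ∀ a : k₀, σ (algebraMap k₀ k a) = algebraMap k₀ k a)
    (hσρ : σ ρ = algebraMap k₀ k η * ρ) : False := by
  have : CharZero k := charZero_of_injective_algebraMap (algebraMap k₀ k).injective
  let Ω := FractionRing (MvPolynomial (Fin 2) k)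
  let _ : Differential k := ⟨d.restrictScalars ℤ⟩
  have hdσ : ∀ a, Differential.deriv a = 0 → ((σ : RingAut k) : k →+* k) a = a := fun a ha ↦ by
    obtain ⟨c, rfl⟩ := hd a ha
    exact hσk₀ c
  let m := ratBaseChange K k (Fin 2)
  let s := ratAut (Fin 2) (σ : RingAut k)
  have hsm : ∀ a, s (m a) = m a := ratAut_ratBaseChange σ
  have hsk : ∀ a, s (algebraMap k Ω a) = algebraMap k Ω (((σ : RingAut k) : k →+* k) a) :=
    ratAut_scalar (σ : RingAut k)
  have hσA : (MvPolynomial.mapEquiv (Fin 2) (σ : RingAut k) :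
      RingAut (MvPolynomial (Fin 2) k)) ^ p = 1 := by
    refine mapEquiv_pow_eq_one ?_
    ext a
    have h1 : ∀ j : ℕ, ((σ : RingAut k) ^ j) a = (σ ^ j) a := by
      intro j
      induction j with
      | zero => rfl
      | succ j ih => rw [pow_succ', pow_succ', AlgEquiv.mul_apply, ← ih]; rfl
    rw [h1, hσ]; rfl
  have hunit : ∀ u : (MvPolynomial (Fin 2) k)ˣ, ∃ c : k, algebraMap k (MvPolynomial (Fin 2) k) c = u := fun u ↦ by
    obtain ⟨c, -, hc⟩ := MvPolynomial.isUnit_iff_eq_C_of_isReduced.mp u.isUnit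
    exact ⟨c, hc.symm⟩
  have hy0 : y ≠ 0 :=
    (algebraicIndependent_of_eq (two_le_trdeg_fractionRing K) hgen hf).ne_zero 1
  have hρ0 : ρ ≠ 0 := by
    rintro rfl
    rw [zero_pow (by norm_num), eq_comm, map_eq_zero] at hρ
    exact hf0 hρ
  obtain ⟨ν₀, hν₀⟩ := IsAlgClosed.exists_pow_nat_eq (-2 : k₀) (n := 3) (by norm_num)
  have hν₀0 : ν₀ ≠ 0 := by rintro rfl; norm_num at hν₀
  obtain ⟨μ₀, hμ₀⟩ := IsAlgClosed.exists_pow_nat_eq (-36 / ν₀ : k₀) (n := 3) (by norm_num)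
  have hμ₀0 : μ₀ ≠ 0 := by
    rintro rfl
    rw [zero_pow (by norm_num), eq_comm, div_eq_zero_iff] at hμ₀
    norm_num [hν₀0] at hμ₀
  let ν : Ω := algebraMap k Ω (algebraMap k₀ k ν₀)
  let μ : Ω := algebraMap k Ω (algebraMap k₀ k μ₀)
  let r : Ω := algebraMap k Ω ρ
  have hν : ν ^ 3 = -2 := by
    simp only [ν, ← map_pow, hν₀, map_neg, map_ofNat]
  have hμ : μ ^ 3 * ν = -36 := by
    have : μ₀ ^ 3 * ν₀ = -36 := by rw [hμ₀]; field_simp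
    simp only [ν, μ, ← map_pow, ← map_mul, this, map_neg, map_ofNat]
  have hν0 : ν ≠ 0 := by simpa [ν] using hν₀0
  have hμ0 : μ ≠ 0 := by simpa [μ] using hμ₀0
  have hr0 : r ≠ 0 := by simpa [r] using hρ0
  have hmy : m y ≠ 0 := by simpa using hy0
  have hmf : m x ^ 3 * m y + m y ^ 3 + m z ^ 2 = r ^ 18 := by
    have := congrArg m hf
    rw [ratBaseChange_scalar, ← hρ] at this
    simpa [r] using this
  let V : Ω := ν * (m y / r ^ 6)
  let X' : Ω := μ * V * (m x / r ^ 4)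
  let Z : Ω := 6 * V * (m z / r ^ 9)
  have hE : Z ^ 2 = X' ^ 3 + 18 * V ^ 2 * (V ^ 3 + 2) := by
    have h1 : (m x / r ^ 4) ^ 3 * (m y / r ^ 6) + (m y / r ^ 6) ^ 3 + (m z / r ^ 9) ^ 2 = 1 := by
      field_simp
      linear_combination hmf
    linear_combination 36 * V ^ 2 * h1 - V ^ 2 * (m x / r ^ 4) ^ 3 * (m y / r ^ 6) * hμ -
      18 * V ^ 2 * (m y / r ^ 6) ^ 3 * hν
  have hV0 : V ≠ 0 := mul_ne_zero hν0 (div_ne_zero hmy (pow_ne_zero _ hr0))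
  have h6 : (6 : Ω) ≠ 0 := by
    have : CharZero Ω := charZero_of_injective_algebraMap (algebraMap k Ω).injective
    norm_num
  have hgen' : IntermediateField.adjoin k {V, X', Z} = ⊤ := by
    refine eq_top_of_ratBaseChange_mem hgen ?_
    let E := IntermediateField.adjoin k {V, X', Z}
    have hVE : V ∈ E := IntermediateField.subset_adjoin _ _ (by simp)
    have hXE : X' ∈ E := IntermediateField.subset_adjoin _ _ (by simp)
    have hZE : Z ∈ E := IntermediateField.subset_adjoin _ _ (by simp)
    have hrE : r ∈ E := E.algebraMap_mem _
    have hνE : ν ∈ E := E.algebraMap_mem _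
    have hμE : μ ∈ E := E.algebraMap_mem _
    rintro a (rfl | rfl | rfl)
    · have : m a = X' / (μ * V) * r ^ 4 := by simp only [X']; field_simp
      exact this ▸ mul_mem (div_mem hXE (mul_mem hμE hVE)) (pow_mem hrE 4)
    · have : m a = V / ν * r ^ 6 := by simp only [V]; field_simp
      exact this ▸ mul_mem (div_mem hVE hνE) (pow_mem hrE 6)
    · have : m a = Z / (6 * V) * r ^ 9 := by simp only [Z]; field_simp
      exact this ▸ mul_mem (div_mem hZE (mul_mem (ofNat_mem E 6) hVE)) (pow_mem hrE 9)
  have hsν : s ν = ν := (hsk _).trans (congrArg _ (hσk₀ _))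
  have hsμ : s μ = μ := (hsk _).trans (congrArg _ (hσk₀ _))
  let η' : Ω := algebraMap k Ω (algebraMap k₀ k η)
  have hsr : s r = η' * r := (hsk _).trans (by
    rw [← map_mul, ← hσρ]; rfl)
  have hs6 : s 6 = 6 := map_ofNat s 6
  rcases hp with rfl | rfl
  · have hη1 : η' = -1 := by simp only [η', hη.eq_neg_one_of_two_right, map_neg, map_one]
    have hsV : s V = V := by
      simp only [V, map_mul, map_div₀, map_pow, hsν, hsm, hsr, hη1]; ring
    refine Mordell.not_involution (two_le_trdeg_fractionRing k) hunit hdσ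
      (ratAut_algebraMap (σ : RingAut k)) hsk hE hgen' hsV hσA ?_ ?_
    · change s X' = X'
      simp only [X', map_mul, map_div₀, map_pow, hsμ, hsV, hsm, hsr, hη1]; ring
    · change s Z = -Z
      simp only [Z, map_mul, map_div₀, map_pow, hs6, hsV, hsm, hsr, hη1]
      field_simp
  · have hη3 : η' ^ 3 = 1 := by simp only [η', ← map_pow, hη.pow_eq_one, map_one]
    have hη0 : η' ≠ 0 := by rintro h; simp [h] at hη3
    have hη6 : η' ^ 6 = 1 := by linear_combination (η' ^ 3 + 1) * hη3
    have hη9 : η' ^ 9 = 1 := by linear_combination (η' ^ 6 + η' ^ 3 + 1) * hη3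
    have hsV : s V = V := by
      simp only [V, map_mul, map_div₀, map_pow, hsν, hsm, hsr, mul_pow, hη6, one_mul]
    have hω : η ^ 2 + η + 1 = 0 := by
      have h := hη.geom_sum_eq_zero (by norm_num)
      simp only [Finset.sum_range_succ, Finset.sum_range_zero] at h
      linear_combination h
    have hω' : (algebraMap k₀ k (η ^ 2)) ^ 2 + algebraMap k₀ k (η ^ 2) + 1 = 0 := by
      rw [← map_pow, ← map_add, ← map_one (algebraMap k₀ k), ← map_add]
      have : (η ^ 2) ^ 2 + η ^ 2 + 1 = 0 := by linear_combination (η ^ 2 - η + 1) * hω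
      rw [this, map_zero]
    refine Mordell.not_triality (two_le_trdeg_fractionRing k) hunit hdσ
      (ratAut_algebraMap (σ : RingAut k)) hsk hE hgen' hsV hω' (hσk₀ _) hσA ?_ ?_
    · change s X' = algebraMap k Ω (algebraMap k₀ k (η ^ 2)) * X'
      have : algebraMap k Ω (algebraMap k₀ k (η ^ 2)) = η' ^ 2 := by simp only [η', map_pow]
      rw [this]
      simp only [X', map_mul, map_div₀, map_pow, hsμ, hsV, hsm, hsr]
      have : η' ^ 2 = 1 / η' ^ 4 := by
        rw [eq_div_iff (pow_ne_zero _ hη0)]; linear_combination hη6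
      rw [this]
      field_simp
    · change s Z = Z
      simp only [Z, map_mul, map_div₀, map_pow, hs6, hsV, hsm, hsr, mul_pow, hη9, one_mul]

theorem exists_algEquiv_fractionRing {K L : Type*} [Field K] [Field L] [Algebra K L]
    (htr : 2 ≤ Algebra.trdeg K L) {g h : L} (hgh : IntermediateField.adjoin K {g, h} = ⊤) :
    Nonempty (L ≃ₐ[K] FractionRing (MvPolynomial (Fin 2) K)) := by
  have hind : AlgebraicIndependent K ![g, h] := by
    refine algebraicIndependent_pair htr ?_
    rw [hgh]
    exact ⟨fun a ↦ isAlgebraic_algebraMap (⟨a, IntermediateField.mem_top⟩ : (⊤ : IntermediateField K L))⟩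
  have hr : IntermediateField.adjoin K (Set.range ![g, h]) = ⊤ := by
    rw [← hgh]; congr 1; simp [Set.pair_comm]
  exact ⟨(hind.aevalEquivField.trans
    ((IntermediateField.equivOfEq hr).trans IntermediateField.topEquiv)).symm⟩

theorem exists_root_of_rational {k₀ K L : Type*} [Field k₀] [CharZero k₀] [IsAlgClosed k₀]
    [Field K] [Algebra k₀ K] [Field L] [Algebra K L] (htrK : Algebra.trdeg k₀ K ≤ 1) {f : K}
    (hft : Transcendental k₀ f) (htr : 2 ≤ Algebra.trdeg K L) {x y z : L}
    (hgen : IntermediateField.adjoin K {x, y, z} = ⊤)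
    (hf : x ^ 3 * y + y ^ 3 + z ^ 2 = algebraMap K L f) {g h : L}
    (hgh : IntermediateField.adjoin K {g, h} = ⊤) : ∃ ρ : K, ρ ^ 18 = f := by
  by_contra hno
  obtain ⟨e⟩ := exists_algEquiv_fractionRing htr hgh
  have hf0 : f ≠ 0 := by
    rintro rfl
    exact hft isAlgebraic_zero
  obtain ⟨ρ, p, η, σ, hρ, hp, hpn, hη, hσp, hσρ⟩ :=
    exists_kummer_automorphism (k₀ := k₀) hf0 (by norm_num) hno
  let k := (X ^ 18 - C f).SplittingField
  have hfk : Transcendental k₀ (algebraMap K k f) :=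
    (transcendental_algebraMap_iff (algebraMap K k).injective).mpr hft
  have htrk : Algebra.trdeg k₀ k ≤ 1 := by
    rw [← trdeg_add_eq k₀ K (A := k), trdeg_eq_zero (R := K), add_zero]
    exact htrK
  have : Algebra.IsAlgebraic (Algebra.adjoin k₀ {algebraMap K k f}) k := by
    have hb : IsTranscendenceBasis k₀ (fun _ : Unit ↦ algebraMap K k f) :=
      (algebraicIndependent_unique_type_iff.mpr hfk).isTranscendenceBasis_of_lift_trdeg_le_of_finite
        (by simpa using htrk)
    have := hb.isAlgebraic
    rwa [Set.range_const] at this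
  obtain ⟨d, hd⟩ := exists_derivation_constants _ hfk
  have hp' : p = 2 ∨ p = 3 := by
    rw [show 18 = 2 * 3 ^ 2 by norm_num, hp.dvd_mul] at hpn
    rcases hpn with h | h
    · exact .inl ((Nat.prime_dvd_prime_iff_eq hp Nat.prime_two).mp h)
    · exact .inr ((Nat.prime_dvd_prime_iff_eq hp Nat.prime_three).mp (hp.dvd_of_dvd_pow h))
  refine false_of_kummer_automorphism (x := e x) (y := e y) (z := e z) hf0 hd ?_ ?_ hρ hp' hη hσp
    (fun a ↦ ?_) hσρ
  · have := congrArg (IntermediateField.map e.toAlgHom) hgen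
    rw [IntermediateField.adjoin_map, ← AlgHom.fieldRange_eq_map, e.fieldRange_eq_top] at this
    simpa [Set.image_insert_eq] using this
  · rw [← e.commutes, ← hf]; simp
  · rw [IsScalarTower.algebraMap_apply k₀ K k, σ.commutes]

/-- Over a field `K`, the affine coordinates `x, y, u = (z - 1) / y` of the surface
`x³y + y³ + z² = 1` satisfy no nontrivial affine-linear relation. -/
theorem eq_zero_of_linear_relation {K L : Type*} [Field K] [CharZero K] [Field L] [Algebra K L]
    {x y u : L} (hxy : AlgebraicIndependent K ![x, y])
    (h : x ^ 3 + y ^ 2 + 2 * u + u ^ 2 * y = 0) {a b c d : K}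
    (hrel : algebraMap K L a * x + algebraMap K L b * y + algebraMap K L c
      + algebraMap K L d * u = 0) : a = 0 ∧ b = 0 ∧ c = 0 ∧ d = 0 := by
  let P : MvPolynomial (Fin 2) K :=
    .C (d ^ 2) * (1 - .X 0 ^ 3 * .X 1 - .X 1 ^ 3)
      - (.C d - .C a * (.X 0 * .X 1) - .C b * .X 1 ^ 2 - .C c * .X 1) ^ 2
  have hP : P = 0 := by
    apply (algebraicIndependent_iff_injective_aeval.mp hxy)
    simp only [P, map_zero, map_sub, map_mul, map_pow, map_one, MvPolynomial.aeval_C,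
      MvPolynomial.aeval_X, Matrix.cons_val_zero, Matrix.cons_val_one]
    grind
  have key (s t : K) :
      d ^ 2 * (1 - s ^ 3 * t - t ^ 3) - (d - a * (s * t) - b * t ^ 2 - c * t) ^ 2 = 0 := by
    simpa [P] using congrArg (MvPolynomial.eval ![s, t]) hP
  have h1 : d - b - c = 0 := by
    have := key 0 1
    exact pow_eq_zero_iff (two_ne_zero) |>.mp (by linear_combination -this)
  have h2 : d ^ 2 + a ^ 2 = 0 := by linear_combination -(d - b - c - 2 * a) * h1 - key 1 1
  have h3 : -d ^ 2 + a ^ 2 = 0 := by linear_combination -(d - b - c + 2 * a) * h1 - key (-1) 1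
  have hd : d = 0 := pow_eq_zero_iff two_ne_zero |>.mp (by linear_combination (h2 - h3) / 2)
  have ha : a = 0 := pow_eq_zero_iff two_ne_zero |>.mp (by linear_combination (h2 + h3) / 2)
  subst hd ha
  have h4 : b - c = 0 :=
    pow_eq_zero_iff two_ne_zero |>.mp (by linear_combination -key 0 (-1))
  exact ⟨rfl, by linear_combination (h4 - h1) / 2, by linear_combination (-h4 - h1) / 2, rfl⟩

/-- The cubic surface `X³ = Y² + U + U²Y` is rational over any field containing a primitive ninth
root of unity and a cube root of `9`. -/
theorem exists_mem_adjoin_of_cubic {K L : Type*} [Field K] [CharZero K] [Field L] [Algebra K L]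
    {x y u : L} (h : x ^ 3 = y ^ 2 + u + u ^ 2 * y) {ε δ : K}
    (hε : ε ^ 6 + ε ^ 3 + 1 = 0) (hδ : δ ^ 3 = 9)
    (hlin : ∀ a b c d : K, algebraMap K L a * x + algebraMap K L b * y + algebraMap K L c
      + algebraMap K L d * u = 0 → a = 0 ∧ b = 0 ∧ c = 0 ∧ d = 0) :
    ∃ p q : L, x ∈ IntermediateField.adjoin K {p, q} ∧ y ∈ IntermediateField.adjoin K {p, q} ∧
      u ∈ IntermediateField.adjoin K {p, q} := by
  have : CharZero L := charZero_of_injective_algebraMap (algebraMap K L).injective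
  obtain ⟨e, he⟩ : ∃ e, e = algebraMap K L ε := ⟨_, rfl⟩
  obtain ⟨d, hd⟩ : ∃ d, d = algebraMap K L δ := ⟨_, rfl⟩
  obtain ⟨w, hw⟩ : ∃ w, w = e ^ 3 := ⟨_, rfl⟩
  have hwε : w = algebraMap K L (ε ^ 3) := by rw [hw, he, map_pow]
  have hw1 : w ^ 2 + w + 1 = 0 := by
    simpa [hwε, ← pow_mul] using congrArg (algebraMap K L) hε
  have hd3 : d ^ 3 = 9 := by rw [hd, ← map_pow, hδ, map_ofNat]
  have hw3 : w ^ 3 = 1 := by linear_combination (w - 1) * hw1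
  have hε0 : ε ≠ 0 := by rintro rfl; simp at hε
  have hδ0 : δ ≠ 0 := by rintro rfl; simp at hδ
  have he0 : e ≠ 0 := by simpa [he]
  have hd0 : d ≠ 0 := by simpa [hd]
  have hε1 : ε ^ 2 + ε ≠ 0 := by
    intro h0
    have : (1 : K) = 0 := by linear_combination hε - (ε ^ 4 - ε ^ 3 + ε ^ 2) * h0
    exact one_ne_zero this
  obtain ⟨A, hA⟩ : ∃ A, A = y + 1 + u := ⟨_, rfl⟩
  obtain ⟨B, hB⟩ : ∃ B, B = e ^ 2 * (y + w + w ^ 2 * u) := ⟨_, rfl⟩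
  obtain ⟨C, hC⟩ : ∃ C, C = e * (y + w ^ 2 + w * u) := ⟨_, rfl⟩
  have hsum : (d * x) ^ 3 - A ^ 3 = B ^ 3 + C ^ 3 := by
    have h1 : B ^ 3 = w ^ 2 * (y + w + w ^ 2 * u) ^ 3 := by rw [hB, hw]; ring
    have h2 : C ^ 3 = w * (y + w ^ 2 + w * u) ^ 3 := by rw [hC, hw]; ring
    rw [h1, h2, hA, mul_pow, hd3, h]
    clear * - hw1; grind
  obtain ⟨a₁, ha₁⟩ : ∃ a, a = w * (d * x) - w ^ 2 * A := ⟨_, rfl⟩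
  obtain ⟨a₂, ha₂⟩ : ∃ a, a = w ^ 2 * (d * x) - w * A := ⟨_, rfl⟩
  obtain ⟨b₁, hb₁⟩ : ∃ b, b = w * B + w ^ 2 * C := ⟨_, rfl⟩
  obtain ⟨b₂, hb₂⟩ : ∃ b, b = w ^ 2 * B + w * C := ⟨_, rfl⟩
  have hprod : a₁ * a₂ * (a₁ + a₂) = b₁ * b₂ * (b₁ + b₂) := by
    have h1 : a₁ * a₂ * (a₁ + a₂) = A ^ 3 - (d * x) ^ 3 := by
      rw [ha₁, ha₂]; clear * - hw1; grind
    have h2 : b₁ * b₂ * (b₁ + b₂) = - (B ^ 3 + C ^ 3) := by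
      rw [hb₁, hb₂]; clear * - hw1; grind
    rw [h1, h2, ← hsum]; ring
  have hb₁0 : b₁ ≠ 0 := by
    intro h0
    refine hε1 (hlin 0 (ε ^ 5 + ε ^ 7) (ε ^ 8 + ε ^ 4) (ε ^ 2 + ε) ?_).2.2.2
    simp only [map_add, map_pow, map_zero, ← he]
    rw [zero_mul, zero_add, ← h0, hb₁, hB, hC]
    clear * - hw hw3; grind
  have hb₂0 : b₂ ≠ 0 := by
    intro h0
    refine hε1 (hlin 0 (ε ^ 8 + ε ^ 4) (ε ^ 2 + ε) (ε ^ 5 + ε ^ 7) ?_).2.2.1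
    simp only [map_add, map_pow, map_zero, ← he]
    rw [zero_mul, zero_add, ← h0, hb₂, hB, hC]
    clear * - hw hw3; grind
  have hab (ζ : K) : a₁ ≠ algebraMap K L ζ * b₁ := by
    intro h0
    refine mul_ne_zero (pow_ne_zero 3 hε0) hδ0 (hlin (ε ^ 3 * δ) (-ε ^ 6 - ζ * (ε ^ 5 + ε ^ 7))
      (-ε ^ 6 - ζ * (ε ^ 8 + ε ^ 4)) (-ε ^ 6 - ζ * (ε ^ 2 + ε)) ?_).1
    simp only [map_add, map_pow, map_mul, map_neg, map_sub, ← he, ← hd]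
    rw [ha₁, hb₁, hA, hB, hC] at h0
    subst hw
    linear_combination h0 + algebraMap K L ζ * (e ^ 4 + u * (e ^ 2 + e)) * hw3
  obtain ⟨p, hp⟩ : ∃ p, p = a₁ / b₁ := ⟨_, rfl⟩
  obtain ⟨q, hq⟩ : ∃ q, q = a₂ / b₂ := ⟨_, rfl⟩
  have hpa : a₁ = p * b₁ := by rw [hp]; field_simp
  have hqa : a₂ = q * b₂ := by rw [hq]; field_simp
  have hpq : b₁ * (p ^ 2 * q - 1) = b₂ * (1 - p * q ^ 2) := by
    rw [hpa, hqa] at hprod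
    have : b₁ * b₂ * (b₁ * (p ^ 2 * q - 1) - b₂ * (1 - p * q ^ 2)) = 0 := by
      linear_combination hprod
    simpa [hb₁0, hb₂0, sub_eq_zero] using this
  have hpq0 : p ^ 2 * q - 1 ≠ 0 := by
    intro h0
    have h1 : 1 - p * q ^ 2 = 0 := by
      rw [h0, mul_zero] at hpq
      exact (mul_eq_zero.mp hpq.symm).resolve_left hb₂0
    have h2 : p = q := by linear_combination q * h0 + p * h1
    subst h2
    have h3 : (p - 1) * ((p - w) * (p - w ^ 2)) = 0 := by
      clear * - h0 hw1; grind
    rcases mul_eq_zero.mp h3 with h4 | h3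
    · exact hab 1 (by rw [hpa, sub_eq_zero.mp h4, map_one])
    rcases mul_eq_zero.mp h3 with h4 | h4
    · exact hab (ε ^ 3) (by rw [hpa, sub_eq_zero.mp h4, hwε])
    · exact hab ((ε ^ 3) ^ 2) (by rw [hpa, sub_eq_zero.mp h4, map_pow _ _ 2, ← hwε])
  set M := IntermediateField.adjoin K {p, q} with hM
  have hpM : p ∈ M := IntermediateField.subset_adjoin _ _ (by simp)
  have hqM : q ∈ M := IntermediateField.subset_adjoin _ _ (by simp)
  have heM : e ∈ M := he ▸ M.algebraMap_mem ε
  have hdM : d ∈ M := hd ▸ M.algebraMap_mem δ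
  have hwM : w ∈ M := hw ▸ pow_mem heM 3
  have h3M : (3 : L) ∈ M := ofNat_mem M 3
  have h30 : (3 : L) ≠ 0 := by norm_num
  have hsolve (s : L) (h1 : s * b₁ ∈ M) (h2 : s * b₂ ∈ M) :
      s * x ∈ M ∧ s * y ∈ M ∧ s * u ∈ M ∧ s ∈ M := by
    have ha1 : s * a₁ ∈ M := by
      rw [hpa, mul_left_comm]; exact mul_mem hpM h1
    have ha2 : s * a₂ ∈ M := by
      rw [hqa, mul_left_comm]; exact mul_mem hqM h2
    have hAM : s * A ∈ M := by
      rw [show s * A = (s * a₁ + s * a₂ - (w * (s * a₁) + w ^ 2 * (s * a₂))) / 3 by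
        rw [ha₁, ha₂]; clear * - hw1 h30; grind]
      exact div_mem (sub_mem (add_mem ha1 ha2)
        (add_mem (mul_mem hwM ha1) (mul_mem (pow_mem hwM 2) ha2))) h3M
    have hCM : s * C ∈ M := by
      rw [show s * C = (w * (s * b₁) + w ^ 2 * (s * b₂) - (s * b₁ + s * b₂)) / 3 by
        rw [hb₁, hb₂]; clear * - hw1 h30; grind]
      exact div_mem (sub_mem (add_mem (mul_mem hwM h1) (mul_mem (pow_mem hwM 2) h2))
        (add_mem h1 h2)) h3M
    have hBM : s * B ∈ M := by
      rw [show s * B = -(s * C) - s * b₁ - s * b₂ by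
        rw [hb₁, hb₂]; linear_combination s * (B + C) * hw1]
      exact sub_mem (sub_mem (neg_mem hCM) h1) h2
    have hxM : s * x ∈ M := by
      rw [show s * x = (s * A - s * a₁ - s * a₂) / d by
        rw [ha₁, ha₂, eq_div_iff hd0]; linear_combination s * (d * x - A) * hw1]
      exact div_mem (sub_mem (sub_mem hAM ha1) ha2) hdM
    obtain ⟨S, hS⟩ : ∃ S, S = s * B / e ^ 2 := ⟨_, rfl⟩
    obtain ⟨T, hT⟩ : ∃ T, T = s * C / e := ⟨_, rfl⟩
    have hSM : S ∈ M := hS ▸ div_mem hBM (pow_mem heM 2)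
    have hTM : T ∈ M := hT ▸ div_mem hCM heM
    have hS' : S = s * (y + w + w ^ 2 * u) := by rw [hS, hB]; field_simp
    have hT' : T = s * (y + w ^ 2 + w * u) := by rw [hT, hC]; field_simp
    refine ⟨hxM, ?_, ?_, ?_⟩
    · rw [show s * y = (s * A + S + T) / 3 by
        rw [hA, hS', hT']; clear * - hw1 h30; grind]
      exact div_mem (add_mem (add_mem hAM hSM) hTM) h3M
    · rw [show s * u = (s * A + w * S + w ^ 2 * T) / 3 by
        rw [hA, hS', hT']; clear * - hw1 h30; grind]
      exact div_mem (add_mem (add_mem hAM (mul_mem hwM hSM)) (mul_mem (pow_mem hwM 2) hTM)) h3M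
    · rw [show s = (s * A + w ^ 2 * S + w * T) / 3 by
        rw [hA, hS', hT']; clear * - hw1 h30; grind]
      exact div_mem (add_mem (add_mem hAM (mul_mem (pow_mem hwM 2) hSM)) (mul_mem hwM hTM)) h3M
  have hb₂M : b₂⁻¹ ∈ M := by
    refine (hsolve b₂⁻¹ ?_ ?_).2.2.2
    · rw [show b₂⁻¹ * b₁ = (1 - p * q ^ 2) / (p ^ 2 * q - 1) by
        rw [eq_div_iff hpq0, mul_assoc, hpq]; field_simp]
      exact div_mem (sub_mem (one_mem M) (mul_mem hpM (pow_mem hqM 2)))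
        (sub_mem (mul_mem (pow_mem hpM 2) hqM) (one_mem M))
    · rw [inv_mul_cancel₀ hb₂0]; exact one_mem M
  have hb₂M' : b₂ ∈ M := by simpa using inv_mem hb₂M
  have hb₁M : b₁ ∈ M := by
    rw [show b₁ = b₂ * ((1 - p * q ^ 2) / (p ^ 2 * q - 1)) by
      rw [← mul_div_assoc, eq_div_iff hpq0, hpq]]
    exact mul_mem hb₂M' (div_mem (sub_mem (one_mem M) (mul_mem hpM (pow_mem hqM 2)))
        (sub_mem (mul_mem (pow_mem hpM 2) hqM) (one_mem M)))
  have := hsolve 1 (by simpa using hb₁M) (by simpa using hb₂M')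
  simp only [one_mul] at this
  exact ⟨p, q, this.1, this.2.1, this.2.2.1⟩

theorem IntermediateField.eq_top_of_mem_of_mem_of_mem {K L : Type*} [Field K] [Field L]
    [Algebra K L] {x y z : L} (hgen : IntermediateField.adjoin K {x, y, z} = ⊤)
    {M : IntermediateField K L} (hx : x ∈ M) (hy : y ∈ M) (hz : z ∈ M) : M = ⊤ := by
  rw [← top_le_iff, ← hgen, IntermediateField.adjoin_le_iff]
  rintro a (rfl | rfl | rfl) <;> assumption

/-- The surface `x³y + y³ + z² = 1` is rational over any field containing an algebraically closed
field of characteristic zero. -/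
theorem exists_adjoin_eq_top_of_eq_one (k₀ : Type*) {K L : Type*} [Field k₀] [CharZero k₀]
    [IsAlgClosed k₀] [Field K] [Algebra k₀ K] [Field L] [Algebra K L]
    (htr : 2 ≤ Algebra.trdeg K L) {x y z : L}
    (hgen : IntermediateField.adjoin K {x, y, z} = ⊤)
    (hf : x ^ 3 * y + y ^ 3 + z ^ 2 = 1) :
    ∃ g h : L, IntermediateField.adjoin K {g, h} = ⊤ := by
  have : CharZero K := charZero_of_injective_algebraMap (algebraMap k₀ K).injective
  have hroot (a : k₀) : ∃ b : K, b ^ 3 = algebraMap k₀ K a := by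
    obtain ⟨b, hb⟩ := IsAlgClosed.exists_pow_nat_eq a three_pos
    exact ⟨algebraMap k₀ K b, by rw [← map_pow, hb]⟩
  have hxy : AlgebraicIndependent K ![x, y] :=
    algebraicIndependent_of_eq (f := 1) htr hgen (by rw [hf, map_one])
  have hy0 : y ≠ 0 := by
    rintro rfl
    exact hxy.transcendental 1 isAlgebraic_zero
  obtain ⟨u, hu⟩ : ∃ u, u = (z - 1) / y := ⟨_, rfl⟩
  have hz : z = 1 + u * y := by rw [hu]; field_simp; ring
  have hu' : x ^ 3 + y ^ 2 + 2 * u + u ^ 2 * y = 0 := by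
    refine (mul_eq_zero.mp (?_ : y * _ = 0)).resolve_left hy0
    rw [hz] at hf
    linear_combination hf
  obtain ⟨β₀, hβ₀⟩ := IsAlgClosed.exists_pow_nat_eq (2 : k₀) three_pos
  obtain ⟨β, hβ⟩ : ∃ β, β = algebraMap k₀ K β₀ := ⟨_, rfl⟩
  have hβ3 : β ^ 3 = 2 := by rw [hβ, ← map_pow, hβ₀, map_ofNat]
  obtain ⟨γ, hγ⟩ := hroot (-2 * β₀)
  rw [map_mul, ← hβ, map_neg, map_ofNat] at hγ
  obtain ⟨δ, hδ⟩ := hroot 9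
  rw [map_ofNat] at hδ
  obtain ⟨ε₀, hε₀⟩ := HasEnoughRootsOfUnity.exists_primitiveRoot k₀ 9
  have hε : algebraMap k₀ K ε₀ ^ 6 + algebraMap k₀ K ε₀ ^ 3 + 1 = 0 := by
    have h3 : IsPrimitiveRoot (ε₀ ^ 3) 3 := hε₀.pow (by norm_num) (by norm_num)
    have := h3.geom_sum_eq_zero (by norm_num)
    simp only [Finset.sum_range_succ, Finset.sum_range_zero] at this
    rw [← map_pow, ← map_pow, ← map_add, ← map_one (algebraMap k₀ K), ← map_add]
    exact (map_eq_zero _).mpr (by linear_combination this)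
  have hβ0 : β ≠ 0 := by rintro rfl; norm_num at hβ3
  have hγ0 : γ ≠ 0 := by
    rintro rfl
    simp [hβ0] at hγ
  have hbL : algebraMap K L β ≠ 0 := by simpa
  have hcL : algebraMap K L γ ≠ 0 := by simpa
  have hbL3 : algebraMap K L β ^ 3 = 2 := by rw [← map_pow, hβ3, map_ofNat]
  have hcL3 : algebraMap K L γ ^ 3 = -2 * algebraMap K L β := by
    rw [← map_pow, hγ, map_mul, map_neg, map_ofNat]
  obtain ⟨p, q, hx, hy, hu⟩ := exists_mem_adjoin_of_cubic (x := x / algebraMap K L γ)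
    (y := y / algebraMap K L β ^ 2) (u := u / algebraMap K L β) (by
      field_simp
      rw [hcL3]
      have : x ^ 3 = - (y ^ 2 + 2 * u + u ^ 2 * y) := by linear_combination hu'
      rw [this]
      generalize algebraMap K L β = b at *
      linear_combination (-b * (y * u ^ 2 + y ^ 2)) * hbL3) hε hδ (fun a b c d h ↦ by
      have := eq_zero_of_linear_relation hxy hu' (a := a / γ) (b := b / β ^ 2) (c := c)
        (d := d / β) (by
          simp only [map_div₀, map_pow]
          linear_combination h)
      simpa [hβ0, hγ0] using this)
  refine ⟨p, q, ?_⟩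
  set M := IntermediateField.adjoin K {p, q}
  have hx' : x ∈ M := by
    rw [← div_mul_cancel₀ x hcL]
    exact mul_mem hx (M.algebraMap_mem _)
  have hy' : y ∈ M := by
    rw [← div_mul_cancel₀ y (pow_ne_zero 2 hbL)]
    exact mul_mem hy (pow_mem (M.algebraMap_mem _) 2)
  have hu' : u ∈ M := by
    rw [← div_mul_cancel₀ u hbL]
    exact mul_mem hu (M.algebraMap_mem _)
  refine IntermediateField.eq_top_of_mem_of_mem_of_mem hgen hx' hy' ?_
  rw [hz]
  exact add_mem (one_mem M) (mul_mem hu' hy')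

theorem exists_rational_of_root (k₀ : Type*) {K L : Type*} [Field k₀] [CharZero k₀]
    [IsAlgClosed k₀] [Field K] [Algebra k₀ K] [Field L] [Algebra K L]
    (htr : 2 ≤ Algebra.trdeg K L) {x y z : L}
    (hgen : IntermediateField.adjoin K {x, y, z} = ⊤) {ρ : K} (hρ : ρ ≠ 0)
    (hf : x ^ 3 * y + y ^ 3 + z ^ 2 = algebraMap K L (ρ ^ 18)) :
    ∃ g h : L, IntermediateField.adjoin K {g, h} = ⊤ := by
  have hr : algebraMap K L ρ ≠ 0 := by simpa
  refine exists_adjoin_eq_top_of_eq_one k₀ htr (x := x / algebraMap K L ρ ^ 4)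
    (y := y / algebraMap K L ρ ^ 6) (z := z / algebraMap K L ρ ^ 9) ?_ ?_
  · set M := IntermediateField.adjoin K {x / algebraMap K L ρ ^ 4, y / algebraMap K L ρ ^ 6,
      z / algebraMap K L ρ ^ 9} with hM
    have hmem (a : L) (n : ℕ) (h : a / algebraMap K L ρ ^ n ∈ M) : a ∈ M := by
      rw [← div_mul_cancel₀ a (pow_ne_zero n hr)]
      exact mul_mem h (pow_mem (M.algebraMap_mem _) n)
    exact IntermediateField.eq_top_of_mem_of_mem_of_mem hgen
      (hmem x 4 (IntermediateField.subset_adjoin _ _ (by simp)))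
      (hmem y 6 (IntermediateField.subset_adjoin _ _ (by simp)))
      (hmem z 9 (IntermediateField.subset_adjoin _ _ (by simp)))
  · rw [map_pow] at hf
    field_simp
    linear_combination hf

end

open MvPolynomial TensorProduct

set_option synthInstance.maxHeartbeats 1000000
set_option maxHeartbeats 2000000

noncomputable section

theorem transcendental_fE7 : Transcendental ℂ fE7 := by
  intro halg
  obtain ⟨c, hc⟩ := mem_range_algebraMap_of_isAlgebraic (k₀ := ℂ) halg
  have h : (X 0 ^ 3 * X 1 + X 1 ^ 3 + X 2 ^ 2 : MvPolynomial (Fin 3) ℂ) = C c := by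
    apply IsFractionRing.injective (MvPolynomial (Fin 3) ℂ) Fxyz
    rw [← MvPolynomial.algebraMap_eq, ← IsScalarTower.algebraMap_apply, hc]
    simp [fE7, Vx, Vy, Vz]
  have h0 := congrArg (MvPolynomial.eval ![0, 0, 0]) h
  have h1 := congrArg (MvPolynomial.eval ![0, 0, 1]) h
  simp at h0 h1
  exact one_ne_zero (h1.trans h0.symm)

theorem adjoin_Vx_Vy_Vz : IntermediateField.adjoin ℂ {Vx, Vy, Vz} = ⊤ := by
  refine eq_top_iff.mpr fun a _ ↦ ?_
  set M := IntermediateField.adjoin ℂ {Vx, Vy, Vz} with hM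
  have hpoly (p : MvPolynomial (Fin 3) ℂ) : algebraMap _ Fxyz p ∈ M := by
    induction p using MvPolynomial.induction_on with
    | C c =>
      rw [← MvPolynomial.algebraMap_eq, ← IsScalarTower.algebraMap_apply]
      exact M.algebraMap_mem c
    | add p q hp hq => rw [map_add]; exact add_mem hp hq
    | mul_X p i hp =>
      rw [map_mul]
      refine mul_mem hp (IntermediateField.subset_adjoin _ _ ?_)
      fin_cases i <;> simp [Vx, Vy, Vz]
  obtain ⟨p, q, -, rfl⟩ := IsFractionRing.div_surjective (A := MvPolynomial (Fin 3) ℂ) a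
  exact div_mem (hpoly p) (hpoly q)

theorem trdeg_Cf_le_one : Algebra.trdeg ℂ Cf ≤ 1 := by
  let f : Cf := ⟨fE7, IntermediateField.subset_adjoin ℂ {fE7} rfl⟩
  have haeval (r : Polynomial ℂ) : IsAlgebraic (Algebra.adjoin ℂ {f}) (Polynomial.aeval f r) :=
    isAlgebraic_algebraMap (⟨_, Polynomial.aeval_mem_adjoin_singleton ℂ f⟩ : Algebra.adjoin ℂ {f})
  have : Algebra.IsAlgebraic (Algebra.adjoin ℂ {f}) Cf := by
    refine ⟨fun a ↦ ?_⟩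
    obtain ⟨r, s, hrs⟩ := IntermediateField.mem_adjoin_simple_iff ℂ (a : Fxyz) |>.mp a.2
    have ha : a = Polynomial.aeval f r / Polynomial.aeval f s := by
      apply Subtype.val_injective
      rw [hrs]
      have hval (t : Polynomial ℂ) : ((Polynomial.aeval f t : Cf) : Fxyz) = Polynomial.aeval fE7 t :=
        (Polynomial.aeval_algHom_apply Cf.val f t).symm
      rw [IntermediateField.coe_div, hval, hval]
    rw [ha, div_eq_mul_inv]
    exact (haeval r).mul (haeval s).inv
  simpa using Algebra.IsAlgebraic.trdeg_le_cardinalMk ℂ {f}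

theorem three_le_trdeg_Fxyz : 3 ≤ Algebra.trdeg ℂ Fxyz :=
  mod_cast natCast_le_trdeg_fractionRing ℂ 3

theorem rational_iff_root_of_ringHom {K L : Type} [Field K] [Algebra Cf K] [FiniteDimensional Cf K]
    [Field L] [Algebra K L] (φ : Fxyz →+* L)
    (hφ : ∀ c : Cf, φ c = algebraMap K L (algebraMap Cf K c))
    (hgen : Algebra.adjoin K (Set.range φ) = ⊤) :
    (∃ g h : L, IntermediateField.adjoin K {g, h} = ⊤) ↔
      ∃ ρ : K, ρ ^ 18 = algebraMap Cf K ⟨fE7, IntermediateField.subset_adjoin ℂ {fE7} rfl⟩ := by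
  let _ : Algebra ℂ K := ((algebraMap Cf K).comp (algebraMap ℂ Cf)).toAlgebra
  have : IsScalarTower ℂ Cf K := .of_algebraMap_eq fun _ ↦ rfl
  let _ : Algebra ℂ L := ((algebraMap K L).comp (algebraMap ℂ K)).toAlgebra
  have : IsScalarTower ℂ K L := .of_algebraMap_eq fun _ ↦ rfl
  let ψ : Fxyz →ₐ[ℂ] L := { φ with commutes' := fun c ↦ hφ (algebraMap ℂ Cf c) }
  have htrK : Algebra.trdeg ℂ K ≤ 1 := by
    rw [← trdeg_add_eq ℂ Cf (A := K), trdeg_eq_zero (R := Cf), add_zero]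
    exact trdeg_Cf_le_one
  have htr : 2 ≤ Algebra.trdeg K L := by
    have h3 : 3 ≤ Algebra.trdeg ℂ L :=
      three_le_trdeg_Fxyz.trans (trdeg_le_of_injective ψ ψ.toRingHom.injective)
    rw [← trdeg_add_eq ℂ K (A := L)] at h3
    by_contra hlt
    have hle : Algebra.trdeg K L ≤ 1 := by
      rw [not_le] at hlt
      exact Order.lt_succ_iff.mp (by rwa [← Nat.cast_one, Cardinal.succ_natCast, Nat.cast_one, one_add_one_eq_two])
    have := h3.trans (add_le_add htrK hle)
    norm_num at this
  have hgen' : IntermediateField.adjoin K {φ Vx, φ Vy, φ Vz} = ⊤ := by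
    set M := IntermediateField.adjoin K {φ Vx, φ Vy, φ Vz} with hM
    have hψ : ψ.fieldRange ≤ M.restrictScalars ℂ := by
      rw [AlgHom.fieldRange_eq_map, ← adjoin_Vx_Vy_Vz, IntermediateField.adjoin_map,
        IntermediateField.adjoin_le_iff, Set.image_insert_eq, Set.image_pair]
      exact IntermediateField.subset_adjoin K {φ Vx, φ Vy, φ Vz}
    have hle : Algebra.adjoin K (Set.range φ) ≤ M.toSubalgebra := by
      rw [Algebra.adjoin_le_iff]
      rintro _ ⟨a, rfl⟩
      exact hψ ⟨a, rfl⟩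
    rw [hgen] at hle
    exact eq_top_iff.mpr fun a _ ↦ hle Algebra.mem_top
  have hf : φ Vx ^ 3 * φ Vy + φ Vy ^ 3 + φ Vz ^ 2 = algebraMap K L (algebraMap Cf K
      ⟨fE7, IntermediateField.subset_adjoin ℂ {fE7} rfl⟩) := by
    rw [← hφ]
    simp [fE7]
  have hft : Transcendental ℂ (algebraMap Cf K
      ⟨fE7, IntermediateField.subset_adjoin ℂ {fE7} rfl⟩) := by
    rw [transcendental_algebraMap_iff (algebraMap Cf K).injective]
    exact (transcendental_algebraMap_iff (algebraMap Cf Fxyz).injective).mp transcendental_fE7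
  constructor
  · rintro ⟨g, h, hgh⟩
    exact exists_root_of_rational htrK hft htr hgen' hf hgh
  · rintro ⟨ρ, hρ⟩
    refine exists_rational_of_root ℂ htr hgen' (ρ := ρ) ?_ (hρ ▸ hf)
    rintro rfl
    rw [← hρ] at hft
    exact hft (by simpa using isAlgebraic_zero)

theorem e7_rational_iff_root (K : Type) [Field K] [Algebra Cf K]
    [FiniteDimensional Cf K] (hL : IsField (K ⊗[Cf] Fxyz)) :
    letI : Field (K ⊗[Cf] Fxyz) := hL.toField
    ((∃ g h : K ⊗[Cf] Fxyz,
        Subfield.closure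
          (Set.range (algebraMap K (K ⊗[Cf] Fxyz)) ∪ {g, h}) = ⊤) ↔
      ∃ ρ : K, ρ ^ 18 = algebraMap Cf K ⟨fE7, IntermediateField.subset_adjoin ℂ {fE7} rfl⟩) := by
  let _ : Field (K ⊗[Cf] Fxyz) := hL.toField
  have key := rational_iff_root_of_ringHom (K := K) (L := K ⊗[Cf] Fxyz)
    (Algebra.TensorProduct.includeRight : Fxyz →ₐ[Cf] K ⊗[Cf] Fxyz).toRingHom
    (fun c ↦ (Algebra.TensorProduct.tmul_one_eq_one_tmul c).symm)
    (eq_top_iff.mpr fun a _ ↦ by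
      induction a using TensorProduct.induction_on with
      | zero => exact zero_mem _
      | add a b ha hb => exact add_mem (ha trivial) (hb trivial)
      | tmul k a =>
        rw [show k ⊗ₜ[Cf] a = k • (1 ⊗ₜ[Cf] a : K ⊗[Cf] Fxyz) by
          rw [TensorProduct.smul_tmul', smul_eq_mul, mul_one]]
        exact Subalgebra.smul_mem _ (Algebra.subset_adjoin (Set.mem_range_self a)) k)
  refine Iff.trans (exists₂_congr fun g h ↦ ?_) key
  rw [← IntermediateField.toSubfield_inj]
  rfl
end
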